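/- (Herman–Yoccoz) Any orientation-preserving C^∞ diffeomorphism f of the circle T = R/Z whose rotation number ρ(f) is Diophantine is C^∞-linearizable: there exists a C^∞ diffeomorphism h of T such that h∘f = T_{ρ(f)}∘h. -/

import Mathlib

open Filter Topology

/-- `ρ` is the rotation (translation) number of the lift `F`. -/
def IsRotNumber (F : ℝ → ℝ) (ρ : ℝ) : Prop :=
  ∀ x : ℝ, Tendsto (fun n : ℕ => (F^[n] x - x) / (n : ℝ)) atTop (𝓝 ρ)

/-- `α` is Diophantine with exponent `σ` and constant `γ`:
`|α - p/q| ≥ γ / q^(2+σ)` for all rationals `p/q`. -/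
def IsDiophantineWith (γ σ α : ℝ) : Prop :=
  ∀ (p : ℤ) (q : ℕ), 0 < q → γ / (q : ℝ) ^ ((2 : ℝ) + σ) ≤ |α - (p : ℝ) / (q : ℝ)|

/-- `α` is a Diophantine number. -/
def IsDiophantine (α : ℝ) : Prop :=
  ∃ γ > (0 : ℝ), ∃ σ ≥ (0 : ℝ), IsDiophantineWith γ σ α

/-- A lift of an orientation-preserving `C^∞` diffeomorphism of the circle `ℝ/ℤ`. -/
structure SmoothCircleDiffeoLift where
  toFun : ℝ → ℝ
  smooth : ContDiff ℝ (⊤ : ℕ∞) toFun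
  deriv_pos : ∀ x, 0 < deriv toFun x
  map_add_one : ∀ x, toFun (x + 1) = toFun x + 1

open scoped ContDiff

namespace HermanYoccoz

/-! ### Pointwise calculus estimates -/

lemma contDiff_iteratedDeriv {g : ℝ → ℝ} (hg : ContDiff ℝ ∞ g) (k : ℕ) :
    ContDiff ℝ ∞ (iteratedDeriv k g) := by
  rw [iteratedDeriv_eq_iterate]
  exact ContDiff.iterate_deriv k hg

lemma contDiff_deriv {g : ℝ → ℝ} (hg : ContDiff ℝ ∞ g) : ContDiff ℝ ∞ (deriv g) :=
  (contDiff_infty_iff_deriv.1 hg).2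

lemma differentiable_of_smooth {g : ℝ → ℝ} (hg : ContDiff ℝ ∞ g) : Differentiable ℝ g :=
  (contDiff_infty_iff_deriv.1 hg).1

lemma hasDerivAt_iteratedDeriv {g : ℝ → ℝ} (hg : ContDiff ℝ ∞ g) (k : ℕ) (x : ℝ) :
    HasDerivAt (iteratedDeriv k g) (iteratedDeriv (k + 1) g x) x := by
  rw [iteratedDeriv_succ]
  exact (differentiable_of_smooth (contDiff_iteratedDeriv hg k) x).hasDerivAt

lemma contDiffAt_nat {g : ℝ → ℝ} (hg : ContDiff ℝ ∞ g) (n : ℕ) (x : ℝ) :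
    ContDiffAt ℝ n g x :=
  (hg.of_le (by exact_mod_cast le_top)).contDiffAt

lemma abs_iteratedDeriv_mul_le {f g : ℝ → ℝ} (hf : ContDiff ℝ ∞ f) (hg : ContDiff ℝ ∞ g)
    {x A B lam : ℝ} (hA : 0 ≤ A) (hlam : 0 ≤ lam) (k : ℕ)
    (h₁ : ∀ j ≤ k, |iteratedDeriv j f x| ≤ A * lam ^ j)
    (h₂ : ∀ j ≤ k, |iteratedDeriv j g x| ≤ B * lam ^ j) :
    |iteratedDeriv k (fun y => f y * g y) x| ≤ 2 ^ k * A * B * lam ^ k := by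
  rw [iteratedDeriv_fun_mul (contDiffAt_nat hf k x) (contDiffAt_nat hg k x)]
  calc _ ≤ ∑ i ∈ Finset.range (k + 1),
        |(k.choose i : ℝ) * iteratedDeriv i f x * iteratedDeriv (k - i) g x| :=
        Finset.abs_sum_le_sum_abs _ _
    _ ≤ ∑ i ∈ Finset.range (k + 1), (k.choose i : ℝ) * (A * B * lam ^ k) := by
        refine Finset.sum_le_sum fun i hi => ?_
        have hi' : i ≤ k := Nat.lt_succ_iff.1 (Finset.mem_range.1 hi)
        rw [abs_mul, abs_mul, Nat.abs_cast, mul_assoc]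
        refine mul_le_mul_of_nonneg_left ?_ (Nat.cast_nonneg _)
        calc _ ≤ (A * lam ^ i) * (B * lam ^ (k - i)) :=
              mul_le_mul (h₁ i hi') (h₂ _ (Nat.sub_le _ _)) (abs_nonneg _) (by positivity)
          _ = A * B * (lam ^ i * lam ^ (k - i)) := by ring
          _ = A * B * lam ^ k := by rw [← pow_add, Nat.add_sub_cancel' hi']
    _ = _ := by
        rw [← Finset.sum_mul]
        have := Nat.sum_range_choose k
        have h2 : (∑ i ∈ Finset.range (k + 1), (k.choose i : ℝ)) = 2 ^ k := by exact_mod_cast this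
        rw [h2]; ring

lemma exists_bound_of_deriv_eq_mul (k : ℕ) (C : ℝ) :
    ∃ C' : ℝ, 1 ≤ C' ∧ ∀ φ g : ℝ → ℝ, ContDiff ℝ ∞ φ → ContDiff ℝ ∞ g →
      (∀ y, deriv g y = deriv φ y * g y) → ∀ x lam : ℝ, 0 ≤ lam →
      (∀ a, 1 ≤ a → a ≤ k → |iteratedDeriv a φ x| ≤ C * lam ^ a) →
      ∀ a ≤ k, |iteratedDeriv a g x| ≤ C' * |g x| * lam ^ a := by
  induction k with
  | zero =>
    refine ⟨1, le_rfl, fun φ g _ _ _ x lam _ _ a ha => ?_⟩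
    obtain rfl : a = 0 := by omega
    simp
  | succ k ih =>
    obtain ⟨C', hC', h⟩ := ih
    refine ⟨max C' (2 ^ k * max C 0 * C'), le_max_of_le_left hC',
      fun φ g hφ hg hd x lam hlam hb a ha => ?_⟩
    have key := h φ g hφ hg hd x lam hlam fun a h1 h2 => hb a h1 (by omega)
    rcases Nat.lt_or_ge a (k + 1) with h1 | h1
    · refine (key a (by omega)).trans ?_
      gcongr
      exact le_max_left _ _
    · obtain rfl : a = k + 1 := by omega
      have e : deriv g = fun y => deriv φ y * g y := funext hd
      rw [iteratedDeriv_succ', e]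
      have := abs_iteratedDeriv_mul_le (contDiff_deriv hφ) hg (x := x) (A := max C 0 * lam)
        (B := C' * |g x|) (by positivity) hlam k (fun j hj => ?_) key
      · refine this.trans ?_
        calc 2 ^ k * (max C 0 * lam) * (C' * |g x|) * lam ^ k
            = (2 ^ k * max C 0 * C') * |g x| * lam ^ (k + 1) := by ring
          _ ≤ _ := by
            gcongr
            exact le_max_right _ _
      · rw [← iteratedDeriv_succ']
        refine (hb (j + 1) (by omega) (by omega)).trans ?_
        calc C * lam ^ (j + 1) ≤ max C 0 * lam ^ (j + 1) := by
              gcongr; exact le_max_left _ _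
          _ = _ := by ring

lemma exists_bound_comp (k : ℕ) (B : ℝ) :
    ∃ C : ℝ, 1 ≤ C ∧ ∀ G f : ℝ → ℝ, ContDiff ℝ ∞ G → ContDiff ℝ ∞ f → ∀ x A lam : ℝ, 0 ≤ lam →
      (∀ j ≤ k, |iteratedDeriv j G (f x)| ≤ A) →
      (∀ b < k, |iteratedDeriv b (deriv f) x| ≤ B * lam ^ (b + 1)) →
      ∀ j ≤ k, |iteratedDeriv j (fun y => G (f y)) x| ≤ C * A * lam ^ j := by
  induction k with
  | zero =>
    refine ⟨1, le_rfl, fun G f _ _ x A lam _ h _ j hj => ?_⟩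
    obtain rfl : j = 0 := by omega
    simpa using h 0 le_rfl
  | succ k ih =>
    obtain ⟨C, hC, h⟩ := ih
    refine ⟨max C (2 ^ k * C * B), le_max_of_le_left hC,
      fun G f hG hf x A lam hlam h₁ h₂ j hj => ?_⟩
    have hA : 0 ≤ A := (abs_nonneg _).trans (h₁ 0 (by omega))
    rcases Nat.lt_or_ge j (k + 1) with hj1 | hj1
    · refine (h G f hG hf x A lam hlam (fun i hi => h₁ i (by omega))
        (fun b hb => h₂ b (by omega)) j (by omega)).trans ?_
      gcongr
      exact le_max_left _ _
    · obtain rfl : j = k + 1 := by omega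
      have e : deriv (fun y => G (f y)) = fun y => deriv G (f y) * deriv f y := by
        funext y
        exact ((differentiable_of_smooth hG (f y)).hasDerivAt.comp y
          (differentiable_of_smooth hf y).hasDerivAt).deriv
      rw [iteratedDeriv_succ', e]
      have key := h (deriv G) f (contDiff_deriv hG) hf x A lam hlam
        (fun i hi => by rw [← iteratedDeriv_succ']; exact h₁ _ (by omega))
        (fun b hb => h₂ b (by omega))
      refine (abs_iteratedDeriv_mul_le ((contDiff_deriv hG).comp hf) (contDiff_deriv hf)
        (A := C * A) (B := B * lam) (by positivity) hlam k key
        (fun b hb => (h₂ b (by omega)).trans (le_of_eq (by ring)))).trans ?_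
      calc 2 ^ k * (C * A) * (B * lam) * lam ^ k = (2 ^ k * C * B) * A * lam ^ (k + 1) := by ring
        _ ≤ _ := by gcongr; exact le_max_right _ _

lemma exists_bound_comp_sub (j : ℕ) {E : ℝ} (hE : 0 ≤ E) :
    ∃ C : ℝ, 1 ≤ C ∧ ∀ G F : ℝ → ℝ, ContDiff ℝ ∞ G → ContDiff ℝ ∞ F → ∀ x A ε : ℝ,
      ε ≤ E → (∀ i ≤ j + 1, ∀ y, |iteratedDeriv i G y| ≤ A) →
      (∀ i ≤ j, |iteratedDeriv i (fun y => F y - y) x| ≤ ε) →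
      ∀ i ≤ j, |iteratedDeriv i (fun y => G (F y) - G y) x| ≤ C * A * ε := by
  induction j with
  | zero =>
    refine ⟨1, le_rfl, fun G F hG hF x A ε hε h₁ h₂ i hi => ?_⟩
    obtain rfl : i = 0 := by omega
    have := Convex.norm_image_sub_le_of_norm_deriv_le (f := G) (C := A) (s := Set.univ)
      (fun y _ => differentiable_of_smooth hG y)
      (fun y _ => by simpa using h₁ 1 le_rfl y) convex_univ (Set.mem_univ x) (Set.mem_univ (F x))
    have h3 := h₂ 0 le_rfl
    have hA : 0 ≤ A := (abs_nonneg _).trans (h₁ 0 (by omega) x)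
    simp only [iteratedDeriv_zero, one_mul] at h3 ⊢
    exact this.trans (mul_le_mul_of_nonneg_left h3 hA)
  | succ j ih =>
    obtain ⟨C, hC, h⟩ := ih
    refine ⟨C + 2 ^ j * (C * E + 1), le_add_of_le_of_nonneg hC (by positivity),
      fun G F hG hF x A ε hε h₁ h₂ i hi => ?_⟩
    have hA : 0 ≤ A := (abs_nonneg _).trans (h₁ 0 (by omega) x)
    have hε0 : 0 ≤ ε := (abs_nonneg _).trans (h₂ 0 (by omega))
    rcases Nat.lt_or_ge i (j + 1) with hi1 | hi1
    · refine (h G F hG hF x A ε hε (fun i hi => h₁ i (by omega))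
        (fun b hb => h₂ b (by omega)) i (by omega)).trans ?_
      gcongr
      exact le_add_of_nonneg_right (by positivity)
    · obtain rfl : i = j + 1 := by omega
      have hG' := contDiff_deriv hG
      have hF' := contDiff_deriv hF
      have hFd : ContDiff ℝ ∞ (fun y => F y - y) := hF.sub contDiff_id
      have eF : deriv (fun y => F y - y) = fun y => deriv F y - 1 := by
        funext y
        exact ((differentiable_of_smooth hF y).hasDerivAt.sub (hasDerivAt_id y)).deriv
      have e : deriv (fun y => G (F y) - G y) =
          fun y => (deriv G (F y) - deriv G y) + deriv G (F y) * (deriv F y - 1) := by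
        funext y
        have := (((differentiable_of_smooth hG (F y)).hasDerivAt.comp y
          (differentiable_of_smooth hF y).hasDerivAt).sub
            (differentiable_of_smooth hG y).hasDerivAt).deriv
        refine Eq.trans this ?_
        ring
      have s1 : ContDiff ℝ ∞ (fun y => deriv G (F y)) := hG'.comp hF
      have s2 : ContDiff ℝ ∞ (fun y => deriv F y - 1) := hF'.sub contDiff_const
      have key := h (deriv G) F hG' hF x A ε hε
        (fun i hi y => by rw [← iteratedDeriv_succ']; exact h₁ _ (by omega) y)
        (fun b hb => h₂ b (by omega))
      rw [iteratedDeriv_succ', e, iteratedDeriv_fun_add (contDiffAt_nat (s1.sub hG') j x)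
        (contDiffAt_nat (s1.mul s2) j x)]
      have h3 : ∀ i ≤ j,
          |iteratedDeriv i (fun y => deriv G (F y)) x| ≤ ((C * E + 1) * A) * 1 ^ i := by
        intro i hi
        have e2 : (fun y => deriv G (F y)) = fun y => (deriv G (F y) - deriv G y) + deriv G y := by
          funext y; ring
        rw [e2, iteratedDeriv_fun_add (contDiffAt_nat (s1.sub hG') i x)
          (contDiffAt_nat hG' i x)]
        refine (abs_add_le _ _).trans ?_
        have h5 := h₁ (i + 1) (by omega) x
        rw [iteratedDeriv_succ'] at h5
        have h6 : C * A * ε ≤ C * A * E := by gcongr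
        have := key i hi
        rw [one_pow]
        linarith
      have h4 := abs_iteratedDeriv_mul_le s1 s2 (x := x) (A := (C * E + 1) * A) (B := ε) (lam := 1)
        (by positivity) zero_le_one j h3 (fun i hi => by
          rw [← eF, ← iteratedDeriv_succ', one_pow, mul_one]; exact h₂ _ (by omega))
      refine (abs_add_le _ _).trans ?_
      have := key j le_rfl
      rw [one_pow] at h4
      linarith

lemma exists_iteratedDeriv_le_of_nodes (j : ℕ) : ∀ (g : ℝ → ℝ), ContDiff ℝ ∞ g →
    ∀ (x : ℕ → ℝ) (d η : ℝ), 0 < d → (∀ i, i + 1 < 2 ^ j → x i + d ≤ x (i + 1)) →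
      (∀ i < 2 ^ j, |g (x i)| ≤ η) →
      ∃ ζ ∈ Set.Icc (x 0) (x (2 ^ j - 1)), |iteratedDeriv j g ζ| ≤ (2 / d) ^ j * η := by
  induction j with
  | zero =>
    intro g _ x d η _ _ h
    exact ⟨x 0, by simp, by simpa using h 0 (by simp)⟩
  | succ j ih =>
    intro g hg x d η hd hx h
    have hp : 2 ^ (j + 1) = 2 * 2 ^ j := by ring
    have H : ∀ i, ∃ y, i < 2 ^ j → x (2 * i) ≤ y ∧ y ≤ x (2 * i + 1) ∧ |deriv g y| ≤ 2 / d * η := by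
      intro i
      by_cases hi : i < 2 ^ j
      · have h1 := hx (2 * i) (by omega)
        obtain ⟨y, hy, hy'⟩ := exists_deriv_eq_slope g (show x (2 * i) < x (2 * i + 1) by linarith)
          hg.continuous.continuousOn (differentiable_of_smooth hg).differentiableOn
        refine ⟨y, fun _ => ⟨hy.1.le, hy.2.le, ?_⟩⟩
        have h2 := h (2 * i) (by omega)
        have h3 := h (2 * i + 1) (by omega)
        have h4 : |g (x (2 * i + 1)) - g (x (2 * i))| ≤ 2 * η :=
          (abs_sub _ _).trans (by linarith)
        rw [hy', abs_div, abs_of_pos (show 0 < x (2 * i + 1) - x (2 * i) by linarith),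
          div_mul_eq_mul_div]
        have : (0:ℝ) ≤ 2 * η := (abs_nonneg _).trans h4
        gcongr
        linarith
      · exact ⟨0, fun h => absurd h hi⟩
    choose y hy using H
    obtain ⟨ζ, hζ, hζ'⟩ := ih (deriv g) (contDiff_deriv hg) y d (2 / d * η) hd
      (fun i hi => by
        have h1 := (hy i (by omega)).2.1
        have h2 := (hy (i + 1) hi).1
        have h3 := hx (2 * i + 1) (by omega)
        rw [show 2 * (i + 1) = 2 * i + 1 + 1 by ring] at h2
        linarith) (fun i hi => (hy i hi).2.2)
    have hpos : 0 < 2 ^ j := by positivity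
    refine ⟨ζ, ⟨?_, ?_⟩, ?_⟩
    · exact ((hy 0 hpos).1.trans hζ.1)
    · have h1 := (hy (2 ^ j - 1) (by omega)).2.1
      rw [show 2 * (2 ^ j - 1) + 1 = 2 ^ (j + 1) - 1 by omega] at h1
      exact hζ.2.trans h1
    · rw [iteratedDeriv_succ']
      exact hζ'.trans (le_of_eq (by ring))

lemma exists_interpolation_bound (K : ℕ) {Λ : ℝ} (hΛ : 0 ≤ Λ) :
    ∃ C : ℝ, 1 ≤ C ∧ ∀ g : ℝ → ℝ, ContDiff ℝ ∞ g → ∀ (x : ℕ → ℝ) (a b d A B : ℝ), 0 < d →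
      b - a ≤ Λ * d → (∀ i, i + 1 < 2 ^ K → x i + d ≤ x (i + 1)) →
      (∀ i < 2 ^ K, x i ∈ Set.Icc a b) → (∀ i < 2 ^ K, |g (x i)| ≤ A) →
      (∀ y ∈ Set.Icc a b, |iteratedDeriv K g y| ≤ B) →
      ∀ j ≤ K, ∀ y ∈ Set.Icc a b,
        |iteratedDeriv j g y| ≤ C * (A * (d ^ j)⁻¹ + B * d ^ (K - j)) := by
  have main : ∀ i ≤ K, ∃ C : ℝ, 1 ≤ C ∧ ∀ g : ℝ → ℝ, ContDiff ℝ ∞ g →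
      ∀ (x : ℕ → ℝ) (a b d A B : ℝ), 0 < d →
      b - a ≤ Λ * d → (∀ i, i + 1 < 2 ^ K → x i + d ≤ x (i + 1)) →
      (∀ i < 2 ^ K, x i ∈ Set.Icc a b) → (∀ i < 2 ^ K, |g (x i)| ≤ A) →
      (∀ y ∈ Set.Icc a b, |iteratedDeriv K g y| ≤ B) →
      ∀ y ∈ Set.Icc a b,
        |iteratedDeriv (K - i) g y| ≤ C * (A * (d ^ (K - i))⁻¹ + B * d ^ i) := by
    intro i
    induction i with
    | zero =>
      refine fun _ => ⟨1, le_rfl, fun g _ x a b d A B hd _ _ _ hA hB y hy => ?_⟩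
      have hA0 : 0 ≤ A := (abs_nonneg _).trans (hA 0 (by positivity))
      have : 0 ≤ A * (d ^ K)⁻¹ := by positivity
      have := hB y hy
      simp only [Nat.sub_zero, pow_zero, mul_one, one_mul]
      linarith
    | succ i ih =>
      intro hi
      obtain ⟨C, hC, h⟩ := ih (by omega)
      set j := K - (i + 1) with hj
      have hj1 : K - i = j + 1 := by omega
      refine ⟨2 ^ j + Λ * C + 1, ?_, fun g hg x a b d A B hd hab hx hxI hA hB y hy => ?_⟩
      · have : (0:ℝ) < 2 ^ j := by positivity
        have : 0 ≤ Λ * C := by positivity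
        linarith
      have h1 := h g hg x a b d A B hd hab hx hxI hA hB
      rw [hj1] at h1
      have hA0 : 0 ≤ A := (abs_nonneg _).trans (hA 0 (by positivity))
      have hB0 : 0 ≤ B := (abs_nonneg _).trans (hB y hy)
      have hpow : 2 ^ j ≤ 2 ^ K := Nat.pow_le_pow_right (by norm_num) (by omega)
      have hpos : 0 < 2 ^ j := by positivity
      obtain ⟨ζ, hζ, hζ'⟩ := exists_iteratedDeriv_le_of_nodes j g hg x d A hd
        (fun i hi => hx i (by omega)) (fun i hi => hA i (by omega))
      have hζI : ζ ∈ Set.Icc a b :=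
        ⟨(hxI 0 (by omega)).1.trans hζ.1, hζ.2.trans (hxI _ (by omega)).2⟩
      have h2 := Convex.norm_image_sub_le_of_norm_hasDerivWithin_le
        (f := iteratedDeriv j g) (f' := iteratedDeriv (j + 1) g) (s := Set.Icc a b)
        (fun z _ => (hasDerivAt_iteratedDeriv hg j z).hasDerivWithinAt) h1 (convex_Icc a b) hζI hy
      rw [Real.norm_eq_abs, Real.norm_eq_abs] at h2
      have h3 : |y - ζ| ≤ Λ * d := by
        rw [abs_le]; constructor <;> linarith [hy.1, hy.2, hζI.1, hζI.2]
      have h4 : |iteratedDeriv j g y| ≤ |iteratedDeriv j g ζ| +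
          |iteratedDeriv j g y - iteratedDeriv j g ζ| := by
        have := abs_add_le (iteratedDeriv j g ζ) (iteratedDeriv j g y - iteratedDeriv j g ζ)
        rwa [add_sub_cancel] at this
      have h5 : C * (A * (d ^ (j + 1))⁻¹ + B * d ^ i) * |y - ζ| ≤
          C * (A * (d ^ (j + 1))⁻¹ + B * d ^ i) * (Λ * d) := by gcongr
      have h6 : C * (A * (d ^ (j + 1))⁻¹ + B * d ^ i) * (Λ * d) =
          (Λ * C) * (A * (d ^ j)⁻¹ + B * d ^ (i + 1)) := by
        field_simp
        ring
      have h7 : (2 / d) ^ j * A = 2 ^ j * (A * (d ^ j)⁻¹) := by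
        rw [div_pow]; field_simp
      have h8 : 0 ≤ B * d ^ (i + 1) := by positivity
      have h9 : 0 ≤ A * (d ^ j)⁻¹ := by positivity
      have h10 : 0 ≤ (2 ^ j : ℝ) * (B * d ^ (i + 1)) := by positivity
      nlinarith
  choose! C hC h using main
  refine ⟨1 + ∑ i ∈ Finset.range (K + 1), C i, ?_,
    fun g hg x a b d A B hd hab hx hxI hA hB j hj y hy => ?_⟩
  · have := Finset.sum_nonneg (s := Finset.range (K + 1)) (f := C) fun i hi =>
      zero_le_one.trans (hC i (by simpa [Nat.lt_succ_iff] using hi))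
    linarith
  · have h1 := h (K - j) (Nat.sub_le _ _) g hg x a b d A B hd hab hx hxI hA hB y hy
    rw [Nat.sub_sub_self hj] at h1
    refine h1.trans ?_
    have hA0 : 0 ≤ A := (abs_nonneg _).trans (hA 0 (by positivity))
    have hB0 : 0 ≤ B := (abs_nonneg _).trans (hB y hy)
    gcongr
    have := Finset.single_le_sum (s := Finset.range (K + 1)) (f := C) (fun i hi =>
      zero_le_one.trans (hC i (by simpa [Nat.lt_succ_iff] using hi)))
      (Finset.mem_range.2 (show K - j < K + 1 by omega))
    linarith

/-! ### Periodic functions -/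

lemma exists_abs_le_of_periodic {g : ℝ → ℝ} (hg : Continuous g) (hp : Function.Periodic g 1) :
    ∃ C : ℝ, 0 ≤ C ∧ ∀ x, |g x| ≤ C := by
  obtain ⟨C, hC⟩ := (isCompact_Icc (a := (0:ℝ)) (b := 1)).exists_bound_of_continuousOn
    hg.continuousOn
  refine ⟨C, (norm_nonneg _).trans (hC 0 (by simp)), fun x => ?_⟩
  obtain ⟨y, hy, hxy⟩ := hp.exists_mem_Ico₀ one_pos x
  rw [hxy]
  exact hC y ⟨hy.1, hy.2.le⟩

lemma exists_isMax_of_periodic {g : ℝ → ℝ} (hg : Continuous g) (hp : Function.Periodic g 1) :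
    ∃ x, ∀ y, g y ≤ g x := by
  obtain ⟨x, _, hx⟩ := (isCompact_Icc (a := (0:ℝ)) (b := 1)).exists_isMaxOn
    (Set.nonempty_Icc.2 zero_le_one) hg.continuousOn
  refine ⟨x, fun y => ?_⟩
  obtain ⟨z, hz, hyz⟩ := hp.exists_mem_Ico₀ one_pos y
  rw [hyz]
  exact hx ⟨hz.1, hz.2.le⟩

lemma exists_isMin_of_periodic {g : ℝ → ℝ} (hg : Continuous g) (hp : Function.Periodic g 1) :
    ∃ x, ∀ y, g x ≤ g y := by
  obtain ⟨x, hx⟩ := exists_isMax_of_periodic (g := fun x => - g x) hg.neg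
    (fun x => by simp only [hp x])
  exact ⟨x, fun y => by linarith [hx y]⟩

lemma iteratedDeriv_periodic {g : ℝ → ℝ} (hp : Function.Periodic g 1) (k : ℕ) :
    Function.Periodic (iteratedDeriv k g) 1 := by
  intro x
  have := congrFun (iteratedDeriv_comp_add_const (f := g) k 1) x
  rw [← this]
  congr 1
  funext y
  exact hp y

lemma exists_abs_iteratedDeriv_le_of_periodic {g : ℝ → ℝ} (hg : ContDiff ℝ ∞ g)
    (hp : Function.Periodic g 1) (k : ℕ) :
    ∃ C : ℝ, 0 ≤ C ∧ ∀ j ≤ k, ∀ x, |iteratedDeriv j g x| ≤ C := by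
  choose C h0 hC using fun j => exists_abs_le_of_periodic
    (contDiff_iteratedDeriv hg j).continuous (iteratedDeriv_periodic hp j)
  refine ⟨∑ j ∈ Finset.range (k + 1), C j, Finset.sum_nonneg fun _ _ => h0 _, fun j hj x => ?_⟩
  exact (hC j x).trans (Finset.single_le_sum (fun i _ => h0 i)
    (Finset.mem_range.2 (Nat.lt_succ_of_le hj)))

/-! ### Iterates and the logarithmic derivative cocycle -/

section cocycle

variable (f : SmoothCircleDiffeoLift)

/-- The lift as a degree one monotone map. -/
noncomputable def toDeg1 : CircleDeg1Lift where
  toFun := f.toFun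
  monotone' := (strictMono_of_deriv_pos f.deriv_pos).monotone
  map_add_one' := f.map_add_one

/-- `log D(f^l)`, written as a Birkhoff sum. -/
noncomputable def phi (l : ℕ) (x : ℝ) : ℝ :=
  ∑ i ∈ Finset.range l, Real.log (deriv f.toFun (f.toFun^[i] x))

lemma smooth_iterate (l : ℕ) : ContDiff ℝ ∞ (f.toFun^[l]) := by
  induction l with
  | zero => exact contDiff_id
  | succ l ih => rw [Function.iterate_succ']; exact f.smooth.comp ih

lemma iterate_strictMono (l : ℕ) : StrictMono (f.toFun^[l]) :=
  (strictMono_of_deriv_pos f.deriv_pos).iterate l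

lemma iterate_eq_pow (l : ℕ) (x : ℝ) : f.toFun^[l] x = (toDeg1 f ^ l) x := by
  rw [CircleDeg1Lift.coe_pow]; rfl

lemma iterate_add_int (l : ℕ) (x : ℝ) (k : ℤ) : f.toFun^[l] (x + k) = f.toFun^[l] x + k := by
  rw [iterate_eq_pow, iterate_eq_pow, CircleDeg1Lift.map_add_int]

lemma iterate_add_one (l : ℕ) (x : ℝ) : f.toFun^[l] (x + 1) = f.toFun^[l] x + 1 := by
  exact_mod_cast iterate_add_int f l x 1

lemma bijective_toFun : Function.Bijective f.toFun := by
  refine ⟨(strictMono_of_deriv_pos f.deriv_pos).injective, ?_⟩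
  exact (CircleDeg1Lift.continuous_iff_surjective (f := toDeg1 f)).1 f.smooth.continuous

lemma deriv_periodic : Function.Periodic (deriv f.toFun) 1 := by
  intro x
  have h := deriv_comp_add_const f.toFun 1 x
  rw [← h]
  have : (fun y => f.toFun (y + 1)) = fun y => f.toFun y + 1 := funext f.map_add_one
  rw [this, deriv_add_const]

lemma smooth_logDeriv : ContDiff ℝ ∞ (fun x => Real.log (deriv f.toFun x)) :=
  (contDiff_deriv f.smooth).log fun x => (f.deriv_pos x).ne'

lemma smooth_phi (l : ℕ) : ContDiff ℝ ∞ (phi f l) := by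
  unfold phi
  exact ContDiff.sum fun i _ => (smooth_logDeriv f).comp (smooth_iterate f i)

lemma phi_zero : phi f 0 = fun _ => 0 := by funext x; simp [phi]

lemma phi_one (x : ℝ) : phi f 1 x = Real.log (deriv f.toFun x) := by simp [phi]

lemma phi_add (a b : ℕ) (x : ℝ) : phi f (a + b) x = phi f a (f.toFun^[b] x) + phi f b x := by
  unfold phi
  rw [add_comm a b, Finset.sum_range_add, add_comm]
  congr 1
  refine Finset.sum_congr rfl fun i _ => ?_
  rw [add_comm b i, Function.iterate_add_apply]

lemma phi_add_int (l : ℕ) (x : ℝ) (k : ℤ) : phi f l (x + k) = phi f l x := by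
  unfold phi
  refine Finset.sum_congr rfl fun i _ => ?_
  rw [iterate_add_int]
  congr 1
  simpa using ((deriv_periodic f).int_mul k) (f.toFun^[i] x)

lemma phi_periodic (l : ℕ) : Function.Periodic (phi f l) 1 := fun x => by
  exact_mod_cast phi_add_int f l x 1

lemma phi_sub_int (l : ℕ) (x : ℝ) (k : ℤ) : phi f l (x - k) = phi f l x := by
  have := phi_add_int f l x (-k)
  rw [← this]; push_cast; rfl

lemma hasDerivAt_iterate (l : ℕ) (x : ℝ) :
    HasDerivAt (f.toFun^[l]) (Real.exp (phi f l x)) x := by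
  induction l with
  | zero => simpa [phi] using hasDerivAt_id x
  | succ l ih =>
    have h1 := (differentiable_of_smooth f.smooth (f.toFun^[l] x)).hasDerivAt.comp x ih
    rw [add_comm, phi_add, Real.exp_add, phi_one, Real.exp_log (f.deriv_pos _), add_comm,
      Function.iterate_succ']
    exact h1

lemma deriv_iterate (l : ℕ) : deriv (f.toFun^[l]) = fun x => Real.exp (phi f l x) :=
  funext fun x => (hasDerivAt_iterate f l x).deriv

lemma hasDerivAt_phi (l : ℕ) (x : ℝ) : HasDerivAt (phi f l) (deriv (phi f l) x) x :=
  (differentiable_of_smooth (smooth_phi f l) x).hasDerivAt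

lemma hasDerivAt_deriv_phi (l : ℕ) (x : ℝ) :
    HasDerivAt (deriv (phi f l)) (deriv (deriv (phi f l)) x) x :=
  (differentiable_of_smooth (contDiff_deriv (smooth_phi f l)) x).hasDerivAt

lemma deriv_phi_periodic (l : ℕ) : Function.Periodic (deriv (phi f l)) 1 := by
  simpa using iteratedDeriv_periodic (phi_periodic f l) 1

lemma deriv_phi_add_int (l : ℕ) (x : ℝ) (k : ℤ) :
    deriv (phi f l) (x + k) = deriv (phi f l) x := by
  simpa using ((deriv_phi_periodic f l).int_mul k) x

lemma deriv_phi_add (a b : ℕ) (x : ℝ) : deriv (phi f (a + b)) x =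
    deriv (phi f a) (f.toFun^[b] x) * Real.exp (phi f b x) + deriv (phi f b) x := by
  have h := ((hasDerivAt_phi f a (f.toFun^[b] x)).comp x (hasDerivAt_iterate f b x)).add
    (hasDerivAt_phi f b x)
  have e : phi f (a + b) = (phi f a ∘ f.toFun^[b]) + phi f b := funext fun y => phi_add f a b y
  rw [e]
  exact h.deriv

/-- The Schwarzian derivative of `f^l`. -/
noncomputable def schwarz (l : ℕ) (x : ℝ) : ℝ :=
  deriv (deriv (phi f l)) x - deriv (phi f l) x ^ 2 / 2

lemma schwarz_add (a b : ℕ) (x : ℝ) : schwarz f (a + b) x =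
    schwarz f a (f.toFun^[b] x) * Real.exp (phi f b x) ^ 2 + schwarz f b x := by
  have e : deriv (phi f (a + b)) = fun x =>
      deriv (phi f a) (f.toFun^[b] x) * Real.exp (phi f b x) + deriv (phi f b) x :=
    funext fun y => deriv_phi_add f a b y
  have h : HasDerivAt (deriv (phi f (a + b)))
      (deriv (deriv (phi f a)) (f.toFun^[b] x) * Real.exp (phi f b x) * Real.exp (phi f b x)
        + deriv (phi f a) (f.toFun^[b] x) * (Real.exp (phi f b x) * deriv (phi f b) x)
        + deriv (deriv (phi f b)) x) x := by
    rw [e]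
    exact (((hasDerivAt_deriv_phi f a (f.toFun^[b] x)).comp x (hasDerivAt_iterate f b x)).mul
      (hasDerivAt_phi f b x).exp).add (hasDerivAt_deriv_phi f b x)
  unfold schwarz
  rw [h.deriv, deriv_phi_add]
  ring

lemma schwarz_zero (x : ℝ) : schwarz f 0 x = 0 := by
  simp [schwarz, phi_zero]

lemma schwarz_eq_sum (l : ℕ) (x : ℝ) : schwarz f l x =
    ∑ i ∈ Finset.range l, schwarz f 1 (f.toFun^[i] x) * Real.exp (phi f i x) ^ 2 := by
  induction l with
  | zero => simp [schwarz_zero]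
  | succ l ih => rw [Finset.sum_range_succ, ← ih, add_comm l 1, schwarz_add, add_comm]

lemma smooth_schwarz (l : ℕ) : ContDiff ℝ ∞ (schwarz f l) := by
  unfold schwarz
  have h := contDiff_deriv (smooth_phi f l)
  exact (contDiff_deriv h).sub ((h.pow 2).div_const 2)

lemma schwarz_periodic (l : ℕ) : Function.Periodic (schwarz f l) 1 := by
  intro x
  unfold schwarz
  have := iteratedDeriv_periodic (phi_periodic f l) 2 x
  simp only [iteratedDeriv_succ, iteratedDeriv_zero] at this
  rw [this, deriv_phi_periodic f l x]

/-! ### Rotation number and order -/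

variable {f} {α : ℝ}

lemma translationNumber_eq (hρ : IsRotNumber f.toFun α) :
    CircleDeg1Lift.translationNumber (toDeg1 f) = α := by
  have h1 := (toDeg1 f).tendsto_translationNumber 0
  have h2 := hρ 0
  simp only [iterate_eq_pow] at h2
  exact tendsto_nhds_unique h1 h2

lemma iterate_lt_add (hρ : IsRotNumber f.toFun α) {l : ℕ} {k : ℤ} (h : l * α < k) (x : ℝ) :
    f.toFun^[l] x < x + k := by
  rw [iterate_eq_pow]
  apply CircleDeg1Lift.map_lt_of_translationNumber_lt_int
  rw [CircleDeg1Lift.translationNumber_pow, translationNumber_eq hρ]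
  exact h

lemma add_lt_iterate (hρ : IsRotNumber f.toFun α) {l : ℕ} {k : ℤ} (h : k < l * α) (x : ℝ) :
    x + k < f.toFun^[l] x := by
  rw [iterate_eq_pow]
  apply CircleDeg1Lift.lt_map_of_int_lt_translationNumber
  rw [CircleDeg1Lift.translationNumber_pow, translationNumber_eq hρ]
  exact h

lemma abs_iterate_sub_le (hρ : IsRotNumber f.toFun α) (l : ℕ) (x : ℝ) :
    |f.toFun^[l] x - x - l * α| ≤ 1 := by
  have h1 := (toDeg1 f ^ l).map_lt_add_translationNumber_add_one x
  rw [CircleDeg1Lift.translationNumber_pow, translationNumber_eq hρ, ← iterate_eq_pow] at h1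
  have h2 : ((⌈l * α⌉ - 1 : ℤ) : ℝ) < l * α := by
    push_cast
    linarith [Int.ceil_lt_add_one (l * α)]
  have h3 := add_lt_iterate hρ h2 x
  push_cast at h3
  rw [abs_le]
  constructor <;> linarith [Int.le_ceil (l * α)]

end cocycle

/-! ### Best rational approximations -/

/-- The sequence of best approximations `p n / q n` of an irrational number `α`. -/
structure Convergents (α : ℝ) where
  q : ℕ → ℕ
  p : ℕ → ℤ
  q_pos : ∀ n, 0 < q n
  q_lt : ∀ n, q n < q (n + 1)
  lt_abs : ∀ n j, 0 < j → j < q n → ∀ k : ℤ, |q n * α - p n| < |j * α - k|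
  le_abs : ∀ n j, 0 < j → j < q (n + 1) → ∀ k : ℤ, |q n * α - p n| ≤ |j * α - k|
  abs_le_round : ∀ n (k : ℤ), |q n * α - p n| ≤ |q n * α - k|
  abs_lt : ∀ n, |q (n + 1) * α - p (n + 1)| < |q n * α - p n|
  ne_zero : ∀ n, q n * α - p n ≠ 0
  mul_abs_le : ∀ n, q (n + 1) * |q n * α - p n| ≤ 1

lemma exists_pow_le_of_isDiophantine {α : ℝ} (h : IsDiophantine α) :
    ∃ γ > (0 : ℝ), ∃ τ : ℕ, 1 ≤ τ ∧ ∀ (q : ℕ) (p : ℤ), 0 < q → γ / (q : ℝ) ^ τ ≤ |q * α - p| := by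
  obtain ⟨γ, hγ, σ, hσ, h⟩ := h
  refine ⟨γ, hγ, ⌈1 + σ⌉₊, Nat.one_le_iff_ne_zero.2 (Nat.pos_iff_ne_zero.1
    (Nat.ceil_pos.2 (by linarith))), fun q p hq => ?_⟩
  have hq1 : (1 : ℝ) ≤ q := by exact_mod_cast hq
  have hq0 : (0 : ℝ) < q := by linarith
  have h1 := h p q hq
  have h2 : |q * α - p| = q * |α - p / q| := by
    rw [← abs_of_pos hq0, ← abs_mul, abs_of_pos hq0]
    congr 1
    field_simp
  rw [h2]
  calc γ / (q : ℝ) ^ ⌈1 + σ⌉₊ ≤ γ / (q : ℝ) ^ (1 + σ) := by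
        gcongr
        rw [← Real.rpow_natCast]
        exact Real.rpow_le_rpow_of_exponent_le hq1 (Nat.le_ceil _)
    _ = q * (γ / (q : ℝ) ^ (2 + σ)) := by
        rw [show (2 : ℝ) + σ = (1 + σ) + 1 by ring, Real.rpow_add hq0 (1 + σ), Real.rpow_one]
        field_simp
    _ ≤ _ := by gcongr

lemma exists_convergents {α : ℝ} (hirr : ∀ (q : ℕ) (p : ℤ), 0 < q → (q : ℝ) * α - p ≠ 0) :
    ∃ c : Convergents α, c.q 0 = 1 := by
  set dist : ℕ → ℝ := fun j => |j * α - round (j * α)| with hdist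
  have hle : ∀ (j : ℕ) (k : ℤ), dist j ≤ |j * α - k| := fun j k => round_le _ _
  have hpos : ∀ j, 0 < j → 0 < dist j := fun j hj => abs_pos.2 (hirr _ _ hj)
  have hex : ∀ Q : ℕ, ∃ j, 0 < Q → 0 < j ∧ dist j < dist Q := by
    intro Q
    by_cases hQ : 0 < Q
    · obtain ⟨n, hn⟩ := exists_nat_one_div_lt (hpos Q hQ)
      obtain ⟨k, hk, -, h⟩ := Real.exists_nat_abs_mul_sub_round_le α (Nat.succ_pos n)
      refine ⟨k, fun _ => ⟨hk, h.trans_lt (lt_of_le_of_lt ?_ hn)⟩⟩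
      push_cast
      gcongr
      linarith
    · exact ⟨0, fun h => absurd h hQ⟩
  have hnxt : ∀ Q : ℕ, ∃ j, 0 < Q → 0 < j ∧ dist j < dist Q ∧
      ∀ i, 0 < i → i < j → dist Q ≤ dist i := by
    intro Q
    by_cases hQ : 0 < Q
    · classical
      refine ⟨Nat.find (hex Q), fun _ => ⟨(Nat.find_spec (hex Q) hQ).1,
        (Nat.find_spec (hex Q) hQ).2, fun i hi hij => ?_⟩⟩
      by_contra! hc
      exact Nat.find_min (hex Q) hij fun _ => ⟨hi, hc⟩
    · exact ⟨0, fun h => absurd h hQ⟩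
  choose nxt hn using hnxt
  obtain ⟨q, hq0, hqs⟩ : ∃ q : ℕ → ℕ, q 0 = 1 ∧ ∀ n, q (n + 1) = nxt (q n) :=
    ⟨fun n => Nat.rec 1 (fun _ Q => nxt Q) n, rfl, fun n => rfl⟩
  have hqpos : ∀ n, 0 < q n := by
    intro n
    induction n with
    | zero => simp [hq0]
    | succ n ih => rw [hqs]; exact (hn (q n) ih).1
  have hdlt : ∀ n, dist (q (n + 1)) < dist (q n) := fun n => by
    rw [hqs]; exact (hn (q n) (hqpos n)).2.1
  have hmin : ∀ n j, 0 < j → j < q (n + 1) → dist (q n) ≤ dist j := by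
    intro n j hj hjq
    rw [hqs] at hjq
    exact (hn (q n) (hqpos n)).2.2 j hj hjq
  have hbest : ∀ n j, 0 < j → j < q n → dist (q n) < dist j := by
    intro n j hj hjq
    cases n with
    | zero => rw [hq0] at hjq; omega
    | succ n => exact (hdlt n).trans_le (hmin n j hj hjq)
  have hqlt : ∀ n, q n < q (n + 1) := by
    intro n
    refine lt_of_not_ge fun hc => ?_
    rcases hc.lt_or_eq with h | h
    · exact (hbest n _ (hqpos _) h).asymm (hdlt n)
    · exact (hdlt n).ne (by rw [h])
  refine ⟨⟨q, fun n => round (q n * α), hqpos, hqlt, fun n j hj hjq k => ?_,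
    fun n j hj hjq k => (hmin n j hj hjq).trans (hle j k), fun n k => hle _ k, hdlt,
    fun n => hirr _ _ (hqpos n), fun n => ?_⟩, hq0⟩
  · exact (hbest n j hj hjq).trans_le (hle j k)
  · have h2 : 0 < q (n + 1) - 1 := by have := hqlt n; have := hqpos n; omega
    obtain ⟨k, hk, hk', h⟩ := Real.exists_nat_abs_mul_sub_round_le α h2
    have h3 := (hmin n k hk (by omega)).trans h
    have h4 : ((q (n + 1) - 1 : ℕ) : ℝ) + 1 = q (n + 1) := by
      rw [Nat.cast_sub (by omega)]; simp
    rw [h4] at h3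
    have h5 : (0 : ℝ) < q (n + 1) := by exact_mod_cast hqpos _
    rw [le_div_iff₀ h5] at h3
    linarith

namespace Convergents

variable {α : ℝ} (c : Convergents α)

/-- The signed error `q n α - p n`. -/
noncomputable def a (n : ℕ) : ℝ := c.q n * α - c.p n

/-- The distance from `q n α` to `p n`. -/
noncomputable def err (n : ℕ) : ℝ := |c.a n|

lemma err_pos (n : ℕ) : 0 < c.err n := abs_pos.2 (c.ne_zero n)

lemma a_ne_zero (n : ℕ) : c.a n ≠ 0 := c.ne_zero n

lemma err_succ_lt (n : ℕ) : c.err (n + 1) < c.err n := c.abs_lt n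

lemma a_mul_neg (n : ℕ) : c.a n * c.a (n + 1) < 0 := by
  by_contra! h
  have h0 := c.a_ne_zero n
  have h1 := c.a_ne_zero (n + 1)
  have hpos : 0 < c.a n * c.a (n + 1) := lt_of_le_of_ne h (mul_ne_zero h0 h1).symm
  have hl := c.q_lt n
  have hq := c.q_pos n
  have h2 := c.le_abs n (c.q (n + 1) - c.q n) (by omega) (by omega) (c.p (n + 1) - c.p n)
  have h3 : ((c.q (n + 1) - c.q n : ℕ) : ℝ) * α - ((c.p (n + 1) - c.p n : ℤ) : ℝ)
      = c.a (n + 1) - c.a n := by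
    rw [Nat.cast_sub hl.le]; push_cast; unfold a; ring
  rw [h3] at h2
  change |c.a n| ≤ _ at h2
  have h4 : |c.a (n + 1)| < |c.a n| := c.abs_lt n
  rcases pos_and_pos_or_neg_and_neg_of_mul_pos hpos with ⟨h5, h6⟩ | ⟨h5, h6⟩
  · rw [abs_of_pos h5, abs_of_pos h6] at h4
    rw [abs_of_pos h5, abs_of_neg (by linarith)] at h2
    linarith
  · rw [abs_of_neg h5, abs_of_neg h6] at h4
    rw [abs_of_neg h5, abs_of_pos (by linarith)] at h2
    linarith

lemma err_add_le (n : ℕ) : c.err (n + 1) + c.err (n + 2) ≤ c.err n := by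
  have s1 := c.a_mul_neg n
  have s2 := c.a_mul_neg (n + 1)
  have l1 := c.err_succ_lt n
  have l2 := c.err_succ_lt (n + 1)
  have hsum : |c.a n + c.a (n + 1)| = c.err n - c.err (n + 1) := by
    unfold err at *
    rcases lt_or_gt_of_ne (c.a_ne_zero n) with h | h
    · have h' : 0 < c.a (n + 1) := by nlinarith
      rw [abs_of_neg h, abs_of_pos h'] at *
      rw [abs_of_neg (by linarith)]; linarith
    · have h' : c.a (n + 1) < 0 := by nlinarith
      rw [abs_of_pos h, abs_of_neg h'] at *
      rw [abs_of_pos (by linarith)]; linarith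
  have e1 : ((c.q n + c.q (n + 1) : ℕ) : ℝ) * α - ((c.p n + c.p (n + 1) : ℤ) : ℝ)
      = c.a n + c.a (n + 1) := by push_cast; unfold a; ring
  rcases lt_trichotomy (c.q n + c.q (n + 1)) (c.q (n + 2)) with h | h | h
  · have := c.le_abs (n + 1) (c.q n + c.q (n + 1)) (by have := c.q_pos n; omega) h
      (c.p n + c.p (n + 1))
    rw [e1, hsum] at this
    change c.err (n + 1) ≤ _ at this
    linarith
  · have := c.abs_le_round (n + 2) (c.p n + c.p (n + 1))
    rw [← h, e1, hsum] at this
    have h2 : c.err (n + 2) = |((c.q n + c.q (n + 1) : ℕ) : ℝ) * α - c.p (n + 2)| := by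
      unfold err a; rw [h]
    rw [← h2] at this
    linarith
  · exfalso
    have hq2 : c.q (n + 1) < c.q (n + 2) := c.q_lt (n + 1)
    have := c.lt_abs n (c.q n + c.q (n + 1) - c.q (n + 2)) (by omega)
      (by omega) (c.p n + c.p (n + 1) - c.p (n + 2))
    have e2 : ((c.q n + c.q (n + 1) - c.q (n + 2) : ℕ) : ℝ) * α -
        ((c.p n + c.p (n + 1) - c.p (n + 2) : ℤ) : ℝ) = c.a n + c.a (n + 1) - c.a (n + 2) := by
      rw [Nat.cast_sub h.le]; push_cast; unfold a; ring
    rw [e2] at this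
    change |c.a n| < _ at this
    unfold err at *
    rcases lt_or_gt_of_ne (c.a_ne_zero n) with h | h
    · have h' : 0 < c.a (n + 1) := by nlinarith
      have h'' : c.a (n + 2) < 0 := by nlinarith
      rw [abs_of_neg h, abs_of_pos h'] at *
      rw [abs_of_neg h''] at *
      rcases abs_cases (c.a n + c.a (n + 1) - c.a (n + 2)) with h7 | h7 <;> linarith
    · have h' : c.a (n + 1) < 0 := by nlinarith
      have h'' : 0 < c.a (n + 2) := by nlinarith
      rw [abs_of_pos h, abs_of_neg h'] at *
      rw [abs_of_pos h''] at *
      rcases abs_cases (c.a n + c.a (n + 1) - c.a (n + 2)) with h7 | h7 <;> linarith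

lemma q_mul_err_le (n : ℕ) : c.q (n + 1) * c.err n ≤ 1 := c.mul_abs_le n

lemma half_le_q_mul_err (n : ℕ) : 1 / 2 ≤ c.q (n + 1) * c.err n := by
  have s1 := c.a_mul_neg n
  have l1 := c.err_succ_lt n
  have hq : (c.q n : ℝ) ≤ c.q (n + 1) := by exact_mod_cast (c.q_lt n).le
  have hq0 : (0 : ℝ) < c.q n := by exact_mod_cast c.q_pos n
  have h1 : c.q (n + 1) * c.err n + c.q n * c.err (n + 1)
      = |((c.q n * c.p (n + 1) - c.q (n + 1) * c.p n : ℤ) : ℝ)| := by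
    have : ((c.q n * c.p (n + 1) - c.q (n + 1) * c.p n : ℤ) : ℝ)
        = c.q (n + 1) * c.a n - c.q n * c.a (n + 1) := by
      push_cast; unfold a; ring
    rw [this]
    unfold err
    rcases lt_or_gt_of_ne (c.a_ne_zero n) with h | h
    · have h' : 0 < c.a (n + 1) := by nlinarith
      rw [abs_of_neg h, abs_of_pos h', abs_of_neg (by nlinarith)]; ring
    · have h' : c.a (n + 1) < 0 := by nlinarith
      rw [abs_of_pos h, abs_of_neg h', abs_of_pos (by nlinarith)]; ring
  have p1 := c.err_pos n
  have p2 := c.err_pos (n + 1)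
  have h2 : (1 : ℝ) ≤ |((c.q n * c.p (n + 1) - c.q (n + 1) * c.p n : ℤ) : ℝ)| := by
    have hpos : (0 : ℝ) < |((c.q n * c.p (n + 1) - c.q (n + 1) * c.p n : ℤ) : ℝ)| := by
      rw [← h1]; nlinarith
    have hne : (c.q n * c.p (n + 1) - c.q (n + 1) * c.p n : ℤ) ≠ 0 := by
      intro h0; rw [h0] at hpos; simp at hpos
    exact_mod_cast Int.one_le_abs hne
  rw [← h1] at h2
  nlinarith

lemma q_strictMono : StrictMono c.q := strictMono_nat_of_lt_succ c.q_lt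

lemma err_antitone : Antitone c.err := antitone_nat_of_succ_le fun n => (c.err_succ_lt n).le

end Convergents

/-! ### Disjointness modulo one -/

lemma sum_length_le_one (n : ℕ) (u v : ℕ → ℝ) (huv : ∀ i < n, u i ≤ v i)
    (hd : ∀ i < n, ∀ j < n, ∀ k : ℤ, ∀ t, t ∈ Set.Ioo (u i) (v i) →
      t + k ∈ Set.Ioo (u j) (v j) → i = j ∧ k = 0) :
    ∑ i ∈ Finset.range n, (v i - u i) ≤ 1 := by
  by_contra! hlt
  set T : Set ℝ := ⋃ i ∈ Finset.range n, Set.Ioo (u i) (v i) with hT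
  have hvol : MeasureTheory.volume T = ENNReal.ofReal (∑ i ∈ Finset.range n, (v i - u i)) := by
    rw [hT, MeasureTheory.measure_biUnion_finset]
    · rw [ENNReal.ofReal_sum_of_nonneg]
      · simp
      · intro i hi
        exact sub_nonneg.2 (huv i (Finset.mem_range.1 hi))
    · intro i hi j hj hij
      rw [Function.onFun, Set.disjoint_left]
      intro t ht ht'
      exact hij (hd i (by simpa using hi) j (by simpa using hj) 0 t ht (by simpa using ht')).1
    · exact fun i _ => measurableSet_Ioo
  have hm : MeasureTheory.NullMeasurableSet T :=
    (Finset.measurableSet_biUnion _ fun i _ => measurableSet_Ioo).nullMeasurableSet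
  obtain ⟨x, hx, y, hy, g, hg, hgxy⟩ :=
    (isAddFundamentalDomain_Ioc (one_pos : (0:ℝ) < 1) 0).exists_ne_zero_vadd_eq hm (by
      rw [hvol, Real.volume_Ioc]
      exact (ENNReal.ofReal_lt_ofReal_iff (by linarith)).2 (by simpa using hlt))
  obtain ⟨k, hk⟩ := AddSubgroup.mem_zmultiples_iff.1 g.2
  simp only [hT, Set.mem_iUnion, Finset.mem_range] at hx hy
  obtain ⟨i, hi, hxi⟩ := hx
  obtain ⟨j, hj, hyj⟩ := hy
  have e : x + k = y := by
    rw [← hgxy]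
    change x + k = (g : ℝ) + x
    rw [← hk]; simp [add_comm]
  have := (hd i hi j hj k x hxi (by rw [e]; exact hyj)).2
  apply hg
  ext
  rw [← hk, this]; simp

/-! ### Return maps -/

/-- The map `f^q - p`. -/
noncomputable def ret (f : SmoothCircleDiffeoLift) (q : ℕ) (p : ℤ) (x : ℝ) : ℝ :=
  f.toFun^[q] x - p

section ret

variable (f : SmoothCircleDiffeoLift) (q : ℕ) (p : ℤ)

lemma ret_strictMono : StrictMono (ret f q p) := fun _ _ h =>
  sub_lt_sub_right (iterate_strictMono f q h) _

lemma ret_add_int (x : ℝ) (k : ℤ) : ret f q p (x + k) = ret f q p x + k := by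
  unfold ret; rw [iterate_add_int]; ring

lemma ret_iterate (l : ℕ) (x : ℝ) : ret f q p (f.toFun^[l] x) = f.toFun^[l] (ret f q p x) := by
  unfold ret
  have := iterate_add_int f l (f.toFun^[q] x) (-p)
  push_cast at this
  rw [sub_eq_add_neg (f.toFun^[q] x), this, ← Function.iterate_add_apply,
    ← Function.iterate_add_apply, add_comm q l]; ring

lemma ret_comm (q' : ℕ) (p' : ℤ) (x : ℝ) :
    ret f q p (ret f q' p' x) = ret f q' p' (ret f q p x) := by
  conv_rhs => rw [ret, ← ret_iterate]
  have := ret_add_int f q p (f.toFun^[q'] x) (-p')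
  push_cast at this
  change ret f q p (f.toFun^[q'] x - p') = _
  rw [sub_eq_add_neg, this]; rfl

lemma smooth_ret : ContDiff ℝ ∞ (ret f q p) := (smooth_iterate f q).sub contDiff_const

lemma hasDerivAt_ret (x : ℝ) : HasDerivAt (ret f q p) (Real.exp (phi f q x)) x :=
  (hasDerivAt_iterate f q x).sub_const _

lemma phi_ret (l : ℕ) (x : ℝ) : phi f l (ret f q p x) = phi f l (f.toFun^[q] x) :=
  phi_sub_int f l _ p

lemma phi_iterate_sub (l : ℕ) (x : ℝ) :
    phi f q (f.toFun^[l] x) - phi f q x = phi f l (ret f q p x) - phi f l x := by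
  rw [phi_ret]
  have h1 := phi_add f q l x
  have h2 := phi_add f l q x
  rw [add_comm] at h2
  linarith

lemma exists_phi_eq_zero : ∃ x, phi f q x = 0 := by
  have hg : ContDiff ℝ ∞ (fun x => f.toFun^[q] x - x) := (smooth_iterate f q).sub contDiff_id
  obtain ⟨x, hx⟩ := exists_isMax_of_periodic hg.continuous (fun x => by
    simp only [iterate_add_one]; ring)
  refine ⟨x, ?_⟩
  have h1 : IsLocalMax (fun x => f.toFun^[q] x - x) x := Filter.Eventually.of_forall hx
  have h2 := h1.hasDerivAt_eq_zero ((hasDerivAt_iterate f q x).sub (hasDerivAt_id x))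
  have h3 : Real.exp (phi f q x) = 1 := by linarith
  exact (Real.exp_eq_one_iff _).1 h3

end ret

/-- A pair `(q, p)` such that `f^q - p` moves every point in the direction `s`, together with the
geometric information on orbit segments of length `N` used in the a priori estimates. -/
structure Level (f : SmoothCircleDiffeoLift) (B : ℝ) where
  q : ℕ
  N : ℕ
  p : ℤ
  s : ℝ
  M : ℝ
  s_eq : s = 1 ∨ s = -1
  q_le : q ≤ N
  move : ∀ x, 0 < s * (ret f q p x - x)
  le_M : ∀ x, |ret f q p x - x| ≤ M
  M_le : M ≤ 1
  sum_le : ∀ x, ∑ i ∈ Finset.range N, |ret f q p (f.toFun^[i] x) - f.toFun^[i] x| ≤ 2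
  cover : ∀ x y, ∃ k < N, ∃ j : ℤ,
    y ∈ Set.uIcc (f.toFun^[k] x + j) (ret f q p (f.toFun^[k] x + j))
  phi_le : ∀ x, |phi f q x| ≤ B

section combinatorics

variable {f : SmoothCircleDiffeoLift} {α : ℝ}

lemma Convergents.irrational (c : Convergents α) (j : ℕ) (hj : 0 < j) (k : ℤ) :
    (j : ℝ) * α - k ≠ 0 := by
  have h1 : j < c.q (j + 1) := (Nat.lt_succ_self j).trans_le (c.q_strictMono.id_le _)
  have := c.lt_abs (j + 1) j hj h1 k
  intro h0
  rw [h0, abs_zero] at this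
  exact absurd this (not_lt.2 (abs_nonneg _))

lemma Convergents.eq_of_mul_add_eq (c : Convergents α) {l l' : ℕ} {k k' : ℤ}
    (h : l * α + k = l' * α + k') : l = l' ∧ k = k' := by
  have hl : l = l' := by
    rcases lt_trichotomy l l' with hl | hl | hl
    · exfalso
      apply c.irrational (l' - l) (by omega) (k - k')
      rw [Nat.cast_sub hl.le]; push_cast; linarith
    · exact hl
    · exfalso
      apply c.irrational (l - l') (by omega) (k' - k)
      rw [Nat.cast_sub hl.le]; push_cast; linarith
  subst hl
  exact ⟨rfl, by have : (k : ℝ) = k' := by linarith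
                 exact_mod_cast this⟩

lemma iterate_add_lt (hρ : IsRotNumber f.toFun α) {l l' : ℕ} {k k' : ℤ}
    (h : l * α + k < l' * α + k') (x : ℝ) : f.toFun^[l] x + k < f.toFun^[l'] x + k' := by
  rcases le_total l l' with hl | hl
  · obtain ⟨d, rfl⟩ := Nat.exists_eq_add_of_le hl
    have := add_lt_iterate hρ (l := d) (k := k - k') (by push_cast at h ⊢; linarith)
      (f.toFun^[l] x)
    rw [← Function.iterate_add_apply, add_comm d l] at this
    push_cast at this
    linarith
  · obtain ⟨d, rfl⟩ := Nat.exists_eq_add_of_le hl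
    have := iterate_lt_add hρ (l := d) (k := k' - k) (by push_cast at h ⊢; linarith)
      (f.toFun^[l'] x)
    rw [← Function.iterate_add_apply, add_comm d l'] at this
    push_cast at this
    linarith

lemma le_of_iterate_add_le (hρ : IsRotNumber f.toFun α) {l l' : ℕ} {k k' : ℤ} {x : ℝ}
    (h : f.toFun^[l] x + k ≤ f.toFun^[l'] x + k') : l * α + k ≤ l' * α + k' := by
  by_contra! hc
  exact absurd (iterate_add_lt hρ hc x) (not_lt.2 h)

variable (c : Convergents α)

/-- The direction of the `n`-th closest return. -/
noncomputable def Convergents.sgn (n : ℕ) : ℝ := if 0 < c.a n then 1 else -1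

lemma Convergents.sgn_eq (n : ℕ) : c.sgn n = 1 ∨ c.sgn n = -1 := by
  unfold Convergents.sgn; split_ifs <;> simp

lemma ret_move (hρ : IsRotNumber f.toFun α) (n : ℕ) (x : ℝ) :
    0 < c.sgn n * (ret f (c.q n) (c.p n) x - x) := by
  unfold Convergents.sgn
  split_ifs with h
  · have := add_lt_iterate hρ (l := c.q n) (k := c.p n) (by unfold Convergents.a at h; linarith) x
    unfold ret; linarith
  · have h' := lt_of_le_of_ne (not_lt.1 h) (c.a_ne_zero n)
    have := iterate_lt_add hρ (l := c.q n) (k := c.p n) (by unfold Convergents.a at h'; linarith) x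
    unfold ret; linarith

lemma err_lt_one (n : ℕ) : c.err n < 1 := by
  have h1 := c.q_mul_err_le n
  have h2 : (2 : ℝ) ≤ c.q (n + 1) := by
    have := c.q_lt n; have := c.q_pos n; exact_mod_cast (by omega : 2 ≤ c.q (n + 1))
  nlinarith [c.err_pos n]

lemma overlap_aux (hρ : IsRotNumber f.toFun α) (n i l : ℕ) (hl : l < c.q (n + 1)) (k : ℤ)
    {x t : ℝ} {y z : ℝ} (hy : y = f.toFun^[i] x) (hz : z = f.toFun^[l + i] x + k)
    (ht : t ∈ Set.Ioo (min y (ret f (c.q n) (c.p n) y)) (max y (ret f (c.q n) (c.p n) y)))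
    (ht' : t ∈ Set.Ioo (min z (ret f (c.q n) (c.p n) z)) (max z (ret f (c.q n) (c.p n) z))) :
    l = 0 ∧ k = 0 := by
  have hm := ret_move c hρ n
  have ez : z = f.toFun^[l] y + k := by rw [hz, hy, Function.iterate_add_apply]
  have eF : ret f (c.q n) (c.p n) z = f.toFun^[l + c.q n] y + ((k - c.p n : ℤ) : ℝ) := by
    rw [ez, ret_add_int, ret, ← Function.iterate_add_apply, add_comm l]; push_cast; ring
  have eFy : ret f (c.q n) (c.p n) y = f.toFun^[c.q n] y + ((- c.p n : ℤ) : ℝ) := by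
    rw [ret]; push_cast; ring
  have ey : y = f.toFun^[0] y + ((0 : ℤ) : ℝ) := by simp
  have key : |l * α + k| ≤ c.err n ∧ z ≠ ret f (c.q n) (c.p n) y := by
    rcases c.sgn_eq n with hs | hs
    · have h1 := hm y
      have h2 := hm z
      rw [hs] at h1 h2
      have hy1 : y < ret f (c.q n) (c.p n) y := by linarith
      have hz1 : z < ret f (c.q n) (c.p n) z := by linarith
      rw [min_eq_left hy1.le, max_eq_right hy1.le] at ht
      rw [min_eq_left hz1.le, max_eq_right hz1.le] at ht'
      refine ⟨?_, (ht'.1.trans ht.2).ne⟩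
      have h3 : z ≤ ret f (c.q n) (c.p n) y := (ht'.1.trans ht.2).le
      have h4 : y ≤ ret f (c.q n) (c.p n) z := (ht.1.trans ht'.2).le
      rw [eFy, ez] at h3
      rw [eF] at h4
      nth_rewrite 1 [ey] at h4
      have h5 := le_of_iterate_add_le hρ h3
      have h6 := le_of_iterate_add_le hρ h4
      push_cast at h5 h6
      have : c.a n ≤ c.err n := le_abs_self _
      unfold Convergents.a at this
      rw [abs_le]; constructor <;> linarith
    · have h1 := hm y
      have h2 := hm z
      rw [hs] at h1 h2
      have hy1 : ret f (c.q n) (c.p n) y < y := by linarith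
      have hz1 : ret f (c.q n) (c.p n) z < z := by linarith
      rw [min_eq_right hy1.le, max_eq_left hy1.le] at ht
      rw [min_eq_right hz1.le, max_eq_left hz1.le] at ht'
      refine ⟨?_, (ht.1.trans ht'.2).ne'⟩
      have h3 : ret f (c.q n) (c.p n) y ≤ z := (ht.1.trans ht'.2).le
      have h4 : ret f (c.q n) (c.p n) z ≤ y := (ht'.1.trans ht.2).le
      rw [eFy, ez] at h3
      rw [eF] at h4
      nth_rewrite 2 [ey] at h4
      have h5 := le_of_iterate_add_le hρ h3
      have h6 := le_of_iterate_add_le hρ h4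
      push_cast at h5 h6
      have : - c.a n ≤ c.err n := neg_le_abs _
      unfold Convergents.a at this
      rw [abs_le]; constructor <;> linarith
  obtain ⟨key, hne⟩ := key
  rcases Nat.eq_zero_or_pos l with h0 | h0
  · refine ⟨h0, ?_⟩
    subst h0
    simp only [Nat.cast_zero, zero_mul, zero_add] at key
    have h2 := key.trans_lt (err_lt_one c n)
    have : |k| < 1 := by exact_mod_cast h2
    exact Int.abs_lt_one_iff.1 this
  · exfalso
    have h1 := c.le_abs n l h0 hl (-k)
    push_cast at h1
    rw [sub_neg_eq_add] at h1
    have h2 : |l * α + k| = |c.a n| := le_antisymm key h1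
    rcases abs_eq_abs.1 h2 with h3 | h3
    · have : l * α + k = c.q n * α + ((- c.p n : ℤ) : ℝ) := by
        rw [h3]; push_cast; unfold Convergents.a; ring
      obtain ⟨e1, e2⟩ := c.eq_of_mul_add_eq this
      apply hne
      rw [ez, eFy, e1, e2]
    · apply c.irrational (l + c.q n) (by omega) (c.p n - k)
      push_cast
      unfold Convergents.a at h3
      linarith

lemma sum_gap_le_one (hρ : IsRotNumber f.toFun α) (n : ℕ) (x : ℝ) :
    ∑ i ∈ Finset.range (c.q (n + 1)),
      |ret f (c.q n) (c.p n) (f.toFun^[i] x) - f.toFun^[i] x| ≤ 1 := by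
  have h := sum_length_le_one (c.q (n + 1))
    (fun i => min (f.toFun^[i] x) (ret f (c.q n) (c.p n) (f.toFun^[i] x)))
    (fun i => max (f.toFun^[i] x) (ret f (c.q n) (c.p n) (f.toFun^[i] x)))
    (fun i _ => min_le_max) ?_
  · simpa only [max_sub_min_eq_abs] using h
  · have aux : ∀ i j, i ≤ j → j < c.q (n + 1) → ∀ (k : ℤ) (t : ℝ),
        t ∈ Set.Ioo (min (f.toFun^[i] x) (ret f (c.q n) (c.p n) (f.toFun^[i] x)))
          (max (f.toFun^[i] x) (ret f (c.q n) (c.p n) (f.toFun^[i] x))) →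
        t + k ∈ Set.Ioo (min (f.toFun^[j] x) (ret f (c.q n) (c.p n) (f.toFun^[j] x)))
          (max (f.toFun^[j] x) (ret f (c.q n) (c.p n) (f.toFun^[j] x))) → i = j ∧ k = 0 := by
      intro i j hij hj k t ht ht'
      obtain ⟨l, rfl⟩ := Nat.exists_eq_add_of_le hij
      have := overlap_aux c hρ n i l (by omega) (-k) rfl rfl ht (by
        rw [ret_add_int, min_add_add_right, max_add_add_right, add_comm l i]
        push_cast
        exact ⟨by linarith [ht'.1], by linarith [ht'.2]⟩)
      omega
    intro i hi j hj k t ht ht'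
    rcases le_total i j with hij | hij
    · exact aux i j hij hj k t ht ht'
    · have := aux j i hij hi (-k) (t + k) ht' (by push_cast; simpa using ht)
      omega

lemma sum_gap_le_two (hρ : IsRotNumber f.toFun α) (n : ℕ) (x : ℝ) :
    ∑ i ∈ Finset.range (2 * c.q (n + 1)),
      |ret f (c.q n) (c.p n) (f.toFun^[i] x) - f.toFun^[i] x| ≤ 2 := by
  rw [two_mul, Finset.sum_range_add]
  have h1 := sum_gap_le_one c hρ n x
  have h2 := sum_gap_le_one c hρ n (f.toFun^[c.q (n + 1)] x)
  simp only [← Function.iterate_add_apply] at h2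
  simp only [add_comm (c.q (n + 1))]
  linarith

lemma sgn_succ (n : ℕ) : c.sgn (n + 1) = - c.sgn n := by
  have h := c.a_mul_neg n
  unfold Convergents.sgn
  split_ifs with h1 h2 h2
  · nlinarith
  · simp
  · simp
  · nlinarith [lt_of_le_of_ne (not_lt.1 h1) (c.a_ne_zero _),
      lt_of_le_of_ne (not_lt.1 h2) (c.a_ne_zero _)]

lemma ret_ret_move (hρ : IsRotNumber f.toFun α) (n : ℕ) (x : ℝ) :
    0 < c.sgn n * (ret f (c.q n) (c.p n) (ret f (c.q (n + 1)) (c.p (n + 1)) x) - x) := by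
  have e : ret f (c.q n) (c.p n) (ret f (c.q (n + 1)) (c.p (n + 1)) x)
      = f.toFun^[c.q n + c.q (n + 1)] x + ((- c.p n - c.p (n + 1) : ℤ) : ℝ) := by
    have := ret_add_int f (c.q n) (c.p n) (f.toFun^[c.q (n + 1)] x) (- c.p (n + 1))
    push_cast at this
    rw [ret, sub_eq_add_neg] at *
    rw [ret, sub_eq_add_neg, this, ret, ← Function.iterate_add_apply]; push_cast; ring
  have h1 := c.err_succ_lt n
  have h2 := c.a_mul_neg n
  rw [e]
  unfold Convergents.err at h1
  have e0 : x = f.toFun^[0] x + ((0 : ℤ) : ℝ) := by simp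
  unfold Convergents.sgn
  split_ifs with h
  · have h' : c.a (n + 1) < 0 := by nlinarith
    rw [abs_of_pos h, abs_of_neg h'] at h1
    unfold Convergents.a at h1
    have := iterate_add_lt hρ (l := 0) (k := 0) (l' := c.q n + c.q (n + 1))
      (k' := - c.p n - c.p (n + 1)) (by push_cast; linarith) x
    rw [← e0] at this
    linarith
  · have hn := lt_of_le_of_ne (not_lt.1 h) (c.a_ne_zero _)
    have h' : 0 < c.a (n + 1) := by nlinarith
    rw [abs_of_neg hn, abs_of_pos h'] at h1
    unfold Convergents.a at h1
    have := iterate_add_lt hρ (l' := 0) (k' := 0) (l := c.q n + c.q (n + 1))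
      (k := - c.p n - c.p (n + 1)) (by push_cast; linarith) x
    rw [← e0] at this
    linarith

lemma exists_mem_uIcc_ret (hρ : IsRotNumber f.toFun α) (n : ℕ) (x y : ℝ) :
    ∃ k < 2 * c.q (n + 1), ∃ j : ℤ,
      y ∈ Set.uIcc (f.toFun^[k] x + j) (ret f (c.q n) (c.p n) (f.toFun^[k] x + j)) := by
  have hlt := c.q_lt n
  have hne : (Finset.range (c.q (n + 1) + c.q n)).Nonempty :=
    Finset.nonempty_range_iff.2 (by omega)
  have hm := ret_move c hρ n
  have hm' := ret_move c hρ (n + 1)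
  have hm2 := ret_ret_move c hρ n
  have hF : ∀ (k : ℕ) (j : ℤ), ret f (c.q n) (c.p n) (f.toFun^[k] x + j)
      = f.toFun^[k + c.q n] x + ((j - c.p n : ℤ) : ℝ) := by
    intro k j
    rw [ret_add_int, ret, ← Function.iterate_add_apply, add_comm k]; push_cast; ring
  have hG : ∀ (k : ℕ) (j : ℤ), c.q (n + 1) ≤ k →
      ret f (c.q (n + 1)) (c.p (n + 1)) (f.toFun^[k - c.q (n + 1)] x + ((j + c.p (n + 1) : ℤ) : ℝ))
        = f.toFun^[k] x + j := by
    intro k j hk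
    rw [ret_add_int, ret, ← Function.iterate_add_apply, Nat.add_sub_cancel' hk]; push_cast; ring
  rcases c.sgn_eq n with hs | hs
  · obtain ⟨k, hk, hmax⟩ := Finset.exists_max_image _
      (fun k => f.toFun^[k] x + ⌊y - f.toFun^[k] x⌋) hne
    rw [Finset.mem_range] at hk
    have hle : ∀ k' < c.q (n + 1) + c.q n, ∀ j' : ℤ, f.toFun^[k] x + ⌊y - f.toFun^[k] x⌋ <
        f.toFun^[k'] x + j' → y < f.toFun^[k'] x + j' := by
      intro k' hk' j' h
      by_contra! hc
      have h1 : j' ≤ ⌊y - f.toFun^[k'] x⌋ := Int.le_floor.2 (by linarith)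
      have h2 : (j' : ℝ) ≤ ⌊y - f.toFun^[k'] x⌋ := by exact_mod_cast h1
      have := hmax k' (Finset.mem_range.2 hk')
      linarith
    set j := ⌊y - f.toFun^[k] x⌋ with hj
    refine ⟨k, by omega, j, ?_⟩
    have h1 := hm (f.toFun^[k] x + j)
    rw [hs, one_mul, sub_pos] at h1
    rw [Set.uIcc_of_le h1.le]
    refine ⟨by have := Int.floor_le (y - f.toFun^[k] x); linarith, le_of_lt ?_⟩
    rcases Nat.lt_or_ge k (c.q (n + 1)) with hk1 | hk1
    · rw [hF] at h1 ⊢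
      exact hle _ (by omega) _ h1
    · set t' := f.toFun^[k - c.q (n + 1)] x + ((j + c.p (n + 1) : ℤ) : ℝ) with ht'
      have h2 := hm' t'
      have h3 := hm2 t'
      rw [hG k j hk1, sgn_succ, hs] at h2
      rw [hG k j hk1, hs] at h3
      have h4 := hle (k - c.q (n + 1)) (by omega) (j + c.p (n + 1)) (by rw [← ht']; linarith)
      rw [← ht'] at h4
      linarith
  · obtain ⟨k, hk, hmin⟩ := Finset.exists_min_image _
      (fun k => f.toFun^[k] x + ⌈y - f.toFun^[k] x⌉) hne
    rw [Finset.mem_range] at hk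
    have hle : ∀ k' < c.q (n + 1) + c.q n, ∀ j' : ℤ, f.toFun^[k'] x + j' <
        f.toFun^[k] x + ⌈y - f.toFun^[k] x⌉ → f.toFun^[k'] x + j' < y := by
      intro k' hk' j' h
      by_contra! hc
      have h1 : ⌈y - f.toFun^[k'] x⌉ ≤ j' := Int.ceil_le.2 (by linarith)
      have h2 : (⌈y - f.toFun^[k'] x⌉ : ℝ) ≤ j' := by exact_mod_cast h1
      have := hmin k' (Finset.mem_range.2 hk')
      linarith
    set j := ⌈y - f.toFun^[k] x⌉ with hj
    refine ⟨k, by omega, j, ?_⟩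
    have h1 := hm (f.toFun^[k] x + j)
    rw [hs] at h1
    replace h1 : ret f (c.q n) (c.p n) (f.toFun^[k] x + j) < f.toFun^[k] x + j := by linarith
    rw [Set.uIcc_of_ge h1.le]
    refine ⟨le_of_lt ?_, by have := Int.le_ceil (y - f.toFun^[k] x); linarith⟩
    rcases Nat.lt_or_ge k (c.q (n + 1)) with hk1 | hk1
    · rw [hF] at h1 ⊢
      exact hle _ (by omega) _ h1
    · set t' := f.toFun^[k - c.q (n + 1)] x + ((j + c.p (n + 1) : ℤ) : ℝ) with ht'
      have h2 := hm' t'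
      have h3 := hm2 t'
      rw [hG k j hk1, sgn_succ, hs] at h2
      rw [hG k j hk1, hs] at h3
      have h4 := hle (k - c.q (n + 1)) (by omega) (j + c.p (n + 1)) (by rw [← ht']; linarith)
      rw [← ht'] at h4
      linarith

end combinatorics

lemma iterate_mem_uIcc_ret (f : SmoothCircleDiffeoLift) {q : ℕ} {p : ℤ} {x y : ℝ} (i : ℕ)
    (hy : y ∈ Set.uIcc x (ret f q p x)) :
    f.toFun^[i] y ∈ Set.uIcc (f.toFun^[i] x) (ret f q p (f.toFun^[i] x)) := by
  rw [ret_iterate]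
  have hmono := (iterate_strictMono f i).monotone
  rcases le_total x (ret f q p x) with h | h
  · rw [Set.uIcc_of_le h] at hy
    rw [Set.uIcc_of_le (hmono h)]
    exact ⟨hmono hy.1, hmono hy.2⟩
  · rw [Set.uIcc_of_ge h] at hy
    rw [Set.uIcc_of_ge (hmono h)]
    exact ⟨hmono hy.1, hmono hy.2⟩

lemma distortion (f : SmoothCircleDiffeoLift) {L : ℝ} (hL : ∀ x, |deriv (phi f 1) x| ≤ L)
    {q N : ℕ} {p : ℤ}
    (hsum : ∀ x, ∑ i ∈ Finset.range N, |ret f q p (f.toFun^[i] x) - f.toFun^[i] x| ≤ 2)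
    {x y z : ℝ} (hy : y ∈ Set.uIcc x (ret f q p x)) (hz : z ∈ Set.uIcc x (ret f q p x))
    {l : ℕ} (hl : l ≤ N) : |phi f l y - phi f l z| ≤ 2 * L := by
  have hL0 : 0 ≤ L := (abs_nonneg _).trans (hL 0)
  have hlip : ∀ u v, |phi f 1 u - phi f 1 v| ≤ L * |u - v| := fun u v =>
    Convex.norm_image_sub_le_of_norm_deriv_le (f := phi f 1) (C := L) (s := Set.univ)
      (fun y _ => differentiable_of_smooth (smooth_phi f 1) y) (fun y _ => hL y) convex_univ
      (Set.mem_univ v) (Set.mem_univ u)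
  have e : phi f l y - phi f l z
      = ∑ i ∈ Finset.range l, (phi f 1 (f.toFun^[i] y) - phi f 1 (f.toFun^[i] z)) := by
    rw [Finset.sum_sub_distrib]; simp only [phi_one]; rfl
  rw [e]
  calc _ ≤ ∑ i ∈ Finset.range l, |phi f 1 (f.toFun^[i] y) - phi f 1 (f.toFun^[i] z)| :=
        Finset.abs_sum_le_sum_abs _ _
    _ ≤ ∑ i ∈ Finset.range l, L * |ret f q p (f.toFun^[i] x) - f.toFun^[i] x| := by
        refine Finset.sum_le_sum fun i _ => (hlip _ _).trans ?_
        refine mul_le_mul_of_nonneg_left ?_ hL0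
        exact Set.abs_sub_le_of_uIcc_subset_uIcc
          (Set.uIcc_subset_uIcc (iterate_mem_uIcc_ret f i hz) (iterate_mem_uIcc_ret f i hy))
    _ ≤ ∑ i ∈ Finset.range N, L * |ret f q p (f.toFun^[i] x) - f.toFun^[i] x| :=
        Finset.sum_le_sum_of_subset_of_nonneg (Finset.range_subset_range.2 hl)
          fun _ _ _ => by positivity
    _ ≤ 2 * L := by
        rw [← Finset.mul_sum]
        nlinarith [hsum x]

lemma exists_phi_q_bound (f : SmoothCircleDiffeoLift) : ∃ B : ℝ, 0 ≤ B ∧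
    ∀ (α : ℝ) (_ : IsRotNumber f.toFun α) (c : Convergents α) (_ : c.q 0 = 1) (n : ℕ) (x : ℝ),
      |phi f (c.q n) x| ≤ B := by
  obtain ⟨L, hL0, hL⟩ := exists_abs_le_of_periodic
    (contDiff_deriv (smooth_phi f 1)).continuous (deriv_phi_periodic f 1)
  obtain ⟨B₁, hB₁, hB⟩ := exists_abs_le_of_periodic (smooth_phi f 1).continuous (phi_periodic f 1)
  refine ⟨4 * L + B₁, by positivity, fun α hρ c hc n x => ?_⟩
  cases n with
  | zero => rw [hc]; linarith [hB x]
  | succ n =>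
    obtain ⟨x₀, hx₀⟩ := exists_phi_eq_zero f (c.q (n + 1))
    obtain ⟨k, hk, j, hy⟩ := exists_mem_uIcc_ret c hρ n x₀ x
    have h1 := distortion f hL (sum_gap_le_two c hρ n) hy Set.left_mem_uIcc
      (l := c.q (n + 1)) (by omega)
    rw [phi_add_int] at h1
    have h2 := phi_iterate_sub f (c.q (n + 1)) (c.p (n + 1)) k x₀
    have h3 : x₀ ∈ Set.uIcc (ret f (c.q (n + 1)) (c.p (n + 1)) x₀)
        (ret f (c.q n) (c.p n) (ret f (c.q (n + 1)) (c.p (n + 1)) x₀)) := by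
      have h4 := ret_move c hρ (n + 1) x₀
      have h5 := ret_ret_move c hρ n x₀
      rw [sgn_succ] at h4
      rw [Set.mem_uIcc]
      rcases c.sgn_eq n with hs | hs <;> rw [hs] at h4 h5
      · left; constructor <;> linarith
      · right; constructor <;> linarith
    have h4 := distortion f hL (sum_gap_le_two c hρ n) Set.left_mem_uIcc h3 (l := k) hk.le
    rw [← h2, hx₀, sub_zero] at h4
    have := abs_add_le (phi f (c.q (n + 1)) x - phi f (c.q (n + 1)) (f.toFun^[k] x₀))
      (phi f (c.q (n + 1)) (f.toFun^[k] x₀))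
    rw [sub_add_cancel] at this
    linarith

/-- A bound for `log D(f^{q n})`, uniform in `n`. -/
noncomputable def denjoyBound (f : SmoothCircleDiffeoLift) : ℝ := (exists_phi_q_bound f).choose

section levels

variable {f : SmoothCircleDiffeoLift} {α : ℝ} (hρ : IsRotNumber f.toFun α) (c : Convergents α)
  (hc : c.q 0 = 1)

/-- The maximal displacement of the `n`-th return map. -/
noncomputable def maxGap (f : SmoothCircleDiffeoLift) (c : Convergents α) (n : ℕ) : ℝ :=
  ⨆ x, |ret f (c.q n) (c.p n) x - x|

lemma gap_le_one (hρ : IsRotNumber f.toFun α) (n : ℕ) (x : ℝ) :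
    |ret f (c.q n) (c.p n) x - x| ≤ 1 := by
  have h := sum_gap_le_one c hρ n x
  have := Finset.single_le_sum
    (f := fun i => |ret f (c.q n) (c.p n) (f.toFun^[i] x) - f.toFun^[i] x|)
    (fun i _ => abs_nonneg _) (Finset.mem_range.2 (c.q_pos (n + 1)))
  simp only [Function.iterate_zero, id] at this
  linarith

lemma gap_le_maxGap (hρ : IsRotNumber f.toFun α) (n : ℕ) (x : ℝ) :
    |ret f (c.q n) (c.p n) x - x| ≤ maxGap f c n :=
  le_ciSup (f := fun x => |ret f (c.q n) (c.p n) x - x|)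
    ⟨1, by rintro _ ⟨y, rfl⟩; exact gap_le_one c hρ n y⟩ x

/-- The level attached to the `n`-th closest return. -/
noncomputable def level (n : ℕ) : Level f (denjoyBound f) where
  q := c.q n
  N := 2 * c.q (n + 1)
  p := c.p n
  s := c.sgn n
  M := maxGap f c n
  s_eq := c.sgn_eq n
  q_le := by have := c.q_lt n; omega
  move := ret_move c hρ n
  le_M := gap_le_maxGap c hρ n
  M_le := ciSup_le (gap_le_one c hρ n)
  sum_le := sum_gap_le_two c hρ n
  cover := exists_mem_uIcc_ret c hρ n
  phi_le := (exists_phi_q_bound f).choose_spec.2 α hρ c hc n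

end levels

namespace Level

variable {f : SmoothCircleDiffeoLift} {B : ℝ} (Λ : Level f B)

/-- The return map of a level. -/
noncomputable def F (x : ℝ) : ℝ := ret f Λ.q Λ.p x

/-- The displacement of the return map. -/
noncomputable def m (x : ℝ) : ℝ := |Λ.F x - x|

/-- The square root of the maximal displacement. -/
noncomputable def r : ℝ := √Λ.M

lemma s_mul_s : Λ.s * Λ.s = 1 := by rcases Λ.s_eq with h | h <;> rw [h] <;> norm_num

lemma abs_s : |Λ.s| = 1 := by rcases Λ.s_eq with h | h <;> rw [h] <;> norm_num

lemma m_eq (x : ℝ) : Λ.m x = Λ.s * (Λ.F x - x) := by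
  have h := Λ.move x
  have : |Λ.s * (Λ.F x - x)| = Λ.m x := by rw [abs_mul, abs_s, one_mul]; rfl
  rw [← this]
  exact abs_of_pos h

lemma F_sub (x : ℝ) : Λ.F x - x = Λ.s * Λ.m x := by
  rw [m_eq, ← mul_assoc, s_mul_s, one_mul]

lemma m_pos (x : ℝ) : 0 < Λ.m x := by rw [m_eq]; exact Λ.move x

lemma m_le (x : ℝ) : Λ.m x ≤ Λ.M := Λ.le_M x

lemma M_pos : 0 < Λ.M := (Λ.m_pos 0).trans_le (Λ.m_le 0)

lemma r_pos : 0 < Λ.r := Real.sqrt_pos.2 Λ.M_pos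

lemma r_sq : Λ.r ^ 2 = Λ.M := Real.sq_sqrt Λ.M_pos.le

lemma r_le_one : Λ.r ≤ 1 := Real.sqrt_le_one.2 Λ.M_le

lemma M_le_r : Λ.M ≤ Λ.r := by
  rw [← r_sq]; nlinarith [Λ.r_pos, Λ.r_le_one]

lemma B_nonneg {f : SmoothCircleDiffeoLift} {B : ℝ} (Λ : Level f B) : 0 ≤ B :=
  (abs_nonneg _).trans (Λ.phi_le 0)

lemma m_add_int (x : ℝ) (k : ℤ) : Λ.m (x + k) = Λ.m x := by
  unfold m F; rw [ret_add_int]; congr 1; ring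

lemma m_periodic : Function.Periodic Λ.m 1 := fun x => by exact_mod_cast Λ.m_add_int x 1

lemma m_fun_eq : Λ.m = fun x => Λ.s * (Λ.F x - x) := funext Λ.m_eq

lemma smooth_m : ContDiff ℝ ∞ Λ.m := by
  rw [m_fun_eq]
  exact contDiff_const.mul ((smooth_ret f Λ.q Λ.p).sub contDiff_id)

lemma hasDerivAt_m (x : ℝ) : HasDerivAt Λ.m (Λ.s * (Real.exp (phi f Λ.q x) - 1)) x := by
  rw [m_fun_eq]
  exact ((hasDerivAt_ret f Λ.q Λ.p x).sub (hasDerivAt_id x)).const_mul _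

lemma mem_uIcc_iff {x y : ℝ} :
    y ∈ Set.uIcc x (Λ.F x) ↔ 0 ≤ Λ.s * (y - x) ∧ Λ.s * (y - x) ≤ Λ.m x := by
  have h := Λ.m_pos x
  rw [m_eq] at h ⊢
  rw [Set.mem_uIcc]
  rcases Λ.s_eq with hs | hs <;> rw [hs] at h ⊢
  · constructor
    · rintro (h1 | h1) <;> constructor <;> linarith
    · rintro h1; left; constructor <;> linarith
  · constructor
    · rintro (h1 | h1) <;> constructor <;> linarith
    · rintro h1; right; constructor <;> linarith

lemma abs_sub_le_m {x y z : ℝ} (hy : y ∈ Set.uIcc x (Λ.F x)) (hz : z ∈ Set.uIcc x (Λ.F x)) :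
    |y - z| ≤ Λ.m x :=
  Set.abs_sub_le_of_uIcc_subset_uIcc (Set.uIcc_subset_uIcc hz hy)

/-- The mean value theorem for `f^l`. -/
lemma _root_.HermanYoccoz.exists_iterate_sub_eq (f : SmoothCircleDiffeoLift) (l : ℕ) (x y : ℝ) :
    ∃ ξ ∈ Set.uIcc x y, f.toFun^[l] y - f.toFun^[l] x = Real.exp (phi f l ξ) * (y - x) := by
  rcases lt_trichotomy x y with h | h | h
  · obtain ⟨ξ, hξ, he⟩ := exists_hasDerivAt_eq_slope (f.toFun^[l]) (fun t => Real.exp (phi f l t)) h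
      (smooth_iterate f l).continuous.continuousOn (fun t _ => hasDerivAt_iterate f l t)
    refine ⟨ξ, by rw [Set.uIcc_of_le h.le]; exact ⟨hξ.1.le, hξ.2.le⟩, ?_⟩
    rw [he, div_mul_cancel₀ _ (by linarith)]
  · exact ⟨x, by simp, by simp [h]⟩
  · obtain ⟨ξ, hξ, he⟩ := exists_hasDerivAt_eq_slope (f.toFun^[l]) (fun t => Real.exp (phi f l t)) h
      (smooth_iterate f l).continuous.continuousOn (fun t _ => hasDerivAt_iterate f l t)
    refine ⟨ξ, by rw [Set.uIcc_of_ge h.le]; exact ⟨hξ.1.le, hξ.2.le⟩, ?_⟩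
    rw [he]
    have : x - y ≠ 0 := by linarith
    field_simp
    ring

lemma exists_m_iterate_eq (l : ℕ) (x : ℝ) :
    ∃ ξ ∈ Set.uIcc x (Λ.F x), Λ.m (f.toFun^[l] x) = Real.exp (phi f l ξ) * Λ.m x := by
  obtain ⟨ξ, hξ, h⟩ := exists_iterate_sub_eq f l x (Λ.F x)
  refine ⟨ξ, hξ, ?_⟩
  rw [m_eq, m_eq, F, ret_iterate]
  rw [F] at h
  rw [h]; unfold F; ring

lemma distort {L : ℝ} (hL : ∀ x, |deriv (phi f 1) x| ≤ L) {x y z : ℝ}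
    (hy : y ∈ Set.uIcc x (Λ.F x)) (hz : z ∈ Set.uIcc x (Λ.F x)) {l : ℕ} (hl : l ≤ Λ.N) :
    |phi f l y - phi f l z| ≤ 2 * L :=
  distortion f hL Λ.sum_le hy hz hl

lemma exp_phi_mul_m_le {L : ℝ} (hL : ∀ x, |deriv (phi f 1) x| ≤ L) (x : ℝ) {l : ℕ}
    (hl : l ≤ Λ.N) : Real.exp (phi f l x) * Λ.m x ≤ Real.exp (2 * L) * Λ.m (f.toFun^[l] x) := by
  obtain ⟨ξ, hξ, h⟩ := Λ.exists_m_iterate_eq l x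
  have h1 := (abs_le.1 (Λ.distort hL Set.left_mem_uIcc hξ hl)).2
  rw [h, ← mul_assoc, ← Real.exp_add]
  have := Λ.m_pos x
  gcongr
  linarith

lemma m_le_of_mem {x y : ℝ} (hy : y ∈ Set.uIcc x (Λ.F x)) :
    Λ.m y ≤ Real.exp B * Λ.m x ∧ Λ.m x ≤ Real.exp B * Λ.m y := by
  obtain ⟨ξ, -, h⟩ := exists_iterate_sub_eq f Λ.q x y
  have h1 := Λ.mem_uIcc_iff.1 hy
  have h2 : Λ.m y = Real.exp (phi f Λ.q ξ) * (Λ.s * (y - x)) + (Λ.m x - Λ.s * (y - x)) := by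
    rw [m_eq, m_eq]
    unfold F ret
    linear_combination Λ.s * h
  have hB := abs_le.1 (Λ.phi_le ξ)
  have hB0 := Λ.B_nonneg
  have e1 : Real.exp (phi f Λ.q ξ) ≤ Real.exp B := Real.exp_le_exp.2 hB.2
  have e2 : Real.exp (-B) ≤ Real.exp (phi f Λ.q ξ) := Real.exp_le_exp.2 hB.1
  have e3 : 1 ≤ Real.exp B := Real.one_le_exp hB0
  have e4 : Real.exp B * Real.exp (-B) = 1 := by rw [← Real.exp_add]; simp
  have hpos := Real.exp_pos B
  constructor
  · rw [h2]; nlinarith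
  · have h3 : 1 ≤ Real.exp B * Real.exp (phi f Λ.q ξ) := by
      rw [← e4]; gcongr
    rw [h2]; nlinarith

lemma sum_exp_sq_le {L : ℝ} (hL : ∀ x, |deriv (phi f 1) x| ≤ L) (x : ℝ) :
    ∑ i ∈ Finset.range Λ.N, Real.exp (phi f i x) ^ 2
      ≤ 2 * Real.exp (2 * L) ^ 2 * (Λ.r / Λ.m x) ^ 2 := by
  have hm := Λ.m_pos x
  rw [div_pow, r_sq, ← mul_div_assoc, le_div_iff₀ (by positivity), Finset.sum_mul]
  calc _ ≤ ∑ i ∈ Finset.range Λ.N, Real.exp (2 * L) ^ 2 * Λ.M * Λ.m (f.toFun^[i] x) := by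
        refine Finset.sum_le_sum fun i hi => ?_
        have h1 := Λ.exp_phi_mul_m_le hL x (Finset.mem_range.1 hi).le
        have h2 := Λ.m_le (f.toFun^[i] x)
        have h3 := Λ.m_pos (f.toFun^[i] x)
        calc Real.exp (phi f i x) ^ 2 * Λ.m x ^ 2 = (Real.exp (phi f i x) * Λ.m x) ^ 2 := by ring
          _ ≤ (Real.exp (2 * L) * Λ.m (f.toFun^[i] x)) ^ 2 := by gcongr
          _ = Real.exp (2 * L) ^ 2 * Λ.m (f.toFun^[i] x) * Λ.m (f.toFun^[i] x) := by ring
          _ ≤ _ := by gcongr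
    _ = Real.exp (2 * L) ^ 2 * Λ.M * ∑ i ∈ Finset.range Λ.N, Λ.m (f.toFun^[i] x) := by
        rw [Finset.mul_sum]
    _ ≤ Real.exp (2 * L) ^ 2 * Λ.M * 2 := by
        have := Λ.M_pos
        gcongr
        exact Λ.sum_le x
    _ = _ := by ring

lemma _root_.HermanYoccoz.exists_lip (f : SmoothCircleDiffeoLift) :
    ∃ L : ℝ, 0 ≤ L ∧ ∀ x, |deriv (phi f 1) x| ≤ L :=
  exists_abs_le_of_periodic (contDiff_deriv (smooth_phi f 1)).continuous (deriv_phi_periodic f 1)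

variable (f B)

lemma exists_schwarz_bound : ∃ C : ℝ, 0 ≤ C ∧ ∀ (Λ : Level f B) (l : ℕ), l ≤ Λ.N → ∀ x,
    |schwarz f l x| ≤ C * (Λ.r / Λ.m x) ^ 2 := by
  obtain ⟨L, hL0, hL⟩ := exists_lip f
  obtain ⟨S, hS0, hS⟩ := exists_abs_le_of_periodic (smooth_schwarz f 1).continuous
    (schwarz_periodic f 1)
  refine ⟨S * (2 * Real.exp (2 * L) ^ 2), by positivity, fun Λ l hl x => ?_⟩
  rw [schwarz_eq_sum]
  calc _ ≤ ∑ i ∈ Finset.range l, |schwarz f 1 (f.toFun^[i] x) * Real.exp (phi f i x) ^ 2| :=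
        Finset.abs_sum_le_sum_abs _ _
    _ ≤ ∑ i ∈ Finset.range l, S * Real.exp (phi f i x) ^ 2 := by
        refine Finset.sum_le_sum fun i _ => ?_
        rw [abs_mul, abs_of_nonneg (sq_nonneg (Real.exp _))]
        gcongr
        exact hS _
    _ ≤ ∑ i ∈ Finset.range Λ.N, S * Real.exp (phi f i x) ^ 2 :=
        Finset.sum_le_sum_of_subset_of_nonneg (Finset.range_subset_range.2 hl)
          fun _ _ _ => by positivity
    _ ≤ _ := by
        rw [← Finset.mul_sum, mul_assoc]
        gcongr
        exact Λ.sum_exp_sq_le hL x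

variable {f B}

/-- At a point of minimal displacement the return map has derivative one, and its second
derivative points in the direction of the motion. -/
lemma exists_min_point : ∃ x₀, (∀ x, Λ.m x₀ ≤ Λ.m x) ∧ phi f Λ.q x₀ = 0 ∧
    0 ≤ Λ.s * deriv (phi f Λ.q) x₀ := by
  obtain ⟨x₀, hx₀⟩ := exists_isMin_of_periodic Λ.smooth_m.continuous Λ.m_periodic
  have hmin : IsLocalMin Λ.m x₀ := Filter.Eventually.of_forall hx₀
  have h0 : phi f Λ.q x₀ = 0 := by
    have := hmin.hasDerivAt_eq_zero (Λ.hasDerivAt_m x₀)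
    have hs : Λ.s ≠ 0 := by rcases Λ.s_eq with h | h <;> rw [h] <;> norm_num
    have h1 := (mul_eq_zero.1 this).resolve_left hs
    exact (Real.exp_eq_one_iff _).1 (by linarith)
  refine ⟨x₀, hx₀, h0, ?_⟩
  have hd : deriv Λ.m = fun x => Λ.s * (Real.exp (phi f Λ.q x) - 1) :=
    funext fun x => (Λ.hasDerivAt_m x).deriv
  have hdd : deriv (deriv Λ.m) x₀ = Λ.s * deriv (phi f Λ.q) x₀ := by
    rw [hd]
    have := (((hasDerivAt_phi f Λ.q x₀).exp).sub_const 1).const_mul Λ.s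
    rw [h0, Real.exp_zero, one_mul] at this
    exact this.deriv
  rw [← hdd]
  by_contra! hneg
  have hmax := isLocalMax_of_deriv_deriv_neg hneg
    (by rw [(Λ.hasDerivAt_m x₀).deriv, h0]; simp) Λ.smooth_m.continuous.continuousAt
  have hconst : Λ.m =ᶠ[𝓝 x₀] fun _ => Λ.m x₀ := by
    filter_upwards [hmax, hmin] with y h1 h2 using le_antisymm h1 h2
  have h2 : deriv Λ.m =ᶠ[𝓝 x₀] fun _ => 0 := by
    have := hconst.deriv
    simpa using this
  have h3 := h2.deriv_eq
  simp at h3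
  linarith

variable (f B)

set_option maxHeartbeats 1000000 in
lemma exists_phi_q_le_r : ∃ C : ℝ, 1 ≤ C ∧ ∀ (Λ : Level f B) (x : ℝ), |phi f Λ.q x| ≤ C * Λ.r := by
  obtain ⟨L, hL0, hL⟩ := exists_lip f
  obtain ⟨C, hC0, hC⟩ := exists_schwarz_bound f B
  set D : ℝ := Real.exp (B / 2) ^ 2 * (C * Real.exp B ^ 2) with hD
  have hD0 : 0 ≤ D := by positivity
  set E : ℝ := 2 * C + 2 * D * Real.exp (2 * L) with hE
  have hE0 : 0 ≤ E := by positivity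
  refine ⟨1 + E + D, by linarith, fun Λ => ?_⟩
  have hr := Λ.r_pos
  have hB0 := Λ.B_nonneg
  obtain ⟨x₀, hmin, hx₀, hsx₀⟩ := Λ.exists_min_point
  obtain ⟨z₁, hz₁⟩ := exists_isMax_of_periodic (g := fun x => phi f Λ.q x ^ 2)
    ((smooth_phi f Λ.q).continuous.pow 2) (fun x => by simp only [phi_periodic f Λ.q x])
  suffices h : |phi f Λ.q z₁| ≤ (1 + E + D) * Λ.r from
    fun x => (sq_le_sq.1 (hz₁ x)).trans h
  by_cases hz0 : phi f Λ.q z₁ = 0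
  · rw [hz0, abs_zero]; positivity
  have hdz₁ : deriv (phi f Λ.q) z₁ = 0 := by
    have hmax : IsLocalMax (fun x => phi f Λ.q x ^ 2) z₁ := Filter.Eventually.of_forall hz₁
    have := hmax.hasDerivAt_eq_zero ((hasDerivAt_phi f Λ.q z₁).pow 2)
    have h2 : 2 * phi f Λ.q z₁ * deriv (phi f Λ.q) z₁ = 0 := by simpa using this
    rcases mul_eq_zero.1 h2 with h3 | h3
    · exact absurd (by linarith) hz0
    · exact h3
  obtain ⟨l, hl, j, hj⟩ := Λ.cover x₀ z₁
  change z₁ ∈ Set.uIcc (f.toFun^[l] x₀ + j) (Λ.F (f.toFun^[l] x₀ + j)) at hj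
  set y := f.toFun^[l] x₀ + j with hy
  have hmy : Λ.m y = Λ.m (f.toFun^[l] x₀) := Λ.m_add_int _ j
  have hmypos := Λ.m_pos y
  have hm0 := Λ.m_pos x₀
  -- the derivative of `φ_q` on the interval containing `z₁`
  have hder : ∀ t ∈ Set.uIcc y (Λ.F y), |deriv (phi f Λ.q) t| ≤ D * (Λ.M / Λ.m y) := by
    intro t ht
    set h : ℝ → ℝ := fun t => deriv (phi f Λ.q) t * Real.exp (-(phi f Λ.q t / 2)) with hh
    have hd : ∀ t, HasDerivAt h (Real.exp (-(phi f Λ.q t / 2)) * schwarz f Λ.q t) t := by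
      intro t
      have := (hasDerivAt_deriv_phi f Λ.q t).mul
        (((hasDerivAt_phi f Λ.q t).div_const 2).neg.exp)
      refine this.congr_deriv ?_
      simp only [Pi.neg_apply]
      unfold schwarz; ring
    have h1 := Convex.norm_image_sub_le_of_norm_hasDerivWithin_le (f := h)
      (s := Set.uIcc y (Λ.F y)) (C := Real.exp (B / 2) * (C * Real.exp B ^ 2 * (Λ.M / Λ.m y ^ 2)))
      (fun t _ => (hd t).hasDerivWithinAt) (fun t ht => by
        rw [Real.norm_eq_abs, abs_mul, abs_of_pos (Real.exp_pos _)]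
        have h2 := hC Λ Λ.q Λ.q_le t
        have h3 := (Λ.m_le_of_mem ht).2
        have h4 : (Λ.r / Λ.m t) ^ 2 ≤ Real.exp B ^ 2 * (Λ.M / Λ.m y ^ 2) := by
          have := Λ.m_pos t
          rw [div_pow, r_sq, ← mul_div_assoc, div_le_div_iff₀ (by positivity) (by positivity)]
          have h5 : Λ.m y ^ 2 ≤ (Real.exp B * Λ.m t) ^ 2 := by gcongr
          nlinarith [Λ.M_pos]
        have h6 := abs_le.1 (Λ.phi_le t)
        gcongr
        · linarith
        · calc _ ≤ _ := h2
            _ ≤ C * (Real.exp B ^ 2 * (Λ.M / Λ.m y ^ 2)) := by gcongr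
            _ = _ := by ring) (convex_uIcc _ _) hj ht
    have h2 : h z₁ = 0 := by simp [hh, hdz₁]
    rw [h2, sub_zero, Real.norm_eq_abs, Real.norm_eq_abs] at h1
    have h3 := Λ.abs_sub_le_m ht hj
    have h4 : |deriv (phi f Λ.q) t| = |h t| * Real.exp (phi f Λ.q t / 2) := by
      rw [hh]
      simp only
      rw [abs_mul, abs_of_pos (Real.exp_pos _), mul_assoc, ← Real.exp_add]
      simp
    have h5 : Real.exp (phi f Λ.q t / 2) ≤ Real.exp (B / 2) :=
      Real.exp_le_exp.2 (by linarith [(abs_le.1 (Λ.phi_le t)).2])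
    have hM := Λ.M_pos
    rw [h4]
    calc _ ≤ (Real.exp (B / 2) * (C * Real.exp B ^ 2 * (Λ.M / Λ.m y ^ 2)) * Λ.m y)
          * Real.exp (B / 2) := by
          gcongr
          exact h1.trans (by gcongr)
      _ = D * (Λ.M / Λ.m y) := by rw [hD]; field_simp
  -- the value at `y`
  have hval : phi f Λ.q y ^ 2 ≤ E * Λ.M := by
    set a := phi f Λ.q y with ha
    have hM := Λ.M_pos
    have ea : phi f l (Λ.F x₀) - phi f l x₀ = a := by
      have := phi_iterate_sub f Λ.q Λ.p l x₀
      rw [hx₀, sub_zero] at this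
      rw [F, ← this, ha, hy, phi_add_int]
    have ed : deriv (phi f Λ.q) y * Real.exp (phi f l x₀) =
        deriv (phi f Λ.q) x₀ + (deriv (phi f l) (Λ.F x₀) - deriv (phi f l) x₀) := by
      have h1 := deriv_phi_add f Λ.q l x₀
      have h2 := deriv_phi_add f l Λ.q x₀
      rw [hx₀, Real.exp_zero, mul_one, add_comm l] at h2
      have h3 : deriv (phi f l) (Λ.F x₀) = deriv (phi f l) (f.toFun^[Λ.q] x₀) := by
        have := deriv_phi_add_int f l (f.toFun^[Λ.q] x₀) (-Λ.p)
        rw [← this]; push_cast; rfl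
      rw [hy, deriv_phi_add_int, h3]
      linarith
    set m₀ := Λ.m x₀ with hm₀
    set A := Λ.s * a / m₀ with hA
    set K := C * (Λ.M / m₀ ^ 2) with hK
    have hmono : Monotone (fun t => deriv (phi f l) t - A * phi f l t + (A ^ 2 / 2 + K) * t) := by
      have hd : ∀ t, HasDerivAt
          (fun t => deriv (phi f l) t - A * phi f l t + (A ^ 2 / 2 + K) * t)
          (deriv (deriv (phi f l)) t - A * deriv (phi f l) t + (A ^ 2 / 2 + K)) t := by
        intro t
        have := (((hasDerivAt_deriv_phi f l t).sub ((hasDerivAt_phi f l t).const_mul A)).add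
          ((hasDerivAt_id t).const_mul (A ^ 2 / 2 + K)))
        exact this.congr_deriv (by rw [mul_one])
      refine monotone_of_hasDerivAt_nonneg hd fun t => ?_
      have h1 := hC Λ l hl.le t
      have h2 : (Λ.r / Λ.m t) ^ 2 ≤ Λ.M / m₀ ^ 2 := by
        rw [div_pow, r_sq]
        have := hmin t
        gcongr
      have h3 : |schwarz f l t| ≤ K := h1.trans (by rw [hK]; gcongr)
      have h4 := (abs_le.1 h3).1
      unfold schwarz at h4
      simp only [Pi.zero_apply]
      nlinarith [sq_nonneg (deriv (phi f l) t - A)]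
    have hF0 := Λ.F_sub x₀
    rw [← hm₀] at hF0
    have hineq : a ^ 2 / (2 * m₀) - C * (Λ.M / m₀)
        ≤ Λ.s * (deriv (phi f l) (Λ.F x₀) - deriv (phi f l) x₀) := by
      have h1 : 0 ≤ Λ.s * ((deriv (phi f l) (Λ.F x₀) - A * phi f l (Λ.F x₀)
          + (A ^ 2 / 2 + K) * Λ.F x₀) -
          (deriv (phi f l) x₀ - A * phi f l x₀ + (A ^ 2 / 2 + K) * x₀)) := by
        rcases Λ.s_eq with hs | hs
        · have := hmono (show x₀ ≤ Λ.F x₀ by rw [hs] at hF0; linarith)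
          simp only at this
          rw [hs]; linarith
        · have := hmono (show Λ.F x₀ ≤ x₀ by rw [hs] at hF0; linarith)
          simp only at this
          rw [hs]; linarith
      have h2 : Λ.s * ((deriv (phi f l) (Λ.F x₀) - A * phi f l (Λ.F x₀)
          + (A ^ 2 / 2 + K) * Λ.F x₀) -
          (deriv (phi f l) x₀ - A * phi f l x₀ + (A ^ 2 / 2 + K) * x₀)) =
          Λ.s * (deriv (phi f l) (Λ.F x₀) - deriv (phi f l) x₀) - Λ.s * A * a
            + (A ^ 2 / 2 + K) * m₀ := by
        linear_combination (-Λ.s * A) * ea + Λ.s * (A ^ 2 / 2 + K) * hF0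
          + (A ^ 2 / 2 + K) * m₀ * Λ.s_mul_s
      have h3 : Λ.s * A * a = a ^ 2 / m₀ := by
        rw [hA]
        linear_combination (a ^ 2 / m₀) * Λ.s_mul_s
      have h4 : A ^ 2 = a ^ 2 / m₀ ^ 2 := by
        rw [hA]
        linear_combination (a ^ 2 / m₀ ^ 2) * Λ.s_mul_s
      have h5 : (A ^ 2 / 2 + K) * m₀ = a ^ 2 / (2 * m₀) + C * (Λ.M / m₀) := by
        rw [h4, hK]; field_simp
      have h6 : a ^ 2 / m₀ = a ^ 2 / (2 * m₀) + a ^ 2 / (2 * m₀) := by field_simp; ring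
      rw [h2, h3, h5] at h1
      linarith
    have h7 : a ^ 2 / (2 * m₀) - C * (Λ.M / m₀)
        ≤ |deriv (phi f Λ.q) y| * Real.exp (phi f l x₀) := by
      have h8 : Λ.s * (deriv (phi f Λ.q) y * Real.exp (phi f l x₀)) ≤
          |deriv (phi f Λ.q) y| * Real.exp (phi f l x₀) := by
        have := le_abs_self (Λ.s * (deriv (phi f Λ.q) y * Real.exp (phi f l x₀)))
        rwa [abs_mul, abs_mul, abs_s, one_mul, abs_of_pos (Real.exp_pos _)] at this
      rw [ed] at h8
      nlinarith
    have h9 := Λ.exp_phi_mul_m_le hL x₀ hl.le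
    rw [← hmy, ← hm₀] at h9
    have h10 := hder y Set.left_mem_uIcc
    have h11 : |deriv (phi f Λ.q) y| * Real.exp (phi f l x₀) * m₀ ≤ D * Real.exp (2 * L) * Λ.M := by
      calc _ = |deriv (phi f Λ.q) y| * (Real.exp (phi f l x₀) * m₀) := by ring
        _ ≤ D * (Λ.M / Λ.m y) * (Real.exp (2 * L) * Λ.m y) := by gcongr
        _ = _ := by field_simp
    have h12 : (a ^ 2 / (2 * m₀) - C * (Λ.M / m₀)) * m₀ = a ^ 2 / 2 - C * Λ.M := by field_simp
    have h13 := mul_le_mul_of_nonneg_right h7 hm0.le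
    rw [h12] at h13
    rw [hE]
    linarith
  have h1 : |phi f Λ.q y| ≤ (1 + E) * Λ.r := by
    rw [← r_sq] at hval
    apply abs_le_of_sq_le_sq _ (by positivity)
    nlinarith [sq_nonneg Λ.r, sq_nonneg (E * Λ.r)]
  have h2 := Convex.norm_image_sub_le_of_norm_hasDerivWithin_le (f := phi f Λ.q)
    (s := Set.uIcc y (Λ.F y)) (fun t _ => (hasDerivAt_phi f Λ.q t).hasDerivWithinAt)
    hder (convex_uIcc _ _) Set.left_mem_uIcc hj
  rw [Real.norm_eq_abs, Real.norm_eq_abs] at h2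
  have h3 := Λ.abs_sub_le_m hj Set.left_mem_uIcc
  have hM := Λ.M_pos
  have h4 : D * (Λ.M / Λ.m y) * |z₁ - y| ≤ D * Λ.r := by
    calc _ ≤ D * (Λ.M / Λ.m y) * Λ.m y := by gcongr
      _ = D * Λ.M := by field_simp
      _ ≤ _ := by gcongr; exact Λ.M_le_r
  have h5 := abs_add_le (phi f Λ.q y) (phi f Λ.q z₁ - phi f Λ.q y)
  rw [add_sub_cancel] at h5
  linarith

end Level

lemma abs_exp_sub_one_le_mul (t : ℝ) : |Real.exp t - 1| ≤ |t| * Real.exp |t| := by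
  have h1 := Real.add_one_le_exp t
  have h2 := Real.add_one_le_exp (-t)
  have h3 : Real.exp t * Real.exp (-t) = 1 := by rw [← Real.exp_add]; simp
  have h4 := Real.exp_pos t
  have h5 : Real.exp t - 1 ≤ t * Real.exp t := by nlinarith
  rcases le_total 0 t with h | h
  · rw [abs_of_nonneg h, abs_of_nonneg (by linarith)]; exact h5
  · rw [abs_of_nonpos h, abs_of_nonpos (by linarith [Real.exp_le_one_iff.2 h])]
    have := Real.one_le_exp (show 0 ≤ -t by linarith)
    nlinarith

lemma smooth_exp_phi (f : SmoothCircleDiffeoLift) (l : ℕ) :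
    ContDiff ℝ ∞ (fun x => Real.exp (phi f l x)) :=
  Real.contDiff_exp.comp (smooth_phi f l)

lemma deriv_exp_phi (f : SmoothCircleDiffeoLift) (l : ℕ) (y : ℝ) :
    deriv (fun x => Real.exp (phi f l x)) y = deriv (phi f l) y * Real.exp (phi f l y) := by
  rw [((hasDerivAt_phi f l y).exp).deriv, mul_comm]

namespace Level

variable {f : SmoothCircleDiffeoLift} {B : ℝ} (Λ : Level f B)

lemma exp_phi_le {L : ℝ} (hL : ∀ x, |deriv (phi f 1) x| ≤ L) (x : ℝ) {l : ℕ}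
    (hl : l ≤ Λ.N) : Real.exp (phi f l x) ≤ Real.exp (2 * L) * (Λ.r / Λ.m x) := by
  have h := Λ.exp_phi_mul_m_le hL x hl
  have hm := Λ.m_pos x
  rw [← mul_div_assoc, le_div_iff₀ hm]
  refine h.trans ?_
  gcongr
  exact (Λ.m_le _).trans Λ.M_le_r

variable (f B)

lemma exists_m_mul_deriv_phi_le : ∃ C : ℝ, 1 ≤ C ∧ ∀ (Λ : Level f B) (l : ℕ), l ≤ Λ.N → ∀ x,
    |Λ.m x * deriv (phi f l) x| ≤ C * Λ.r := by
  obtain ⟨C₀, hC₀, hS⟩ := exists_schwarz_bound f B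
  obtain ⟨C₁, hC₁, hq⟩ := exists_phi_q_le_r f B
  refine ⟨2 * (C₁ * Real.exp B) + 2 * C₀ + 1, ?_, fun Λ l hl => ?_⟩
  · have := Real.exp_pos B
    have : 0 ≤ C₁ * Real.exp B := by positivity
    linarith
  have hr := Λ.r_pos
  set K := C₁ * Real.exp B with hK
  have hK0 : 0 ≤ K := by positivity
  obtain ⟨z, hz⟩ := exists_isMax_of_periodic (g := fun x => (Λ.m x * deriv (phi f l) x) ^ 2)
    ((Λ.smooth_m.continuous.mul (contDiff_deriv (smooth_phi f l)).continuous).pow 2)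
    (fun x => by simp only [Λ.m_periodic x, deriv_phi_periodic f l x])
  suffices h : |Λ.m z * deriv (phi f l) z| ≤ (2 * K + 2 * C₀ + 1) * Λ.r from
    fun x => (sq_le_sq.1 (hz x)).trans h
  have hmax : IsLocalMax (fun x => (Λ.m x * deriv (phi f l) x) ^ 2) z :=
    Filter.Eventually.of_forall hz
  set G := Λ.m z * deriv (phi f l) z with hG
  by_cases hG0 : G = 0
  · rw [hG0, abs_zero]; positivity
  set m' := Λ.s * (Real.exp (phi f Λ.q z) - 1) with hm'
  have hd := hmax.hasDerivAt_eq_zero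
    (((Λ.hasDerivAt_m z).mul (hasDerivAt_deriv_phi f l z)).pow 2)
  have h1 : m' * deriv (phi f l) z + Λ.m z * deriv (deriv (phi f l)) z = 0 := by
    have : 2 * G * (m' * deriv (phi f l) z + Λ.m z * deriv (deriv (phi f l)) z) = 0 := by
      simpa [G, m'] using hd
    exact (mul_eq_zero.1 this).resolve_left (by simpa using hG0)
  have hmz := Λ.m_pos z
  have h2 : m' * G + Λ.m z ^ 2 * schwarz f l z + G ^ 2 / 2 = 0 := by
    unfold schwarz
    rw [hG]
    linear_combination Λ.m z * h1
  have h3 : |m'| ≤ K * Λ.r := by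
    rw [hm', abs_mul, abs_s, one_mul]
    calc _ ≤ _ := abs_exp_sub_one_le_mul _
      _ ≤ (C₁ * Λ.r) * Real.exp B := by
        gcongr
        · exact hq Λ z
        · exact Λ.phi_le z
      _ = _ := by ring
  have h4 : |Λ.m z ^ 2 * schwarz f l z| ≤ C₀ * Λ.r ^ 2 := by
    rw [abs_mul, abs_of_nonneg (sq_nonneg _)]
    calc _ ≤ Λ.m z ^ 2 * (C₀ * (Λ.r / Λ.m z) ^ 2) := by
          gcongr
          exact hS Λ l hl z
      _ = _ := by field_simp
  have h5 : |m' * G| ≤ K * Λ.r * |G| := by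
    rw [abs_mul]; gcongr
  have h6 : |G| ^ 2 ≤ 2 * (K * Λ.r * |G|) + 2 * (C₀ * Λ.r ^ 2) := by
    rw [sq_abs]
    have := (abs_le.1 h5).1
    have := (abs_le.1 h4).1
    linarith
  by_contra! hcon
  have h7 : Λ.r < |G| := lt_of_le_of_lt (by nlinarith) hcon
  have h8 : 2 * C₀ * Λ.r ≤ |G| - 2 * K * Λ.r := by nlinarith
  have h9 : 2 * C₀ * Λ.r < |G| - 2 * K * Λ.r := by nlinarith
  have h10 := mul_lt_mul'' h7 h9 hr.le (by positivity)
  linarith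

lemma exists_iteratedDeriv_schwarz_le (k : ℕ) (C : ℝ) : ∃ C' : ℝ, 1 ≤ C' ∧
    ∀ (Λ : Level f B) (x : ℝ),
      (∀ l ≤ Λ.N, ∀ a, 1 ≤ a → a ≤ k →
        |iteratedDeriv a (phi f l) x| ≤ C * (Λ.r / Λ.m x) ^ a) →
      ∀ l ≤ Λ.N, |iteratedDeriv k (schwarz f l) x| ≤ C' * (Λ.r / Λ.m x) ^ (k + 2) := by
  obtain ⟨L, hL0, hL⟩ := exists_lip f
  obtain ⟨A, hA0, hA⟩ := exists_abs_iteratedDeriv_le_of_periodic (smooth_schwarz f 1)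
    (schwarz_periodic f 1) k
  obtain ⟨C₁, hC₁, h₁⟩ := exists_bound_of_deriv_eq_mul k C
  obtain ⟨C₂, hC₂, h₂⟩ := exists_bound_comp k (C₁ * Real.exp (2 * L))
  set D : ℝ := 2 ^ k * (C₂ * A) * (2 ^ k * C₁ * C₁) with hD
  have hD0 : 0 ≤ D := by positivity
  refine ⟨1 + D * (2 * Real.exp (2 * L) ^ 2), by
    have : 0 ≤ D * (2 * Real.exp (2 * L) ^ 2) := by positivity
    linarith, fun Λ x hx l hl => ?_⟩
  set lam := Λ.r / Λ.m x with hlam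
  have hlam0 : 0 ≤ lam := div_nonneg Λ.r_pos.le (Λ.m_pos x).le
  have hexp : ∀ i ≤ Λ.N, ∀ a ≤ k, |iteratedDeriv a (fun y => Real.exp (phi f i y)) x|
      ≤ C₁ * Real.exp (phi f i x) * lam ^ a := by
    intro i hi a ha
    have := h₁ (phi f i) _ (smooth_phi f i) (smooth_exp_phi f i) (deriv_exp_phi f i) x lam hlam0
      (hx i hi) a ha
    rwa [abs_of_pos (Real.exp_pos _)] at this
  have hterm : ∀ i ≤ Λ.N, |iteratedDeriv k (fun y => schwarz f 1 (f.toFun^[i] y)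
      * (Real.exp (phi f i y) * Real.exp (phi f i y))) x|
      ≤ D * Real.exp (phi f i x) ^ 2 * lam ^ k := by
    intro i hi
    have hc := h₂ (schwarz f 1) (f.toFun^[i]) (smooth_schwarz f 1) (smooth_iterate f i) x A lam
      hlam0 (fun j hj => hA j hj _) (fun b hb => by
        rw [deriv_iterate]
        calc _ ≤ _ := hexp i hi b hb.le
          _ ≤ C₁ * (Real.exp (2 * L) * lam) * lam ^ b := by
            gcongr
            exact Λ.exp_phi_le hL x hi
          _ = _ := by ring)
    have hsq : ∀ j ≤ k, |iteratedDeriv j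
        (fun y => Real.exp (phi f i y) * Real.exp (phi f i y)) x|
        ≤ (2 ^ k * C₁ * C₁ * Real.exp (phi f i x) ^ 2) * lam ^ j := by
      intro j hj
      calc _ ≤ _ := abs_iteratedDeriv_mul_le (smooth_exp_phi f i) (smooth_exp_phi f i)
            (by positivity) hlam0 j (fun a ha => hexp i hi a (ha.trans hj))
            (fun a ha => hexp i hi a (ha.trans hj))
        _ = 2 ^ j * (C₁ * C₁ * Real.exp (phi f i x) ^ 2 * lam ^ j) := by ring
        _ ≤ 2 ^ k * (C₁ * C₁ * Real.exp (phi f i x) ^ 2 * lam ^ j) := by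
          gcongr
          norm_num
        _ = _ := by ring
    calc _ ≤ _ := abs_iteratedDeriv_mul_le ((smooth_schwarz f 1).comp (smooth_iterate f i))
            ((smooth_exp_phi f i).mul (smooth_exp_phi f i)) (by positivity) hlam0 k hc hsq
      _ = _ := by rw [hD]; ring
  have hsum : schwarz f l = fun y => ∑ i ∈ Finset.range l, schwarz f 1 (f.toFun^[i] y)
      * (Real.exp (phi f i y) * Real.exp (phi f i y)) := by
    funext y
    rw [schwarz_eq_sum]
    simp only [sq]
  rw [hsum, iteratedDeriv_fun_sum (f := fun i y => schwarz f 1 (f.toFun^[i] y)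
      * (Real.exp (phi f i y) * Real.exp (phi f i y))) fun i _ => contDiffAt_nat
    (((smooth_schwarz f 1).comp (smooth_iterate f i)).mul
            ((smooth_exp_phi f i).mul (smooth_exp_phi f i))) k x]
  calc _ ≤ ∑ i ∈ Finset.range l, |iteratedDeriv k (fun y => schwarz f 1 (f.toFun^[i] y)
      * (Real.exp (phi f i y) * Real.exp (phi f i y))) x| := Finset.abs_sum_le_sum_abs _ _
    _ ≤ ∑ i ∈ Finset.range l, D * Real.exp (phi f i x) ^ 2 * lam ^ k :=
        Finset.sum_le_sum fun i hi => hterm i ((Finset.mem_range.1 hi).le.trans hl)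
    _ ≤ ∑ i ∈ Finset.range Λ.N, D * Real.exp (phi f i x) ^ 2 * lam ^ k :=
        Finset.sum_le_sum_of_subset_of_nonneg (Finset.range_subset_range.2 hl)
          fun _ _ _ => by positivity
    _ = D * (∑ i ∈ Finset.range Λ.N, Real.exp (phi f i x) ^ 2) * lam ^ k := by
        rw [Finset.mul_sum, Finset.sum_mul]
    _ ≤ D * (2 * Real.exp (2 * L) ^ 2 * lam ^ 2) * lam ^ k := by
        gcongr
        exact Λ.sum_exp_sq_le hL x
    _ = (D * (2 * Real.exp (2 * L) ^ 2)) * lam ^ (k + 2) := by ring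
    _ ≤ _ := by gcongr; linarith

/-- Yoccoz' a priori estimates on the derivatives of the iterates. -/
lemma exists_iteratedDeriv_phi_le (k : ℕ) : ∃ C : ℝ, 1 ≤ C ∧ ∀ (Λ : Level f B) (l : ℕ),
    l ≤ Λ.N → ∀ (x : ℝ) (a : ℕ), 1 ≤ a → a ≤ k →
      |iteratedDeriv a (phi f l) x| ≤ C * (Λ.r / Λ.m x) ^ a := by
  induction k with
  | zero => exact ⟨1, le_rfl, fun Λ l hl x a h1 h2 => by omega⟩
  | succ k ih =>
    obtain ⟨C, hC, h⟩ := ih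
    rcases Nat.eq_zero_or_pos k with rfl | hk
    · obtain ⟨C₁, hC₁, h₁⟩ := exists_m_mul_deriv_phi_le f B
      refine ⟨C₁, hC₁, fun Λ l hl x a ha1 ha2 => ?_⟩
      obtain rfl : a = 1 := by omega
      have hm := Λ.m_pos x
      have := h₁ Λ l hl x
      rw [abs_mul, abs_of_pos hm] at this
      rw [iteratedDeriv_one, pow_one, ← mul_div_assoc, le_div_iff₀ hm]
      linarith
    · obtain ⟨k, rfl⟩ : ∃ j, k = j + 1 := ⟨k - 1, by omega⟩
      obtain ⟨C', hC', hS⟩ := exists_iteratedDeriv_schwarz_le f B k C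
      refine ⟨max C (C' + 2 ^ k * C * C / 2), le_max_of_le_left hC, fun Λ l hl x a ha1 ha2 => ?_⟩
      set lam := Λ.r / Λ.m x with hlam
      have hlam0 : 0 ≤ lam := div_nonneg Λ.r_pos.le (Λ.m_pos x).le
      rcases Nat.lt_or_ge a (k + 2) with h1 | h1
      · refine (h Λ l hl x a ha1 (by omega)).trans ?_
        gcongr
        exact le_max_left _ _
      · obtain rfl : a = k + 2 := by omega
        have e : deriv (deriv (phi f l)) = fun y => schwarz f l y
            + (1 / 2 : ℝ) * (deriv (phi f l) y * deriv (phi f l) y) := by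
          funext y; unfold schwarz; ring
        have hs := contDiff_deriv (smooth_phi f l)
        rw [iteratedDeriv_succ', iteratedDeriv_succ', e,
          iteratedDeriv_fun_add (contDiffAt_nat (smooth_schwarz f l) k x)
          (contDiffAt_nat (contDiff_const.mul (hs.mul hs)) k x),
          iteratedDeriv_const_mul_field (1 / 2 : ℝ)
            (fun y => deriv (phi f l) y * deriv (phi f l) y)]
        have h2 := hS Λ x (fun l hl a ha1 ha2 => h Λ l hl x a ha1 (by omega)) l hl
        have h3 : ∀ j ≤ k, |iteratedDeriv j (deriv (phi f l)) x| ≤ (C * lam) * lam ^ j := by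
          intro j hj
          rw [← iteratedDeriv_succ']
          refine (h Λ l hl x (j + 1) (by omega) (by omega)).trans (le_of_eq ?_)
          ring
        have h4 := abs_iteratedDeriv_mul_le hs hs (by positivity) hlam0 k h3 h3
        refine (abs_add_le _ _).trans ?_
        rw [abs_mul, abs_of_pos (by norm_num : (0 : ℝ) < 1 / 2)]
        calc _ ≤ C' * lam ^ (k + 2) + 1 / 2 * (2 ^ k * (C * lam) * (C * lam) * lam ^ k) := by
              gcongr
          _ = (C' + 2 ^ k * C * C / 2) * lam ^ (k + 2) := by ring
          _ ≤ _ := by gcongr; exact le_max_right _ _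

end Level

namespace Level

variable {f : SmoothCircleDiffeoLift} {B : ℝ} (Λ : Level f B)

lemma m_le_of_mem_iterate (i : ℕ) : ∀ x, ∀ y ∈ Set.uIcc x (Λ.F^[i] x),
    Λ.m y ≤ Real.exp B ^ i * Λ.m x ∧ Λ.m x ≤ Real.exp B ^ i * Λ.m y := by
  have hB : 1 ≤ Real.exp B := Real.one_le_exp Λ.B_nonneg
  induction i with
  | zero =>
    intro x y hy
    have : y = x := by simpa using hy
    simp [this]
  | succ i ih =>
    intro x y hy
    rw [Function.iterate_succ_apply] at hy
    have hx := Λ.m_pos x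
    have hyp := Λ.m_pos y
    have h1 : Real.exp B ≤ Real.exp B ^ (i + 1) := le_self_pow₀ hB (by omega)
    rcases Set.uIcc_subset_uIcc_union_uIcc (b := Λ.F x) hy with h | h
    · have := Λ.m_le_of_mem h
      exact ⟨this.1.trans (by gcongr), this.2.trans (by gcongr)⟩
    · have h2 := ih (Λ.F x) y h
      have h3 := Λ.m_le_of_mem (x := x) Set.right_mem_uIcc
      have h4 : 0 ≤ Real.exp B ^ i := by positivity
      rw [pow_succ]
      constructor
      · calc _ ≤ _ := h2.1
          _ ≤ Real.exp B ^ i * (Real.exp B * Λ.m x) := by gcongr; exact h3.1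
          _ = _ := by ring
      · calc _ ≤ _ := h3.2
          _ ≤ Real.exp B * (Real.exp B ^ i * Λ.m y) := by gcongr; exact h2.2
          _ = _ := by ring

lemma s_mul_iterate_succ (x : ℝ) (i : ℕ) :
    Λ.s * Λ.F^[i + 1] x = Λ.s * Λ.F^[i] x + Λ.m (Λ.F^[i] x) := by
  rw [Function.iterate_succ_apply', m_eq]; ring

lemma monotone_s_mul_iterate (x : ℝ) : Monotone fun i => Λ.s * Λ.F^[i] x :=
  monotone_nat_of_le_succ fun i => by
    rw [s_mul_iterate_succ]
    linarith [Λ.m_pos (Λ.F^[i] x)]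

lemma iterate_le (x : ℝ) (i : ℕ) :
    Λ.s * Λ.F^[i] x ≤ Λ.s * x + i * (Real.exp B ^ i * Λ.m x) := by
  have hB : 1 ≤ Real.exp B := Real.one_le_exp Λ.B_nonneg
  have hx := Λ.m_pos x
  induction i with
  | zero => simp
  | succ i ih =>
    rw [s_mul_iterate_succ]
    have h1 := (Λ.m_le_of_mem_iterate i x _ Set.right_mem_uIcc).1
    have h2 : Real.exp B ^ i * Λ.m x ≤ Real.exp B ^ (i + 1) * Λ.m x := by
      gcongr
      omega
    push_cast
    nlinarith

variable (f) in
lemma exists_chain_interpolation (K : ℕ) (hK : 1 ≤ K) (B : ℝ) : ∃ C : ℝ, 1 ≤ C ∧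
    ∀ (Λ : Level f B) (g : ℝ → ℝ), ContDiff ℝ ∞ g → ∀ x A D : ℝ,
      (∀ i < 2 ^ K, |g (Λ.F^[i] x)| ≤ A) →
      (∀ y, Λ.m x ≤ Real.exp B ^ 2 ^ K * Λ.m y → |iteratedDeriv K g y| ≤ D) →
      ∀ y ∈ Set.uIcc x (Λ.F x), |g y| ≤ C * (A + D * Λ.m x ^ K) := by
  set E := Real.exp B ^ 2 ^ K with hE
  have hE0 : 0 < E := by positivity
  obtain ⟨C, hC, h⟩ := exists_interpolation_bound K (Λ := 2 ^ K * E * E) (by positivity)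
  refine ⟨C, hC, fun Λ g hg x A D hA hD y hy => ?_⟩
  have hm := Λ.m_pos x
  have hB : 1 ≤ Real.exp B := Real.one_le_exp Λ.B_nonneg
  have h2K : 2 ≤ 2 ^ K := le_self_pow₀ (by norm_num) (by omega)
  have hEi : ∀ i ≤ 2 ^ K, Real.exp B ^ i ≤ E := fun i hi => pow_le_pow_right₀ hB hi
  set R := 2 ^ K - 1 with hR
  set d := Λ.m x / E with hd
  have hd0 : 0 < d := by positivity
  have hdm : d ≤ Λ.m x := div_le_self hm.le (one_le_pow₀ hB)
  have hmem : ∀ z ∈ Set.uIcc x (Λ.F^[R] x), |iteratedDeriv K g z| ≤ D := by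
    intro z hz
    refine hD z ((Λ.m_le_of_mem_iterate R x z hz).2.trans ?_)
    have := Λ.m_pos z
    gcongr
    exact hEi R (by omega)
  have hlen : Λ.s * Λ.F^[R] x - Λ.s * x ≤ 2 ^ K * E * E * d := by
    have h1 := Λ.iterate_le x R
    have h2 : 2 ^ K * E * E * d = 2 ^ K * (E * Λ.m x) := by rw [hd]; field_simp
    have h3 : (R : ℝ) * (Real.exp B ^ R * Λ.m x) ≤ 2 ^ K * (E * Λ.m x) := by
      gcongr
      · have : (R : ℝ) ≤ ((2 ^ K : ℕ) : ℝ) := by exact_mod_cast Nat.sub_le _ _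
        simpa using this
      · exact hEi R (by omega)
    linarith
  have hgap : ∀ i ≤ 2 ^ K, d ≤ Λ.m (Λ.F^[i] x) := by
    intro i hi
    have h1 := (Λ.m_le_of_mem_iterate i x _ Set.right_mem_uIcc).2
    have := Λ.m_pos (Λ.F^[i] x)
    rw [hd, div_le_iff₀ hE0, mul_comm]
    exact h1.trans (by gcongr; exact hEi i hi)
  have hmono := Λ.monotone_s_mul_iterate x
  have hy' : y ∈ Set.uIcc x (Λ.F^[R] x) := by
    refine Set.uIcc_subset_uIcc Set.left_mem_uIcc ?_ hy
    have h1 := hmono (show 0 ≤ 1 by omega)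
    have h2 := hmono (show 1 ≤ R by omega)
    simp only [Function.iterate_zero, id_eq, Function.iterate_one] at h1 h2
    rw [Set.mem_uIcc]
    rcases Λ.s_eq with hs | hs <;> rw [hs] at h1 h2
    · left; constructor <;> linarith
    · right; constructor <;> linarith
  have hA0 : 0 ≤ A := (abs_nonneg _).trans (hA 0 (by positivity))
  have hD0 : 0 ≤ D := (abs_nonneg _).trans (hmem y hy')
  have key : |g y| ≤ C * (A * (d ^ 0)⁻¹ + D * d ^ (K - 0)) := by
    rcases Λ.s_eq with hs | hs
    · simp only [hs, one_mul] at hmono hlen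
      have hle : x ≤ Λ.F^[R] x := hmono (Nat.zero_le R)
      rw [Set.uIcc_of_le hle] at hy' hmem
      refine h g hg (fun i => Λ.F^[i] x) x (Λ.F^[R] x) d A D hd0 hlen ?_ ?_ hA hmem 0
        (Nat.zero_le _) y hy'
      · intro i hi
        have h1 := Λ.s_mul_iterate_succ x i
        rw [hs, one_mul, one_mul] at h1
        rw [h1]
        linarith [hgap i (by omega)]
      · intro i hi
        exact ⟨hmono (Nat.zero_le i), hmono (show i ≤ R by omega)⟩
    · simp only [hs] at hmono hlen
      have hanti : ∀ i j, i ≤ j → Λ.F^[j] x ≤ Λ.F^[i] x := fun i j hij => by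
        have := hmono hij
        simp only at this
        linarith
      have hle : Λ.F^[R] x ≤ x := hanti 0 R (Nat.zero_le R)
      rw [Set.uIcc_of_ge hle] at hy' hmem
      refine h g hg (fun i => Λ.F^[R - i] x) (Λ.F^[R] x) x d A D hd0 (by linarith) ?_ ?_ ?_ hmem 0
        (Nat.zero_le _) y hy'
      · intro i hi
        have e : R - i = (R - (i + 1)) + 1 := by omega
        have h1 := Λ.s_mul_iterate_succ x (R - (i + 1))
        rw [hs] at h1
        rw [e]
        linarith [hgap (R - (i + 1)) (by omega)]
      · intro i hi
        exact ⟨hanti _ _ (Nat.sub_le _ _), hanti 0 _ (Nat.zero_le _)⟩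
      · intro i hi
        exact hA _ (by omega)
  refine key.trans ?_
  simp only [pow_zero, inv_one, mul_one, Nat.sub_zero]
  gcongr

/-- Two consecutive levels. -/
structure Next (Λ Λ' : Level f B) : Prop where
  s_eq : Λ'.s = -Λ.s
  q_le : Λ'.q ≤ Λ.N
  ret_ret : ∀ x, 0 < Λ.s * (Λ.F (Λ'.F x) - x)

variable {Λ} {Λ' : Level f B}

lemma F_comm (Λ Λ' : Level f B) (x : ℝ) : Λ.F (Λ'.F x) = Λ'.F (Λ.F x) := ret_comm f _ _ _ _ x

lemma Next.mem_uIcc (h : Next Λ Λ') {x y : ℝ} (hy : y ∈ Set.uIcc x (Λ'.F x)) :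
    x ∈ Set.uIcc y (Λ.F y) := by
  have h1 := Λ'.mem_uIcc_iff.1 hy
  rw [m_eq, h.s_eq] at h1
  rw [Λ.mem_uIcc_iff, m_eq]
  have h2 := h.ret_ret x
  have hmon : Monotone Λ.F := (ret_strictMono f Λ.q Λ.p).monotone
  rcases Λ.s_eq with hs | hs <;> rw [hs] at h1 h2 ⊢
  · have h3 := hmon (show Λ'.F x ≤ y by linarith)
    constructor <;> linarith
  · have h3 := hmon (show y ≤ Λ'.F x by linarith)
    constructor <;> linarith

lemma exists_F_sub (Λ : Level f B) (x y : ℝ) :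
    ∃ ξ ∈ Set.uIcc x y, Λ.F y - Λ.F x = Real.exp (phi f Λ.q ξ) * (y - x) := by
  obtain ⟨ξ, hξ, h⟩ := exists_iterate_sub_eq f Λ.q x y
  exact ⟨ξ, hξ, by rw [← h]; unfold F ret; ring⟩

lemma exists_m_F (Λ Λ' : Level f B) (x : ℝ) : ∃ ξ ∈ Set.uIcc x (Λ'.F x),
    Λ'.m (Λ.F x) = Real.exp (phi f Λ.q ξ) * Λ'.m x := by
  obtain ⟨ξ, hξ, he⟩ := Λ.exists_F_sub x (Λ'.F x)
  refine ⟨ξ, hξ, ?_⟩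
  rw [m_eq, m_eq, ← F_comm, he]; ring

lemma m_iterate_le (Λ Λ' : Level f B) (i : ℕ) (x : ℝ) :
    Λ'.m (Λ.F^[i] x) ≤ Real.exp B ^ i * Λ'.m x := by
  induction i with
  | zero => simp
  | succ i ih =>
    rw [Function.iterate_succ_apply']
    obtain ⟨ξ, -, he⟩ := exists_m_F Λ Λ' (Λ.F^[i] x)
    have := Λ'.m_pos (Λ.F^[i] x)
    rw [he, pow_succ']
    calc _ ≤ Real.exp B * (Real.exp B ^ i * Λ'.m x) := by
          gcongr
          exact (abs_le.1 (Λ.phi_le ξ)).2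
      _ = _ := by ring

lemma phi_F_sub (Λ Λ' : Level f B) (x : ℝ) : phi f Λ'.q (Λ.F x) - phi f Λ'.q x
    = phi f Λ.q (Λ'.F x) - phi f Λ.q x := by
  have h1 := phi_iterate_sub f Λ.q Λ.p Λ'.q x
  have h2 : phi f Λ.q (Λ'.F x) = phi f Λ.q (f.toFun^[Λ'.q] x) := by
    unfold F ret
    rw [phi_sub_int]
  rw [h2, h1]; rfl

variable (f B)

lemma exists_phi_F_sub_le : ∃ C : ℝ, 1 ≤ C ∧ ∀ Λ Λ' : Level f B, Next Λ Λ' → ∀ x,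
    |phi f Λ'.q (Λ.F x) - phi f Λ'.q x| ≤ C * (Λ.r * (Λ'.m x / Λ.m x)) := by
  obtain ⟨C, hC, h⟩ := exists_iteratedDeriv_phi_le f B 1
  refine ⟨1 + C * Real.exp B, by have := Real.exp_pos B; nlinarith, fun Λ Λ' hn x => ?_⟩
  have hm := Λ.m_pos x
  have hm' := Λ'.m_pos x
  have hr := Λ.r_pos
  rw [phi_F_sub]
  have h1 := Convex.norm_image_sub_le_of_norm_hasDerivWithin_le (f := phi f Λ.q)
    (s := Set.uIcc x (Λ'.F x)) (C := C * (Real.exp B * Λ.r / Λ.m x))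
    (fun t _ => (hasDerivAt_phi f Λ.q t).hasDerivWithinAt)
    (fun t ht => by
      have h2 := h Λ Λ.q Λ.q_le t 1 le_rfl le_rfl
      rw [iteratedDeriv_one, pow_one] at h2
      rw [Real.norm_eq_abs]
      refine h2.trans ?_
      gcongr C * ?_
      have h3 := (Λ.m_le_of_mem (hn.mem_uIcc ht)).1
      have := Λ.m_pos t
      rw [div_le_div_iff₀ this hm]
      nlinarith) (convex_uIcc _ _) Set.left_mem_uIcc Set.right_mem_uIcc
  rw [Real.norm_eq_abs, Real.norm_eq_abs] at h1
  refine h1.trans ?_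
  change C * (Real.exp B * Λ.r / Λ.m x) * Λ'.m x ≤ _
  calc _ = (C * Real.exp B) * (Λ.r * (Λ'.m x / Λ.m x)) := by ring
    _ ≤ _ := by gcongr; linarith

lemma exists_phi_next_osc_le (K : ℕ) (hK : 1 ≤ K) : ∃ C : ℝ, 1 ≤ C ∧ ∀ Λ Λ' : Level f B,
    Next Λ Λ' → ∀ x, ∀ y ∈ Set.uIcc x (Λ.F x),
    |phi f Λ'.q y - phi f Λ'.q x| ≤ C * (Λ.r * (Λ'.m x / Λ.m x) + Λ.r ^ K) := by
  obtain ⟨C₁, hC₁, h₁⟩ := exists_phi_F_sub_le f B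
  obtain ⟨C₂, hC₂, h₂⟩ := exists_iteratedDeriv_phi_le f B K
  obtain ⟨C₃, hC₃, h₃⟩ := exists_chain_interpolation f K hK B
  set E := Real.exp B ^ 2 ^ K with hE
  have hE0 : 0 < E := by positivity
  refine ⟨C₃ * (C₁ * 2 ^ K * E * E + C₂ * E ^ K + 1), ?_, fun Λ Λ' hn x y hy => ?_⟩
  · have : 0 ≤ C₁ * 2 ^ K * E * E := by positivity
    have : 0 ≤ C₂ * E ^ K := by positivity
    nlinarith
  have hB : 1 ≤ Real.exp B := Real.one_le_exp Λ.B_nonneg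
  have hEi : ∀ i ≤ 2 ^ K, Real.exp B ^ i ≤ E := fun i hi => pow_le_pow_right₀ hB hi
  have hm := Λ.m_pos x
  have hm' := Λ'.m_pos x
  have hr := Λ.r_pos
  set w := Λ.r * (Λ'.m x / Λ.m x) with hw
  have hw0 : 0 < w := by positivity
  have hstep : ∀ i ≤ 2 ^ K, |phi f Λ'.q (Λ.F^[i] x) - phi f Λ'.q x| ≤ i * (C₁ * (E * E * w)) := by
    intro i
    induction i with
    | zero => simp
    | succ i ih =>
      intro hi
      have h4 := h₁ Λ Λ' hn (Λ.F^[i] x)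
      rw [← Function.iterate_succ_apply' Λ.F] at h4
      have h5 : Λ'.m (Λ.F^[i] x) / Λ.m (Λ.F^[i] x) ≤ E * E * (Λ'.m x / Λ.m x) := by
        have h6 := m_iterate_le Λ Λ' i x
        have h7 := (Λ.m_le_of_mem_iterate i x _ Set.right_mem_uIcc).2
        have h8 := hEi i (by omega)
        have h9 := Λ.m_pos (Λ.F^[i] x)
        rw [← mul_div_assoc, div_le_div_iff₀ h9 hm]
        calc _ ≤ (E * Λ'.m x) * (E * Λ.m (Λ.F^[i] x)) := by
              gcongr
              · exact h6.trans (by gcongr)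
              · exact h7.trans (by gcongr)
          _ = _ := by ring
      have h6 : |phi f Λ'.q (Λ.F^[i + 1] x) - phi f Λ'.q (Λ.F^[i] x)| ≤ C₁ * (E * E * w) := by
        refine h4.trans ?_
        gcongr C₁ * ?_
        rw [hw]
        calc _ ≤ Λ.r * (E * E * (Λ'.m x / Λ.m x)) := by gcongr
          _ = _ := by ring
      have h7 := ih (by omega)
      have h8 := abs_sub_le (phi f Λ'.q (Λ.F^[i + 1] x)) (phi f Λ'.q (Λ.F^[i] x)) (phi f Λ'.q x)
      push_cast
      linarith
  have h4 := h₃ Λ (fun z => phi f Λ'.q z - phi f Λ'.q x)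
    ((smooth_phi f Λ'.q).sub contDiff_const) x (2 ^ K * (C₁ * (E * E * w)))
    (C₂ * (E * Λ.r / Λ.m x) ^ K) (fun i hi => by
      refine (hstep i hi.le).trans ?_
      have : (i : ℝ) ≤ 2 ^ K := by exact_mod_cast hi.le
      gcongr) (fun z hz => by
      have e : iteratedDeriv K (fun z => phi f Λ'.q z - phi f Λ'.q x) z
          = iteratedDeriv K (phi f Λ'.q) z := by
        rw [iteratedDeriv_fun_sub (contDiffAt_nat (smooth_phi f Λ'.q) K z) contDiffAt_const,
          iteratedDeriv_const, if_neg (by omega), sub_zero]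
      rw [e]
      refine (h₂ Λ Λ'.q hn.q_le z K hK le_rfl).trans ?_
      have := Λ.m_pos z
      have h5 : Λ.r / Λ.m z ≤ E * Λ.r / Λ.m x := by
        rw [div_le_div_iff₀ this hm]
        nlinarith
      gcongr) y hy
  refine h4.trans ?_
  rw [mul_assoc C₃]
  gcongr C₃ * ?_
  have h5 : C₂ * (E * Λ.r / Λ.m x) ^ K * Λ.m x ^ K = C₂ * E ^ K * Λ.r ^ K := by
    rw [div_pow, mul_pow]; field_simp
  rw [h5]
  have h6 : 0 ≤ C₁ * 2 ^ K * E * E := by positivity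
  have h7 : 0 ≤ C₂ * E ^ K := by positivity
  have h8 : 0 ≤ Λ.r ^ K := by positivity
  nlinarith

lemma exists_phi_next_le (K : ℕ) (hK : 1 ≤ K) : ∃ C : ℝ, 1 ≤ C ∧ ∀ Λ Λ' : Level f B,
    Next Λ Λ' → ∀ x, ∀ y ∈ Set.uIcc x (Λ.F x),
    |phi f Λ'.q y| ≤ C * (Λ.r * (Λ'.m x / Λ.m x) + Λ.r ^ K) := by
  obtain ⟨C₁, hC₁, h₁⟩ := exists_phi_next_osc_le f B K hK
  obtain ⟨C₂, hC₂, h₂⟩ := exists_phi_q_le_r f B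
  refine ⟨2 * C₁ + C₂ * Real.exp B * Real.exp B, ?_, fun Λ Λ' hn x y hy => ?_⟩
  · have : 0 ≤ C₂ * Real.exp B * Real.exp B := by positivity
    linarith
  have hm := Λ.m_pos x
  have hm' := Λ'.m_pos x
  have hr := Λ.r_pos
  set w := Λ.r * (Λ'.m x / Λ.m x) with hw
  have hw0 : 0 < w := by positivity
  obtain ⟨ζ, hζ, e1⟩ := Λ'.exists_F_sub x (Λ.F x)
  obtain ⟨ξ, hξ, e2⟩ := Λ.exists_F_sub x (Λ'.F x)
  have e3 : (Real.exp (phi f Λ'.q ζ) - 1) * (Λ.F x - x)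
      = (Real.exp (phi f Λ.q ξ) - 1) * (Λ'.F x - x) := by
    rw [← F_comm] at e1
    linarith
  have e4 : |Real.exp (phi f Λ'.q ζ) - 1| * Λ.m x = |Real.exp (phi f Λ.q ξ) - 1| * Λ'.m x := by
    have := congrArg abs e3
    rwa [abs_mul, abs_mul] at this
  have h3 : |Real.exp (phi f Λ.q ξ) - 1| ≤ C₂ * Λ.r * Real.exp B :=
    (abs_exp_sub_one_le_mul _).trans (by
      gcongr
      · exact h₂ Λ ξ
      · exact Λ.phi_le ξ)
  have h4 : |phi f Λ'.q ζ| ≤ Real.exp B * |Real.exp (phi f Λ'.q ζ) - 1| := by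
    have h5 := Λ'.phi_le ζ
    set t := phi f Λ'.q ζ
    have h6 := Real.add_one_le_exp t
    have h7 := Real.add_one_le_exp (-t)
    have h8 : Real.exp t * Real.exp (-t) = 1 := by rw [← Real.exp_add]; simp
    have h9 : Real.exp (-t) ≤ Real.exp B := Real.exp_le_exp.2 (by linarith [(abs_le.1 h5).1])
    have h10 := Real.one_le_exp Λ.B_nonneg
    rcases le_total 0 t with h | h
    · rw [abs_of_nonneg h, abs_of_nonneg (by linarith)]
      nlinarith
    · have h11 : Real.exp t ≤ 1 := Real.exp_le_one_iff.2 h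
      rw [abs_of_nonpos h, abs_of_nonpos (by linarith)]
      nlinarith
  have h5 : |phi f Λ'.q ζ| ≤ C₂ * Real.exp B * Real.exp B * w := by
    refine h4.trans ?_
    have : |Real.exp (phi f Λ'.q ζ) - 1| ≤ C₂ * Real.exp B * w := by
      rw [hw, ← mul_div_assoc, ← mul_div_assoc, le_div_iff₀ hm, e4]
      nlinarith
    calc _ ≤ Real.exp B * (C₂ * Real.exp B * w) := by gcongr
      _ = _ := by ring
  have h6 := h₁ Λ Λ' hn x y hy
  have h7 := h₁ Λ Λ' hn x ζ hζ
  have h8 : |phi f Λ'.q y| ≤ |phi f Λ'.q y - phi f Λ'.q x| + |phi f Λ'.q ζ - phi f Λ'.q x|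
      + |phi f Λ'.q ζ| := by
    have := abs_add_three (phi f Λ'.q y - phi f Λ'.q x) (-(phi f Λ'.q ζ - phi f Λ'.q x))
      (phi f Λ'.q ζ)
    rw [abs_neg] at this
    refine le_trans (le_of_eq ?_) this
    congr 1
    ring
  have h9 : 0 ≤ C₂ * Real.exp B * Real.exp B * Λ.r ^ K := by positivity
  nlinarith

end Level

lemma exists_threshold (H : CircleDeg1Lift) (x : ℝ) :
    ∃ s₀ : ℝ, (∀ s, s₀ < s → x ≤ H s) ∧ ∀ s, s < s₀ → H s ≤ x := by
  have hint : ∀ k : ℤ, H k = H 0 + k := fun k => by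
    have := H.map_add_int 0 k
    rwa [zero_add] at this
  have hne : ({s | H s ≤ x} : Set ℝ).Nonempty := by
    refine ⟨(⌊x - H 0⌋ : ℤ), ?_⟩
    change H _ ≤ x
    rw [hint]
    linarith [Int.floor_le (x - H 0)]
  have hbdd : BddAbove {s | H s ≤ x} := by
    refine ⟨((⌊x - H 0⌋ + 1 : ℤ) : ℝ), fun s hs => ?_⟩
    by_contra! hlt
    have h1 := H.monotone hlt.le
    rw [hint] at h1
    push_cast at h1
    change H s ≤ x at hs
    linarith [Int.lt_floor_add_one (x - H 0)]
  refine ⟨sSup {s | H s ≤ x}, fun s hs => ?_, fun s hs => ?_⟩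
  · by_contra! h
    exact absurd (le_csSup hbdd (show s ∈ {s | H s ≤ x} from h.le)) (not_le.2 hs)
  · obtain ⟨t, ht, hst⟩ := exists_lt_of_lt_csSup hne hs
    exact (H.monotone hst.le).trans ht

lemma integral_cross {H : ℝ → ℝ} (hH : Monotone H) (s a b : ℝ) :
    ∫ t in s..s + a, (H t - H (t - b)) = ∫ t in (s - b)..s, (H (t + a) - H t) := by
  have hi : ∀ u v, IntervalIntegrable H MeasureTheory.volume u v := fun u v =>
    hH.intervalIntegrable
  have h1 : Monotone fun t => H (t - b) := fun u v h => hH (by linarith)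
  have h2 : Monotone fun t => H (t + a) := fun u v h => hH (by linarith)
  rw [intervalIntegral.integral_sub (hi _ _) h1.intervalIntegrable,
    intervalIntegral.integral_sub h2.intervalIntegrable (hi _ _),
    intervalIntegral.integral_comp_sub_right, intervalIntegral.integral_comp_add_right]
  have e1 := intervalIntegral.integral_add_adjacent_intervals (hi (s - b) s) (hi s (s + a))
  have e2 := intervalIntegral.integral_add_adjacent_intervals (hi (s - b) (s + a - b))
    (hi (s + a - b) (s + a))
  have e3 : s - b + a = s + a - b := by ring
  rw [e3]
  linarith

section cross

variable {H : CircleDeg1Lift} {F G : ℝ → ℝ} {a b x c₁ c₂ : ℝ}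

lemma cross_le (hF : Monotone F) (hG : Monotone G) (ha : 0 ≤ a) (hb : 0 ≤ b)
    (hHF : ∀ s, H (s + a) = F (H s)) (hHG : ∀ s, H (s - b) = G (H s))
    (h₁ : ∀ y ∈ Set.Icc x (F x), c₁ ≤ y - G y) (h₂ : ∀ z ∈ Set.Icc (G x) x, F z - z ≤ c₂) :
    a * c₁ ≤ b * c₂ := by
  obtain ⟨s, hs₁, hs₂⟩ := exists_threshold H x
  have hm1 : Monotone fun t => H (t - b) := fun u v h => H.monotone (by linarith)
  have hm2 : Monotone fun t => H (t + a) := fun u v h => H.monotone (by linarith)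
  have e1 : ∫ _ in s..s + a, c₁ ≤ ∫ t in s..s + a, (H t - H (t - b)) := by
    refine intervalIntegral.integral_mono_on_of_le_Ioo (by linarith) (by simp)
      (H.monotone.intervalIntegrable.sub hm1.intervalIntegrable) fun t ht => ?_
    rw [hHG]
    refine h₁ _ ⟨hs₁ t ht.1, ?_⟩
    have := hHF (t - a)
    rw [sub_add_cancel] at this
    rw [this]
    exact hF (hs₂ _ (by linarith [ht.2]))
  have e2 : ∫ t in (s - b)..s, (H (t + a) - H t) ≤ ∫ _ in (s - b)..s, c₂ := by
    refine intervalIntegral.integral_mono_on_of_le_Ioo (by linarith)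
      (hm2.intervalIntegrable.sub H.monotone.intervalIntegrable) (by simp) fun t ht => ?_
    rw [hHF]
    refine h₂ _ ⟨?_, hs₂ t ht.2⟩
    have := hHG (t + b)
    rw [add_sub_cancel_right] at this
    rw [this]
    exact hG (hs₁ _ (by linarith [ht.1]))
  rw [← integral_cross H.monotone] at e2
  have := e1.trans e2
  simpa using this

lemma le_cross (hF : Monotone F) (hG : Monotone G) (ha : 0 ≤ a) (hb : 0 ≤ b)
    (hHF : ∀ s, H (s + a) = F (H s)) (hHG : ∀ s, H (s - b) = G (H s))
    (h₁ : ∀ y ∈ Set.Icc x (F x), y - G y ≤ c₁) (h₂ : ∀ z ∈ Set.Icc (G x) x, c₂ ≤ F z - z) :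
    b * c₂ ≤ a * c₁ := by
  obtain ⟨s, hs₁, hs₂⟩ := exists_threshold H x
  have hm1 : Monotone fun t => H (t - b) := fun u v h => H.monotone (by linarith)
  have hm2 : Monotone fun t => H (t + a) := fun u v h => H.monotone (by linarith)
  have e1 : ∫ t in s..s + a, (H t - H (t - b)) ≤ ∫ _ in s..s + a, c₁ := by
    refine intervalIntegral.integral_mono_on_of_le_Ioo (by linarith)
      (H.monotone.intervalIntegrable.sub hm1.intervalIntegrable) (by simp) fun t ht => ?_
    rw [hHG]
    refine h₁ _ ⟨hs₁ t ht.1, ?_⟩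
    have := hHF (t - a)
    rw [sub_add_cancel] at this
    rw [this]
    exact hF (hs₂ _ (by linarith [ht.2]))
  have e2 : ∫ _ in (s - b)..s, c₂ ≤ ∫ t in (s - b)..s, (H (t + a) - H t) := by
    refine intervalIntegral.integral_mono_on_of_le_Ioo (by linarith) (by simp)
      (hm2.intervalIntegrable.sub H.monotone.intervalIntegrable) fun t ht => ?_
    rw [hHF]
    refine h₂ _ ⟨?_, hs₂ t ht.2⟩
    have := hHG (t + b)
    rw [add_sub_cancel_right] at this
    rw [this]
    exact hG (hs₁ _ (by linarith [ht.1]))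
  rw [← integral_cross H.monotone] at e2
  have := e2.trans e1
  simpa using this

end cross

section levels

variable {f : SmoothCircleDiffeoLift} {α : ℝ} (hρ : IsRotNumber f.toFun α) (c : Convergents α)
  (hc : c.q 0 = 1)

lemma exists_semiconj (hρ : IsRotNumber f.toFun α) :
    ∃ H : CircleDeg1Lift, ∀ (l : ℕ) (k : ℤ) (s : ℝ), H (s + (l * α - k)) = ret f l k (H s) := by
  set R : CircleDeg1Lift :=
    ((CircleDeg1Lift.translate (Multiplicative.ofAdd α) : CircleDeg1Liftˣ) : CircleDeg1Lift) with hR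
  have hR1 : ∀ s, R s = α + s := fun s => by simp [hR]
  obtain ⟨H, hH⟩ := CircleDeg1Lift.semiconj_of_bijective_of_translationNumber_eq (f₁ := R)
    (f₂ := toDeg1 f) (CircleDeg1Lift.isUnit_iff_bijective.1 (Units.isUnit _)) (bijective_toFun f)
    (by rw [translationNumber_eq hρ, hR, CircleDeg1Lift.translationNumber_translate])
  refine ⟨H, fun l k s => ?_⟩
  have h1 : ∀ l : ℕ, H (s + l * α) = f.toFun^[l] (H s) := by
    intro l
    induction l with
    | zero => simp
    | succ l ih =>
      rw [Function.iterate_succ_apply', ← ih]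
      have := hH (s + l * α)
      rw [hR1] at this
      rw [show s + ((l + 1 : ℕ) : ℝ) * α = α + (s + l * α) by push_cast; ring, this]
      rfl
  have h2 := H.map_sub_int (s + l * α) k
  rw [show s + (l * α - k) = s + l * α - k by ring, h2, h1]
  rfl

lemma a_eq (n : ℕ) : c.a n = c.sgn n * c.err n := by
  unfold Convergents.sgn Convergents.err
  split_ifs with h
  · rw [abs_of_pos h, one_mul]
  · rw [abs_of_nonpos (not_lt.1 h)]; ring

lemma level_next (n : ℕ) : Level.Next (level hρ c hc n) (level hρ c hc (n + 1)) where
  s_eq := sgn_succ c n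
  q_le := by change c.q (n + 1) ≤ 2 * c.q (n + 1); omega
  ret_ret := ret_ret_move c hρ n

lemma F_monotone {B : ℝ} (Λ : Level f B) : Monotone Λ.F := (ret_strictMono f Λ.q Λ.p).monotone

lemma err_mul_le (n : ℕ) {x c₁ c₂ : ℝ}
    (h₁ : ∀ y ∈ Set.uIcc x ((level hρ c hc n).F x), c₁ ≤ (level hρ c hc (n + 1)).m y)
    (h₂ : ∀ z ∈ Set.uIcc x ((level hρ c hc (n + 1)).F x), (level hρ c hc n).m z ≤ c₂) :
    c.err n * c₁ ≤ c.err (n + 1) * c₂ := by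
  obtain ⟨H, hH⟩ := exists_semiconj hρ
  set Λ := level hρ c hc n with hΛ
  set Λ' := level hρ c hc (n + 1) with hΛ'
  have hF : ∀ s, H (s + c.a n) = Λ.F (H s) := fun s => hH (c.q n) (c.p n) s
  have hG : ∀ s, H (s + c.a (n + 1)) = Λ'.F (H s) := fun s => hH (c.q (n + 1)) (c.p (n + 1)) s
  rw [a_eq] at hF hG
  have hsΛ : Λ.s = c.sgn n := rfl
  have hsΛ' : Λ'.s = -c.sgn n := sgn_succ c n
  rw [sgn_succ] at hG
  have hm := Λ.m_pos x
  have hm' := Λ'.m_pos x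
  simp only [Level.m_eq] at h₁ h₂ hm hm'
  rw [hsΛ] at h₂ hm
  rw [hsΛ'] at h₁ hm'
  have e1 := (c.err_pos n).le
  have e2 := (c.err_pos (n + 1)).le
  rcases c.sgn_eq n with hs | hs <;> rw [hs] at hF hG h₁ h₂ hm hm'
  · rw [Set.uIcc_of_le (by linarith)] at h₁
    rw [Set.uIcc_of_ge (by linarith)] at h₂
    refine cross_le (H := H) (x := x) (F_monotone Λ) (F_monotone Λ') e1 e2
      (fun s => ?_) (fun s => ?_)
      (fun y hy => ?_) (fun z hz => ?_)
    · rw [← hF, one_mul]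
    · rw [← hG, neg_one_mul, sub_eq_add_neg]
    · linarith [h₁ y hy]
    · linarith [h₂ z hz]
  · rw [Set.uIcc_of_ge (by linarith)] at h₁
    rw [Set.uIcc_of_le (by linarith)] at h₂
    refine le_cross (H := H) (x := x) (F_monotone Λ') (F_monotone Λ) e2 e1
      (fun s => ?_) (fun s => ?_)
      (fun y hy => ?_) (fun z hz => ?_)
    · rw [← hG, neg_neg, one_mul]
    · rw [← hF, neg_one_mul, sub_eq_add_neg]
    · linarith [h₂ y hy]
    · linarith [h₁ z hz]

lemma le_err_mul (n : ℕ) {x c₁ c₂ : ℝ}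
    (h₁ : ∀ y ∈ Set.uIcc x ((level hρ c hc n).F x), (level hρ c hc (n + 1)).m y ≤ c₁)
    (h₂ : ∀ z ∈ Set.uIcc x ((level hρ c hc (n + 1)).F x), c₂ ≤ (level hρ c hc n).m z) :
    c.err (n + 1) * c₂ ≤ c.err n * c₁ := by
  obtain ⟨H, hH⟩ := exists_semiconj hρ
  set Λ := level hρ c hc n with hΛ
  set Λ' := level hρ c hc (n + 1) with hΛ'
  have hF : ∀ s, H (s + c.a n) = Λ.F (H s) := fun s => hH (c.q n) (c.p n) s
  have hG : ∀ s, H (s + c.a (n + 1)) = Λ'.F (H s) := fun s => hH (c.q (n + 1)) (c.p (n + 1)) s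
  rw [a_eq] at hF hG
  have hsΛ : Λ.s = c.sgn n := rfl
  have hsΛ' : Λ'.s = -c.sgn n := sgn_succ c n
  rw [sgn_succ] at hG
  have hm := Λ.m_pos x
  have hm' := Λ'.m_pos x
  simp only [Level.m_eq] at h₁ h₂ hm hm'
  rw [hsΛ] at h₂ hm
  rw [hsΛ'] at h₁ hm'
  have e1 := (c.err_pos n).le
  have e2 := (c.err_pos (n + 1)).le
  rcases c.sgn_eq n with hs | hs <;> rw [hs] at hF hG h₁ h₂ hm hm'
  · rw [Set.uIcc_of_le (by linarith)] at h₁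
    rw [Set.uIcc_of_ge (by linarith)] at h₂
    refine le_cross (H := H) (x := x) (F_monotone Λ) (F_monotone Λ') e1 e2
      (fun s => ?_) (fun s => ?_)
      (fun y hy => ?_) (fun z hz => ?_)
    · rw [← hF, one_mul]
    · rw [← hG, neg_one_mul, sub_eq_add_neg]
    · linarith [h₁ y hy]
    · linarith [h₂ z hz]
  · rw [Set.uIcc_of_ge (by linarith)] at h₁
    rw [Set.uIcc_of_le (by linarith)] at h₂
    refine cross_le (H := H) (x := x) (F_monotone Λ') (F_monotone Λ) e2 e1
      (fun s => ?_) (fun s => ?_)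
      (fun y hy => ?_) (fun z hz => ?_)
    · rw [← hG, neg_neg, one_mul]
    · rw [← hF, neg_one_mul, sub_eq_add_neg]
    · linarith [h₂ y hy]
    · linarith [h₁ z hz]

lemma maxGap_two_le (n : ℕ) (hρ : IsRotNumber f.toFun α) (hc : c.q 0 = 1) :
    maxGap f c (n + 2) * (1 + Real.exp (-denjoyBound f)) ≤ maxGap f c n := by
  set Λ := level hρ c hc n with hΛ
  set Λ' := level hρ c hc (n + 2) with hΛ'
  have hpos : 0 < 1 + Real.exp (-denjoyBound f) := by positivity
  rw [← le_div_iff₀ hpos]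
  refine ciSup_le fun x => ?_
  change Λ'.m x ≤ Λ.M / _
  rw [le_div_iff₀ hpos]
  refine le_trans ?_ (Λ.m_le x)
  have hs : Λ'.s = Λ.s := by
    change c.sgn (n + 2) = c.sgn n
    rw [sgn_succ, sgn_succ, neg_neg]
  have h1 := (Λ'.m_le_of_mem (x := x) Set.right_mem_uIcc).2
  have h2 : Real.exp (-denjoyBound f) * Λ'.m x ≤ Λ'.m (Λ'.F x) := by
    rw [Real.exp_neg, inv_mul_le_iff₀ (Real.exp_pos _)]
    exact h1
  have h3 : Λ'.m x + Λ'.m (Λ'.F x) ≤ Λ.m x := by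
    have e : Λ'.F (Λ'.F x) = f.toFun^[c.q (n + 2) + c.q (n + 2)] x
        + ((-c.p (n + 2) - c.p (n + 2) : ℤ) : ℝ) := by
      change ret f (c.q (n + 2)) (c.p (n + 2)) (ret f (c.q (n + 2)) (c.p (n + 2)) x) = _
      unfold ret
      have := iterate_add_int f (c.q (n + 2)) (f.toFun^[c.q (n + 2)] x) (-c.p (n + 2))
      push_cast at this ⊢
      rw [← sub_eq_add_neg] at this
      rw [this, Function.iterate_add_apply]
      ring
    have e' : Λ.F x = f.toFun^[c.q n] x + ((-c.p n : ℤ) : ℝ) := by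
      change ret f (c.q n) (c.p n) x = _
      unfold ret; push_cast; ring
    have h4 : 2 * c.err (n + 2) < c.err n := by
      linarith [c.err_add_le n, c.err_succ_lt (n + 1)]
    have a1 := a_eq c n
    have a2 := a_eq c (n + 2)
    rw [sgn_succ, sgn_succ, neg_neg] at a2
    have hsn : Λ.s = c.sgn n := rfl
    unfold Convergents.a at a1 a2
    rw [Level.m_eq, Level.m_eq, Level.m_eq, hs, hsn]
    rcases c.sgn_eq n with h | h <;> rw [h] at a1 a2 ⊢
    · have := iterate_add_lt hρ (l := c.q (n + 2) + c.q (n + 2)) (l' := c.q n)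
        (k := -c.p (n + 2) - c.p (n + 2)) (k' := -c.p n) (by push_cast; linarith) x
      rw [← e, ← e'] at this
      linarith
    · have := iterate_add_lt hρ (l' := c.q (n + 2) + c.q (n + 2)) (l := c.q n)
        (k' := -c.p (n + 2) - c.p (n + 2)) (k := -c.p n) (by push_cast; linarith) x
      rw [← e, ← e'] at this
      linarith
  linarith

/-- Comparison of consecutive displacements with the corresponding ratio for the rotation. -/
lemma exists_ratio_le (f : SmoothCircleDiffeoLift) (K : ℕ) (hK : 1 ≤ K) : ∃ C : ℝ, 1 ≤ C ∧
    ∀ (α : ℝ) (hρ : IsRotNumber f.toFun α) (c : Convergents α) (hc : c.q 0 = 1) (n : ℕ) (x : ℝ),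
    |(level hρ c hc (n + 1)).m x - c.err (n + 1) / c.err n * (level hρ c hc n).m x|
      ≤ C * ((level hρ c hc n).r * (level hρ c hc (n + 1)).m x
        + (level hρ c hc n).r ^ K * (level hρ c hc n).m x) := by
  set B := denjoyBound f with hB
  obtain ⟨C₁, hC₁, h₁⟩ := Level.exists_phi_next_le f B K hK
  obtain ⟨C₂, hC₂, h₂⟩ := Level.exists_phi_q_le_r f B
  set E := Real.exp B with hE
  have hE0 : 0 < E := Real.exp_pos _
  refine ⟨C₁ * E + C₂ * E + 1, ?_, fun α hρ c hc n x => ?_⟩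
  · have : 0 ≤ C₁ * E := by positivity
    have : 0 ≤ C₂ * E := by positivity
    linarith
  have hn := level_next hρ c hc n
  set Λ := level hρ c hc n with hΛ
  set Λ' := level hρ c hc (n + 1) with hΛ'
  have hm := Λ.m_pos x
  have hm' := Λ'.m_pos x
  have hr := Λ.r_pos
  set W := Λ.r * Λ'.m x + Λ.r ^ K * Λ.m x with hW
  have hW0 : 0 ≤ W := by positivity
  have hrW : Λ.r * Λ'.m x ≤ W := by
    have : 0 ≤ Λ.r ^ K * Λ.m x := by positivity
    linarith
  have hu : ∀ y ∈ Set.uIcc x (Λ.F x), |Λ'.m y - Λ'.m x| ≤ C₁ * E * W := by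
    intro y hy
    obtain ⟨ξ, hξ, he⟩ := Λ'.exists_F_sub x y
    have hξ' : ξ ∈ Set.uIcc x (Λ.F x) := Set.uIcc_subset_uIcc Set.left_mem_uIcc hy hξ
    have e : Λ'.m y - Λ'.m x = Λ'.s * ((Real.exp (phi f Λ'.q ξ) - 1) * (y - x)) := by
      rw [Level.m_eq, Level.m_eq]
      linear_combination Λ'.s * he
    rw [e, abs_mul, Λ'.abs_s, one_mul, abs_mul]
    have h3 := h₁ Λ Λ' hn x ξ hξ'
    have h4 := Λ.abs_sub_le_m hy Set.left_mem_uIcc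
    calc _ ≤ (C₁ * (Λ.r * (Λ'.m x / Λ.m x) + Λ.r ^ K) * E) * Λ.m x := by
          gcongr
          refine (abs_exp_sub_one_le_mul _).trans ?_
          gcongr
          exact Real.exp_le_exp.2 (Λ'.phi_le ξ)
      _ = _ := by rw [hW]; field_simp
  have hmm : ∀ z ∈ Set.uIcc x (Λ'.F x), |Λ.m z - Λ.m x| ≤ C₂ * E * W := by
    intro z hz
    obtain ⟨ξ, hξ, he⟩ := Λ.exists_F_sub x z
    have e : Λ.m z - Λ.m x = Λ.s * ((Real.exp (phi f Λ.q ξ) - 1) * (z - x)) := by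
      rw [Level.m_eq, Level.m_eq]
      linear_combination Λ.s * he
    rw [e, abs_mul, Λ.abs_s, one_mul, abs_mul]
    have h4 := Λ'.abs_sub_le_m hz Set.left_mem_uIcc
    calc _ ≤ (C₂ * Λ.r * E) * Λ'.m x := by
          gcongr
          refine (abs_exp_sub_one_le_mul _).trans ?_
          gcongr
          · exact h₂ Λ ξ
          · exact Real.exp_le_exp.2 (Λ.phi_le ξ)
      _ = C₂ * E * (Λ.r * Λ'.m x) := by ring
      _ ≤ _ := by gcongr
  have a1 := c.err_pos n
  have a2 := c.err_pos (n + 1)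
  have a3 := c.err_succ_lt n
  have k1 := err_mul_le hρ c hc n (x := x) (c₁ := Λ'.m x - C₁ * E * W)
    (c₂ := Λ.m x + C₂ * E * W)
    (fun y hy => by have := (abs_le.1 (hu y hy)).1; linarith)
    (fun z hz => by have := (abs_le.1 (hmm z hz)).2; linarith)
  have k2 := le_err_mul hρ c hc n (x := x) (c₁ := Λ'.m x + C₁ * E * W)
    (c₂ := Λ.m x - C₂ * E * W)
    (fun y hy => by have := (abs_le.1 (hu y hy)).2; linarith)
    (fun z hz => by have := (abs_le.1 (hmm z hz)).1; linarith)
  set θ := c.err (n + 1) / c.err n with hθ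
  have hθe : c.err (n + 1) = θ * c.err n := by rw [hθ]; field_simp
  have hθ1 : θ ≤ 1 := by rw [hθ, div_le_one a1]; exact a3.le
  rw [hθe] at k1 k2
  have k1' : Λ'.m x - C₁ * E * W ≤ θ * (Λ.m x + C₂ * E * W) := by
    refine le_of_mul_le_mul_left ?_ a1
    linarith
  have k2' : θ * (Λ.m x - C₂ * E * W) ≤ Λ'.m x + C₁ * E * W := by
    refine le_of_mul_le_mul_left ?_ a1
    linarith
  have k3 : 0 ≤ C₂ * E * W := by positivity
  have k4 : θ * (C₂ * E * W) ≤ C₂ * E * W := by nlinarith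
  rw [abs_le]
  constructor <;> linarith

end levels

lemma sum_range_le_of_two_step {r : ℕ → ℝ} {κ : ℝ} (h0 : ∀ n, 0 ≤ r n) (h1 : ∀ n, r n ≤ 1)
    (hκ : κ < 1) (h2 : ∀ n, r (n + 2) ≤ κ * r n) (n : ℕ) :
    ∑ i ∈ Finset.range n, r i ≤ 2 / (1 - κ) := by
  have e1 : ∑ i ∈ Finset.range n, r i ≤ ∑ i ∈ Finset.range (n + 2), r i :=
    Finset.sum_le_sum_of_subset_of_nonneg (Finset.range_mono (by omega)) fun i _ _ => h0 i
  have e2 : ∑ i ∈ Finset.range (n + 2), r i = ∑ i ∈ Finset.range n, r (i + 2) + r 1 + r 0 := by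
    rw [Finset.sum_range_succ', Finset.sum_range_succ']
  have e3 : ∑ i ∈ Finset.range n, r (i + 2) ≤ κ * ∑ i ∈ Finset.range n, r i := by
    rw [Finset.mul_sum]
    exact Finset.sum_le_sum fun i _ => h2 i
  rw [le_div_iff₀ (by linarith)]
  linarith [h1 0, h1 1]

lemma le_exp_mul_of_one_sub_mul_le {u a t : ℝ} (ha : 0 ≤ a) (ht0 : 0 ≤ t)
    (ht : t ≤ 1 / 2) (h : u * (1 - t) ≤ a * (1 + t)) : u ≤ Real.exp (3 * t) * a := by
  have e1 : 1 + t ≤ Real.exp t := by linarith [Real.add_one_le_exp t]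
  have e2 : 1 ≤ (1 - t) * (1 + 2 * t) := by nlinarith
  have e3 : 1 + 2 * t ≤ Real.exp (2 * t) := by linarith [Real.add_one_le_exp (2 * t)]
  have e4 : Real.exp (3 * t) = Real.exp (2 * t) * Real.exp t := by
    rw [← Real.exp_add]; ring_nf
  have e5 : (1 + 2 * t) * (1 + t) ≤ Real.exp (3 * t) := by
    rw [e4]; gcongr
  refine le_of_mul_le_mul_right ?_ (show 0 < 1 - t by linarith)
  refine h.trans ?_
  calc a * (1 + t) ≤ a * ((1 - t) * (1 + 2 * t) * (1 + t)) := by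
        gcongr; nlinarith
    _ = ((1 + 2 * t) * (1 + t)) * a * (1 - t) := by ring
    _ ≤ _ := by
        have : 0 ≤ 1 - t := by linarith
        gcongr

section sequences

variable {X : Type*} {α r : ℕ → ℝ} {m : ℕ → X → ℝ} {γ κ : ℝ} {τ : ℕ}

/-- The one-step estimate when the error term is dominated by the main one. -/
lemma step_of_le {C θ : ℝ} {K n : ℕ} (hC : 1 ≤ C) (hr : 0 < r n) (hCr : C * r n ≤ 1 / 2)
    (hθ : 0 < θ) (hm : ∀ n x, 0 < m n x)
    (hstep : ∀ x, |m (n + 1) x - θ * m n x| ≤ C * (r n * m (n + 1) x + r n ^ K * m n x))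
    (hle : r n ^ K ≤ θ * r n) (x : X) :
    m (n + 1) x ≤ Real.exp (3 * (C * r n)) * (θ * m n x) ∧
      θ * m n x ≤ Real.exp (3 * (C * r n)) * m (n + 1) x := by
  have h := abs_le.1 (hstep x)
  have h1 := hm n x
  have h2 := hm (n + 1) x
  have h3 : C * (r n ^ K * m n x) ≤ C * (θ * r n * m n x) := by gcongr
  have h4 : 0 ≤ C * r n := by positivity
  constructor
  · refine le_exp_mul_of_one_sub_mul_le (by positivity) h4 hCr ?_
    linarith [h.2]
  · refine le_exp_mul_of_one_sub_mul_le h2.le h4 hCr ?_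
    linarith [h.1]

/-- If the consecutive ratios of `m n` are comparable to those of a sequence `α` decreasing at
most polynomially fast, then `m n` and `α n` are comparable. -/
lemma exists_comparable_of_ratio (hα : ∀ n, 0 < α n) (hα1 : ∀ n, α (n + 1) ≤ α n)
    (hγ : 0 < γ) (hγ1 : γ ≤ 1) (hτ : 1 ≤ τ) (hdio : ∀ n, γ * α n ^ τ ≤ α (n + 1))
    (hr : ∀ n, 0 < r n) (hr1 : ∀ n, r n ≤ 1) (hκ : κ < 1)
    (hr2 : ∀ n, r (n + 2) ≤ κ * r n)
    (hm : ∀ n x, 0 < m n x) (hmr : ∀ n x, m n x ≤ r n ^ 2)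
    (hsup : ∀ n b, (∀ x, m n x ≤ b) → r n ^ 2 ≤ b)
    (hstep : ∀ K, 1 ≤ K → ∃ C : ℝ, 1 ≤ C ∧ ∀ n x,
      |m (n + 1) x - α (n + 1) / α n * m n x| ≤ C * (r n * m (n + 1) x + r n ^ K * m n x)) :
    ∃ V : ℝ, 1 ≤ V ∧ ∃ n₀, ∀ n, n₀ ≤ n → r n ^ 2 ≤ V * α n ∧
      ∀ x, m n₀ x * α n ≤ V * m n x := by
  have hS := sum_range_le_of_two_step (fun n => (hr n).le) hr1 hκ hr2
  set S := 2 / (1 - κ) with hSdef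
  have hS0 : 0 ≤ S := by rw [hSdef]; exact div_nonneg (by norm_num) (by linarith)
  have hsum : Summable r := summable_of_sum_range_le (fun n => (hr n).le) hS
  have hlim : Tendsto r atTop (𝓝 0) := hsum.tendsto_atTop_zero
  have hθ : ∀ n, 0 < α (n + 1) / α n := fun n => div_pos (hα _) (hα _)
  have hθ1 : ∀ n, α (n + 1) / α n ≤ 1 := fun n => (div_le_one (hα _)).2 (hα1 _)
  have hθα : ∀ n, α (n + 1) / α n * α n = α (n + 1) := fun n => div_mul_cancel₀ _ (hα n).ne'
  have hsmall : ∀ b : ℝ, 0 < b → ∀ C : ℝ, 0 < C → ∃ n₀, ∀ n, n₀ ≤ n → C * r n ≤ b := by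
    intro b hb C hC
    obtain ⟨n₀, h⟩ := eventually_atTop.1 (hlim.eventually_le_const (show 0 < b / C by positivity))
    refine ⟨n₀, fun n hn => ?_⟩
    have := h n hn
    rw [le_div_iff₀ hC] at this
    linarith
  -- the first pass
  have first : ∃ k : ℕ, ∃ V : ℝ, 1 ≤ V ∧ ∃ n₁, ∀ n, n₁ ≤ n → (r n ^ 2) ^ k ≤ V * α n := by
    obtain ⟨C, hC, hst⟩ := hstep (2 * τ + 3) (by omega)
    have hC0 : 0 < C := by linarith
    set s : ℕ → ℝ := fun n => ∑ i ∈ Finset.range n, r i with hs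
    set w : ℕ → ℝ := fun n => r n ^ 2 * Real.exp (-(3 * C * s n)) with hw
    have hs0 : ∀ n, 0 ≤ s n := fun n => Finset.sum_nonneg fun i _ => (hr i).le
    have hwr : ∀ n, w n ≤ r n ^ 2 := fun n => by
      have : Real.exp (-(3 * C * s n)) ≤ 1 := by
        rw [Real.exp_le_one_iff]
        have := hs0 n
        have : 0 ≤ 3 * C * s n := by positivity
        linarith
      have h2 := hr n
      calc w n ≤ r n ^ 2 * 1 := mul_le_mul_of_nonneg_left this (by positivity)
        _ = _ := mul_one _
    set E := Real.exp (3 * C * S) with hE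
    have hE0 : 0 < E := Real.exp_pos _
    have hE1 : 1 ≤ E := Real.one_le_exp (by positivity)
    have hrw : ∀ n, r n ^ 2 ≤ E * w n := fun n => by
      have : 1 ≤ E * Real.exp (-(3 * C * s n)) := by
        rw [hE, ← Real.exp_add]
        refine Real.one_le_exp ?_
        have := hS n
        have : 3 * C * s n ≤ 3 * C * S := by gcongr
        linarith
      have h2 := hr n
      calc r n ^ 2 = r n ^ 2 * 1 := (mul_one _).symm
        _ ≤ r n ^ 2 * (E * Real.exp (-(3 * C * s n))) := by gcongr
        _ = _ := by rw [hw]; ring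
    have hw0 : ∀ n, 0 < w n := fun n => mul_pos (pow_pos (hr n) 2) (Real.exp_pos _)
    set C'' := 4 * C * E ^ (τ + 1) with hC''
    have hC''0 : 0 < C'' := by positivity
    obtain ⟨n₁, hn₁⟩ := hsmall (1 / 2) (by norm_num) C hC0
    obtain ⟨n₂, hn₂⟩ := hsmall γ hγ C'' hC''0
    obtain ⟨n₃, hn₃⟩ := hsmall (1 / 2) (by norm_num) 1 (by norm_num)
    set N := max n₁ (max n₂ n₃) with hN
    have hwN : w N < 1 := by
      have h1 := hn₃ N (by omega)
      have h2 := hr N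
      have h3 := hwr N
      nlinarith
    have hstepw : ∀ n, N ≤ n → w (n + 1) ≤ α (n + 1) / α n * w n ∨
        w (n + 1) ≤ C'' * w n * w n ^ τ := by
      intro n hn
      have hCr := hn₁ n (by omega)
      have hrn := hr n
      rcases le_total (r n ^ (2 * τ + 3)) (α (n + 1) / α n * r n) with hle | hle
      · left
        have h1 : r (n + 1) ^ 2 ≤ Real.exp (3 * (C * r n)) * (α (n + 1) / α n * r n ^ 2) := by
          refine hsup _ _ fun x => ?_
          refine (step_of_le hC hrn hCr (hθ n) hm (hst n) hle x).1.trans ?_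
          have := hθ n
          have := hmr n x
          gcongr
        have h2 : Real.exp (-(3 * C * s (n + 1))) * Real.exp (3 * (C * r n))
            = Real.exp (-(3 * C * s n)) := by
          rw [← Real.exp_add, hs]
          congr 1
          simp only [Finset.sum_range_succ]
          ring
        calc w (n + 1) ≤ Real.exp (3 * (C * r n)) * (α (n + 1) / α n * r n ^ 2)
              * Real.exp (-(3 * C * s (n + 1))) :=
              mul_le_mul_of_nonneg_right h1 (Real.exp_pos _).le
          _ = α (n + 1) / α n * (r n ^ 2 * (Real.exp (-(3 * C * s (n + 1)))
              * Real.exp (3 * (C * r n)))) := by ring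
          _ = _ := by rw [h2]
      · right
        have hθle : α (n + 1) / α n ≤ r n ^ (2 * τ + 2) := by
          refine le_of_mul_le_mul_right ?_ hrn
          rw [← pow_succ]; exact hle
        have h1 : r (n + 1) ^ 2 ≤ 4 * C * r n ^ (2 * τ + 2) := by
          refine hsup _ _ fun x => ?_
          have h := (abs_le.1 (hst n x)).2
          have hx := hm n x
          have hx1 : m n x ≤ 1 := (hmr n x).trans (pow_le_one₀ hrn.le (hr1 n))
          have hx' := hm (n + 1) x
          have a1 : α (n + 1) / α n * m n x ≤ r n ^ (2 * τ + 2) * 1 := by gcongr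
          have a2 : r n ^ (2 * τ + 3) * m n x ≤ r n ^ (2 * τ + 2) * 1 := by
            have : r n ^ (2 * τ + 3) ≤ r n ^ (2 * τ + 2) :=
              pow_le_pow_of_le_one hrn.le (hr1 n) (by omega)
            gcongr
          have a3 : C * r n * m (n + 1) x ≤ 1 / 2 * m (n + 1) x := by gcongr
          have a4 : C * (r n ^ (2 * τ + 3) * m n x) ≤ C * (r n ^ (2 * τ + 2) * 1) := by gcongr
          have a5 : r n ^ (2 * τ + 2) ≤ C * r n ^ (2 * τ + 2) :=
            le_mul_of_one_le_left (by positivity) hC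
          linarith
        calc w (n + 1) ≤ 4 * C * r n ^ (2 * τ + 2) := (hwr _).trans h1
          _ = 4 * C * (r n ^ 2) ^ (τ + 1) := by rw [← pow_mul]; ring_nf
          _ ≤ 4 * C * (E * w n) ^ (τ + 1) := by
              have := hrw n
              gcongr
          _ = _ := by rw [hC'']; ring
    obtain ⟨k, hk⟩ : ∃ k : ℕ, w N ^ k < α N := exists_pow_lt_of_lt_one (hα N) hwN
    have key : ∀ n, N ≤ n → w n ^ (k + 1) ≤ α n := by
      intro n hn
      induction n, hn using Nat.le_induction with
      | base =>
        refine le_trans ?_ hk.le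
        exact pow_le_pow_of_le_one (hw0 N).le hwN.le (by omega)
      | succ n hn ih =>
        have hwn := hw0 n
        rcases hstepw n hn with h | h
        · calc w (n + 1) ^ (k + 1) ≤ (α (n + 1) / α n * w n) ^ (k + 1) := by
                have := hw0 (n + 1)
                gcongr
            _ = (α (n + 1) / α n) ^ (k + 1) * w n ^ (k + 1) := mul_pow _ _ _
            _ ≤ (α (n + 1) / α n) * α n := by
                have := hα n
                have := hθ n
                gcongr
                exact pow_le_of_le_one (hθ n).le (hθ1 n) (by omega)
            _ = _ := hθα n
        · have h1 : C'' * w n ≤ γ := by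
            have a := hn₂ n (by omega)
            have b : w n ≤ r n := (hwr n).trans (by nlinarith [hr n, hr1 n])
            have : C'' * w n ≤ C'' * r n := by gcongr
            linarith
          calc w (n + 1) ^ (k + 1) ≤ (C'' * w n * w n ^ τ) ^ (k + 1) := by
                have := hw0 (n + 1)
                gcongr
            _ = (C'' * w n) ^ (k + 1) * (w n ^ (k + 1)) ^ τ := by ring
            _ ≤ γ * α n ^ τ := by
                gcongr
                exact (pow_le_of_le_one (by positivity) (h1.trans hγ1) (by omega)).trans h1
            _ ≤ _ := hdio n
    refine ⟨k + 1, E ^ (k + 1), one_le_pow₀ hE1, N, fun n hn => ?_⟩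
    calc (r n ^ 2) ^ (k + 1) ≤ (E * w n) ^ (k + 1) := by
          have := hrw n
          gcongr
      _ = E ^ (k + 1) * w n ^ (k + 1) := mul_pow _ _ _
      _ ≤ _ := by
          have := key n hn
          gcongr
  -- the second pass
  obtain ⟨k, V, hV, n₁, hk⟩ := first
  have hV0 : 0 < V := by linarith
  obtain ⟨C, hC, hst⟩ := hstep (2 * (k * (τ - 1)) + 2) (by omega)
  have hC0 : 0 < C := by linarith
  obtain ⟨n₂, hn₂⟩ := hsmall (1 / 2) (by norm_num) C hC0
  obtain ⟨n₃, hn₃⟩ := hsmall γ hγ (V ^ (τ - 1)) (by positivity)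
  set N := max n₁ (max n₂ n₃) with hN
  have hle : ∀ n, N ≤ n → r n ^ (2 * (k * (τ - 1)) + 2) ≤ α (n + 1) / α n * r n := by
    intro n hn
    have hrn := hr n
    have hαn := hα n
    have a1 := hk n (by omega)
    have a2 := hn₃ n (by omega)
    have a3 : γ * α n ^ (τ - 1) ≤ α (n + 1) / α n := by
      rw [le_div_iff₀ hαn, mul_assoc, ← pow_succ, Nat.sub_add_cancel hτ]
      exact hdio n
    calc r n ^ (2 * (k * (τ - 1)) + 2) = ((r n ^ 2) ^ k) ^ (τ - 1) * r n * r n := by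
          rw [← pow_mul, ← pow_mul]; ring_nf
      _ ≤ (V * α n) ^ (τ - 1) * r n * r n := by gcongr
      _ = (V ^ (τ - 1) * r n) * α n ^ (τ - 1) * r n := by rw [mul_pow]; ring
      _ ≤ γ * α n ^ (τ - 1) * r n := by gcongr
      _ ≤ _ := by gcongr
  set s : ℕ → ℝ := fun n => ∑ i ∈ Finset.range n, r i with hs
  have hs0 : ∀ n, 0 ≤ s n := fun n => Finset.sum_nonneg fun i _ => (hr i).le
  set E := Real.exp (3 * C * S) with hE
  have hE0 : 0 < E := Real.exp_pos _
  have hE1 : 1 ≤ E := Real.one_le_exp (by positivity)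
  have hes : ∀ n, Real.exp (3 * C * s n) ≤ E := fun n => by
    rw [hE]; gcongr; exact hS n
  have hes1 : ∀ n, 1 ≤ Real.exp (3 * C * s n) := fun n => Real.one_le_exp (by
    have := hs0 n; positivity)
  have hsucc : ∀ n, Real.exp (3 * C * s (n + 1))
      = Real.exp (3 * (C * r n)) * Real.exp (3 * C * s n) := fun n => by
    rw [← Real.exp_add, hs]
    congr 1
    simp only [Finset.sum_range_succ]
    ring
  have key : ∀ n, N ≤ n → (∀ x, m n x * α N ≤ Real.exp (3 * C * s n) * α n) ∧
      ∀ x, m N x * α n ≤ Real.exp (3 * C * s n) * (m n x * α N) := by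
    intro n hn
    induction n, hn using Nat.le_induction with
    | base =>
      have := hα N
      refine ⟨fun x => ?_, fun x => ?_⟩
      · have h1 : m N x ≤ 1 := (hmr N x).trans (pow_le_one₀ (hr N).le (hr1 N))
        gcongr
        exact h1.trans (hes1 N)
      · have := hm N x
        exact le_mul_of_one_le_left (by positivity) (hes1 N)
    | succ n hn ih =>
      have st := step_of_le hC (hr n) (hn₂ n (by omega)) (hθ n) hm (hst n) (hle n hn)
      have hαN := hα N
      have hαn := hα n
      have hθn := hθ n
      rw [hsucc, ← hθα n]
      refine ⟨fun x => ?_, fun x => ?_⟩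
      · calc m (n + 1) x * α N
            ≤ Real.exp (3 * (C * r n)) * (α (n + 1) / α n * m n x) * α N := by
              have := (st x).1
              gcongr
          _ = Real.exp (3 * (C * r n)) * (α (n + 1) / α n) * (m n x * α N) := by ring
          _ ≤ Real.exp (3 * (C * r n)) * (α (n + 1) / α n) * (Real.exp (3 * C * s n) * α n) := by
              have := ih.1 x
              gcongr
          _ = _ := by ring
      · calc m N x * (α (n + 1) / α n * α n) = (α (n + 1) / α n) * (m N x * α n) := by ring
          _ ≤ (α (n + 1) / α n) * (Real.exp (3 * C * s n) * (m n x * α N)) := by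
              have := ih.2 x
              gcongr
          _ = (α (n + 1) / α n * m n x) * (Real.exp (3 * C * s n) * α N) := by ring
          _ ≤ (Real.exp (3 * (C * r n)) * m (n + 1) x) * (Real.exp (3 * C * s n) * α N) := by
              have := (st x).2
              gcongr
          _ = _ := by ring
  have hαN := hα N
  refine ⟨max 1 (max (E / α N) (E * α N)), le_max_left _ _, N, fun n hn => ⟨?_, fun x => ?_⟩⟩
  · refine hsup _ _ fun x => ?_
    have h1 := (key n hn).1 x
    have hαn := hα n
    calc m n x ≤ E / α N * α n := by
          rw [div_mul_eq_mul_div, le_div_iff₀ hαN]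
          refine h1.trans ?_
          have := hes n
          gcongr
      _ ≤ _ := by
          gcongr
          exact (le_max_left _ _).trans (le_max_right _ _)
  · have h1 := (key n hn).2 x
    have hmx := hm n x
    calc m N x * α n ≤ E * α N * m n x := by
          refine h1.trans ?_
          have := hes n
          calc _ ≤ E * (m n x * α N) := by gcongr
            _ = _ := by ring
      _ ≤ _ := by
          gcongr
          exact (le_max_right _ _).trans (le_max_right _ _)

end sequences

section levels

variable {f : SmoothCircleDiffeoLift} {α : ℝ} (hρ : IsRotNumber f.toFun α) (c : Convergents α)
  (hc : c.q 0 = 1)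

lemma m_succ_F_le (n : ℕ) (x : ℝ) :
    (level hρ c hc (n + 1)).m ((level hρ c hc n).F x) ≤ (level hρ c hc n).m x := by
  have h1 := (level_next hρ c hc n).ret_ret x
  rw [Level.F_comm] at h1
  rw [Level.m_eq, Level.m_eq, (level_next hρ c hc n).s_eq]
  linarith

lemma exists_m_add_le (n j : ℕ) (x : ℝ) :
    ∃ y, (level hρ c hc (n + j)).m y ≤ (level hρ c hc n).m x := by
  induction j with
  | zero => exact ⟨x, le_rfl⟩
  | succ j ih =>
    obtain ⟨y, hy⟩ := ih
    exact ⟨_, (m_succ_F_le hρ c hc (n + j) y).trans hy⟩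

lemma exists_pow_err_le (hα : IsDiophantine α) : ∃ γ : ℝ, 0 < γ ∧ γ ≤ 1 ∧ ∃ τ : ℕ, 1 ≤ τ ∧
    ∀ n, γ * c.err n ^ τ ≤ c.err (n + 1) := by
  obtain ⟨γ, hγ, τ, hτ, h⟩ := exists_pow_le_of_isDiophantine hα
  refine ⟨min γ 1, lt_min hγ one_pos, min_le_right _ _, τ, hτ, fun n => ?_⟩
  have hq : (0 : ℝ) < c.q (n + 1) := by exact_mod_cast c.q_pos _
  have he := c.err_pos n
  have h1 := c.q_mul_err_le n
  refine le_trans ?_ (h (c.q (n + 1)) (c.p (n + 1)) (c.q_pos _))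
  rw [le_div_iff₀ (by positivity)]
  calc min γ 1 * c.err n ^ τ * (c.q (n + 1) : ℝ) ^ τ
      = min γ 1 * (c.q (n + 1) * c.err n) ^ τ := by rw [mul_pow]; ring
    _ ≤ γ * 1 ^ τ := by
        gcongr
        exact min_le_left _ _
    _ = γ := by rw [one_pow, mul_one]

/-- The displacements of `f ^ q n` are uniformly comparable to those of the rotation. -/
lemma exists_m_comparable (hα : IsDiophantine α) : ∃ V : ℝ, 1 ≤ V ∧ ∀ n x,
    (level hρ c hc n).m x ≤ V * c.err n ∧ c.err n ≤ V * (level hρ c hc n).m x := by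
  obtain ⟨γ, hγ, hγ1, τ, hτ, hdio⟩ := exists_pow_err_le c hα
  set δ := Real.exp (-denjoyBound f) with hδ
  have hδ0 : 0 < δ := Real.exp_pos _
  obtain ⟨V, hV, n₀, h⟩ := exists_comparable_of_ratio (X := ℝ) (α := c.err)
    (r := fun n => (level hρ c hc n).r) (m := fun n => (level hρ c hc n).m)
    (κ := √(1 / (1 + δ))) c.err_pos (fun n => (c.err_succ_lt n).le) hγ hγ1 hτ hdio
    (fun n => (level hρ c hc n).r_pos) (fun n => (level hρ c hc n).r_le_one)
    (by
      rw [Real.sqrt_lt' one_pos, one_pow, div_lt_one (by positivity)]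
      linarith)
    (fun n => by
      have h1 := maxGap_two_le c n hρ hc
      change √(maxGap f c (n + 2)) ≤ √(1 / (1 + δ)) * √(maxGap f c n)
      rw [← Real.sqrt_mul (by positivity)]
      refine Real.sqrt_le_sqrt ?_
      rw [one_div_mul_eq_div, le_div_iff₀ (by positivity)]
      exact h1)
    (fun n => (level hρ c hc n).m_pos)
    (fun n x => by rw [Level.r_sq]; exact Level.m_le _ x)
    (fun n b hb => by rw [Level.r_sq]; exact ciSup_le hb)
    (fun K hK => by
      obtain ⟨C, hC, h⟩ := exists_ratio_le f K hK
      exact ⟨C, hC, fun n x => h α hρ c hc n x⟩)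
  obtain ⟨x₀, hx₀⟩ := exists_isMin_of_periodic (level hρ c hc n₀).smooth_m.continuous
    (level hρ c hc n₀).m_periodic
  have hc0 := (level hρ c hc n₀).m_pos x₀
  set c₀ := (level hρ c hc n₀).m x₀ with hc₀
  have he0 := c.err_pos n₀
  refine ⟨max (max V (V / c₀)) (max (1 / c.err n₀) (1 / c₀)),
    hV.trans ((le_max_left _ _).trans (le_max_left _ _)), fun n x => ?_⟩
  have he := c.err_pos n
  have hmx := (level hρ c hc n).m_pos x
  rcases le_total n₀ n with hn | hn
  · obtain ⟨h1, h2⟩ := h n hn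
    constructor
    · refine le_trans (?_ : _ ≤ V * c.err n) ?_
      · rw [Level.r_sq] at h1
        exact (Level.m_le _ x).trans h1
      · gcongr
        exact (le_max_left _ _).trans (le_max_left _ _)
    · refine le_trans (?_ : _ ≤ V / c₀ * (level hρ c hc n).m x) ?_
      · rw [div_mul_eq_mul_div, le_div_iff₀ hc0, mul_comm]
        refine le_trans ?_ (h2 x)
        have := hx₀ x
        gcongr
      · gcongr
        exact (le_max_right _ _).trans (le_max_left _ _)
  · constructor
    · refine le_trans (?_ : _ ≤ 1 / c.err n₀ * c.err n) ?_
      · rw [one_div_mul_eq_div, le_div_iff₀ he0]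
        have h1 : (level hρ c hc n).m x ≤ 1 := (Level.m_le _ x).trans (Level.M_le _)
        have h2 : c.err n₀ ≤ c.err n := c.err_antitone hn
        calc _ ≤ 1 * c.err n₀ := by gcongr
          _ ≤ _ := by linarith
      · gcongr
        exact (le_max_left _ _).trans (le_max_right _ _)
    · refine le_trans (?_ : _ ≤ 1 / c₀ * (level hρ c hc n).m x) ?_
      · rw [one_div_mul_eq_div, le_div_iff₀ hc0]
        obtain ⟨y, hy⟩ := exists_m_add_le hρ c hc n (n₀ - n) x
        rw [Nat.add_sub_cancel' hn] at hy
        have h1 := err_lt_one c n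
        have h2 : c₀ ≤ (level hρ c hc n).m x := (hx₀ y).trans hy
        calc _ ≤ 1 * c₀ := by gcongr
          _ ≤ _ := by linarith
      · gcongr
        exact (le_max_right _ _).trans (le_max_right _ _)

/-- Under the arithmetic condition the iterates of `f` are uniformly bi-Lipschitz. -/
lemma exists_abs_phi_le (hρ : IsRotNumber f.toFun α) (c : Convergents α) (hc : c.q 0 = 1)
    (hα : IsDiophantine α) : ∃ C : ℝ, 1 ≤ C ∧
    ∀ N x, |phi f N x| ≤ C := by
  obtain ⟨V, hV, h⟩ := exists_m_comparable hρ c hc hα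
  obtain ⟨L, hL⟩ := exists_lip f
  have hV0 : 0 < V := by linarith
  have hlog := Real.log_nonneg hV
  refine ⟨max 1 (2 * Real.log V + 2 * L), le_max_left _ _, fun N x => le_trans ?_
    (le_max_right _ _)⟩
  set Λ := level hρ c hc N with hΛ
  have hN : N ≤ Λ.N := by
    have : N + 1 ≤ c.q (N + 1) := c.q_strictMono.id_le _
    change N ≤ 2 * c.q (N + 1)
    omega
  obtain ⟨ξ, hξ, he⟩ := Λ.exists_m_iterate_eq N x
  have hd := Λ.distort hL.2 (Set.left_mem_uIcc (a := x) (b := Λ.F x)) hξ hN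
  have h1 := h N x
  have h2 := h N (f.toFun^[N] x)
  rw [← hΛ] at h1 h2
  have hm := Λ.m_pos x
  have hm' := Λ.m_pos (f.toFun^[N] x)
  have e0 := c.err_pos N
  have hV2 : Real.exp (2 * Real.log V) = V * V := by
    rw [two_mul, Real.exp_add, Real.exp_log hV0]
  have hphi : |phi f N ξ| ≤ 2 * Real.log V := by
    have k1 : Real.exp (phi f N ξ) ≤ V * V := by
      refine le_of_mul_le_mul_right ?_ hm
      rw [← he]
      calc _ ≤ V * c.err N := h2.1
        _ ≤ V * (V * Λ.m x) := by gcongr; exact h1.2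
        _ = _ := by ring
    have k2 : Real.exp (- phi f N ξ) ≤ V * V := by
      rw [Real.exp_neg, inv_le_iff_one_le_mul₀ (Real.exp_pos _)]
      refine le_of_mul_le_mul_right ?_ hm
      rw [mul_assoc, ← he]
      calc 1 * Λ.m x ≤ V * c.err N := by rw [one_mul]; exact h1.1
        _ ≤ V * (V * Λ.m (f.toFun^[N] x)) := by gcongr; exact h2.2
        _ = _ := by ring
    rw [← hV2, Real.exp_le_exp] at k1 k2
    rw [abs_le]; constructor <;> linarith
  have := abs_le.1 hd
  have := abs_le.1 hphi
  rw [abs_le]; constructor <;> linarith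

end levels

lemma exists_landau_bound (K : ℕ) : ∃ C : ℝ, 1 ≤ C ∧ ∀ g : ℝ → ℝ, ContDiff ℝ ∞ g →
    ∀ A B d : ℝ, 0 < d → (∀ y, |g y| ≤ A) → (∀ y, |iteratedDeriv K g y| ≤ B) →
    ∀ j ≤ K, ∀ y, |iteratedDeriv j g y| ≤ C * (A * (d ^ j)⁻¹ + B * d ^ (K - j)) := by
  obtain ⟨C, hC, h⟩ := exists_interpolation_bound K (Λ := 2 ^ K) (by positivity)
  refine ⟨C, hC, fun g hg A B d hd hA hB j hj y => ?_⟩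
  have h2 : (1 : ℝ) ≤ 2 ^ K := one_le_pow₀ (by norm_num)
  refine h g hg (fun i => y + i * d) y (y + 2 ^ K * d) d A B hd (by linarith)
    (fun i _ => by push_cast; linarith) (fun i hi => ⟨?_, ?_⟩) (fun i _ => hA _)
    (fun z _ => hB z) j hj y ⟨le_rfl, ?_⟩
  · have : 0 ≤ (i : ℝ) * d := by positivity
    linarith
  · have : (i : ℝ) ≤ 2 ^ K := by exact_mod_cast hi.le
    gcongr
  · have : 0 ≤ (2 : ℝ) ^ K * d := by positivity
    linarith

/-! ### Two recursive estimates -/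

lemma exists_le_rpow_of_halving (C : ℝ) {ε : ℝ} (hε : 0 < ε) :
    ∃ C' : ℝ, 1 ≤ C' ∧ ∀ (T : ℕ → ℝ) (Q : ℕ), (∀ N < Q, T N ≤ C) →
      (∀ N, Q ≤ N → ∃ N', 2 * N' < N ∧ T N ≤ T N' + C * ((N : ℝ) + 1) ^ ε) →
      ∀ N, T N ≤ C' * ((N : ℝ) + 1) ^ ε := by
  set κ := (2 : ℝ)⁻¹ ^ ε with hκ
  have hκ1 : κ < 1 := Real.rpow_lt_one (by norm_num) (by norm_num) hε
  have hκ0 : 0 < κ := by positivity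
  refine ⟨max 1 (C / (1 - κ)), le_max_left _ _, fun T Q h1 h2 N => ?_⟩
  set D := max 1 (C / (1 - κ)) with hD
  have hDC : C ≤ D * (1 - κ) := by
    rw [← div_le_iff₀ (by linarith)]
    exact le_max_right _ _
  have hD0 : 0 < D := lt_of_lt_of_le one_pos (le_max_left _ _)
  induction N using Nat.strong_induction_on with
  | _ N ih =>
    rcases lt_or_ge N Q with hN | hN
    · refine (h1 N hN).trans ?_
      have : 1 ≤ ((N : ℝ) + 1) ^ ε := Real.one_le_rpow (by linarith [N.cast_nonneg (α := ℝ)]) hε.le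
      calc C ≤ D * (1 - κ) := hDC
        _ ≤ D * 1 := by gcongr; linarith
        _ ≤ _ := by gcongr
    · obtain ⟨N', hN', hT⟩ := h2 N hN
      have hih := ih N' (by omega)
      have hle : ((N' : ℝ) + 1) ^ ε ≤ κ * ((N : ℝ) + 1) ^ ε := by
        rw [hκ, ← Real.mul_rpow (by norm_num) (by positivity)]
        refine Real.rpow_le_rpow (by positivity) ?_ hε.le
        have : (2 : ℝ) * N' + 1 ≤ N := by exact_mod_cast hN'
        linarith
      have hp : 0 < ((N : ℝ) + 1) ^ ε := by positivity
      calc T N ≤ D * (κ * ((N : ℝ) + 1) ^ ε) + D * (1 - κ) * ((N : ℝ) + 1) ^ ε := by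
            refine hT.trans (add_le_add (hih.trans ?_) ?_) <;> gcongr
        _ = _ := by ring

lemma exists_le_of_halving (C : ℝ) {ε : ℝ} (hε : 0 < ε) :
    ∃ C' : ℝ, 1 ≤ C' ∧ ∀ (T : ℕ → ℝ) (Q : ℕ), (∀ N < Q, T N ≤ C) →
      (∀ N, Q ≤ N → ∃ N', 2 * N' < N ∧ T N ≤ T N' + C * ((N : ℝ) + 1) ^ (-ε)) →
      ∀ N, T N ≤ C' := by
  set κ := (2 : ℝ) ^ ε with hκ
  have hκ1 : 1 < κ := Real.one_lt_rpow (by norm_num) hε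
  set D := max 1 (max C (C / (κ - 1))) with hD
  have hDC : C ≤ D * (κ - 1) := by
    rw [← div_le_iff₀ (by linarith)]
    exact (le_max_right _ _).trans (le_max_right _ _)
  have hDC' : C ≤ D := (le_max_left _ _).trans (le_max_right _ _)
  have hD1 : 1 ≤ D := le_max_left _ _
  have hD0 : 0 < D := by linarith
  refine ⟨2 * D, by linarith, fun T Q h1 h2 N => ?_⟩
  suffices h : T N ≤ D * (2 - ((N : ℝ) + 1) ^ (-ε)) by
    refine h.trans ?_
    have : 0 < ((N : ℝ) + 1) ^ (-ε) := by positivity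
    nlinarith
  induction N using Nat.strong_induction_on with
  | _ N ih =>
    rcases lt_or_ge N Q with hN | hN
    · refine (h1 N hN).trans (hDC'.trans (le_mul_of_one_le_right hD0.le ?_))
      have : ((N : ℝ) + 1) ^ (-ε) ≤ 1 :=
        Real.rpow_le_one_of_one_le_of_nonpos (by linarith [N.cast_nonneg (α := ℝ)]) (by linarith)
      linarith
    · obtain ⟨N', hN', hT⟩ := h2 N hN
      have hih := ih N' (by omega)
      have hle : κ * ((N : ℝ) + 1) ^ (-ε) ≤ ((N' : ℝ) + 1) ^ (-ε) := by
        have e : κ * ((N : ℝ) + 1) ^ (-ε) = (((N : ℝ) + 1) / 2) ^ (-ε) := by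
          rw [Real.div_rpow (by positivity) (by norm_num), Real.rpow_neg (x := 2) (by norm_num) ε,
            ← hκ, div_inv_eq_mul, mul_comm]
        rw [e]
        refine Real.rpow_le_rpow_of_nonpos (by positivity) ?_ (by linarith)
        have : (2 : ℝ) * N' + 1 ≤ N := by exact_mod_cast hN'
        linarith
      have hp : 0 < ((N : ℝ) + 1) ^ (-ε) := by positivity
      have k1 : C * ((N : ℝ) + 1) ^ (-ε) ≤ D * (κ - 1) * ((N : ℝ) + 1) ^ (-ε) := by gcongr
      have k2 := mul_le_mul_of_nonneg_left hle hD0.le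
      linarith

/-! ### Estimates on derivatives of Birkhoff sums -/

section derivatives

variable (f : SmoothCircleDiffeoLift)

lemma iteratedDeriv_deriv_iterate (l b : ℕ) :
    iteratedDeriv b (deriv f.toFun^[l]) = iteratedDeriv b fun y => Real.exp (phi f l y) := by
  congr 1
  exact funext fun y => (hasDerivAt_iterate f l y).deriv

lemma phi_mul_add (q b N' : ℕ) (x : ℝ) :
    phi f (b * q + N') x = phi f N' x + ∑ i ∈ Finset.range b, phi f q (f.toFun^[i * q + N'] x) := by
  induction b with
  | zero => simp
  | succ b ih =>
    rw [Finset.sum_range_succ, show (b + 1) * q + N' = q + (b * q + N') by ring, phi_add, ih]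
    ring

/-- Derivatives of `φ_N`, `N = b q + N'`, in terms of those of `φ_q` and `φ_{N'}`. -/
lemma exists_iteratedDeriv_phi_mul_add_le {C₀ : ℝ} (hC₀ : ∀ l x, |phi f l x| ≤ C₀) (k : ℕ)
    (C : ℝ) : ∃ C' : ℝ, 1 ≤ C' ∧ ∀ (q b N' : ℕ) (A lam : ℝ), 1 ≤ lam →
      (∀ j ≤ k, ∀ x, |iteratedDeriv j (phi f q) x| ≤ A) →
      (∀ l ≤ b * q + N', ∀ x, ∀ a, 1 ≤ a → a + 1 ≤ k →
        |iteratedDeriv a (phi f l) x| ≤ C * lam ^ a) →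
      ∀ j ≤ k, ∀ x, |iteratedDeriv j (phi f (b * q + N')) x|
        ≤ |iteratedDeriv j (phi f N') x| + C' * b * A * lam ^ k := by
  obtain ⟨C₁, hC₁, h₁⟩ := exists_bound_of_deriv_eq_mul (k - 1) C
  set E := Real.exp C₀ with hE
  have hE0 : 0 < E := Real.exp_pos _
  obtain ⟨C₂, hC₂, h₂⟩ := exists_bound_comp k (C₁ * E)
  refine ⟨C₂, hC₂, fun q b N' A lam hlam hA hl j hj x => ?_⟩
  have hA0 : 0 ≤ A := (abs_nonneg _).trans (hA 0 (Nat.zero_le _) 0)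
  have hsum : phi f (b * q + N') = fun x => phi f N' x
      + ∑ i ∈ Finset.range b, phi f q (f.toFun^[i * q + N'] x) :=
    funext (phi_mul_add f q b N')
  have hsm : ∀ i, ContDiff ℝ ∞ fun x => phi f q (f.toFun^[i * q + N'] x) := fun i =>
    (smooth_phi f q).comp (smooth_iterate f _)
  rw [hsum, iteratedDeriv_fun_add (contDiffAt_nat (smooth_phi f N') _ _)
    (contDiffAt_nat (ContDiff.sum fun i _ => hsm i) _ _),
    iteratedDeriv_fun_sum (f := fun i y => phi f q (f.toFun^[i * q + N'] y))
      (fun i _ => contDiffAt_nat (hsm i) _ _)]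
  refine (abs_add_le _ _).trans (add_le_add le_rfl ?_)
  refine (Finset.abs_sum_le_sum_abs _ _).trans ?_
  have key : ∀ i ∈ Finset.range b,
      |iteratedDeriv j (fun y => phi f q (f.toFun^[i * q + N'] y)) x| ≤ C₂ * A * lam ^ k := by
    intro i hi
    have hi' : i * q + N' ≤ b * q + N' := by
      have := Nat.mul_le_mul_right q (Finset.mem_range.1 hi).le
      omega
    have h3 := h₂ (phi f q) (f.toFun^[i * q + N']) (smooth_phi f q) (smooth_iterate f _) x A lam
      (by linarith) (fun j hj => hA j hj _) (fun b' hb' => by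
        rw [iteratedDeriv_deriv_iterate]
        have h4 := h₁ (phi f (i * q + N')) (fun y => Real.exp (phi f (i * q + N') y))
          (smooth_phi f _) (smooth_exp_phi f _)
          (deriv_exp_phi f _)
          x lam (by linarith) (fun a ha hak => hl _ hi' x a ha (by omega)) b' (by omega)
        refine h4.trans ?_
        have h5 : |Real.exp (phi f (i * q + N') x)| ≤ E := by
          rw [abs_of_pos (Real.exp_pos _)]
          exact Real.exp_le_exp.2 ((le_abs_self _).trans (hC₀ _ _))
        calc _ ≤ C₁ * E * lam ^ b' := by gcongr
          _ ≤ _ := by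
            gcongr
            omega) j hj
    refine h3.trans ?_
    gcongr
  refine (Finset.sum_le_sum key).trans (le_of_eq ?_)
  rw [Finset.sum_const, Finset.card_range, nsmul_eq_mul]
  ring

end derivatives

section derivatives

variable {f : SmoothCircleDiffeoLift} {α : ℝ}

lemma exists_r_le (hρ : IsRotNumber f.toFun α) (c : Convergents α) (hc : c.q 0 = 1)
    (hα : IsDiophantine α) : ∃ V : ℝ, 1 ≤ V ∧ ∀ n,
      (level hρ c hc n).r ≤ V * √(c.err n) ∧
      ∀ x, (level hρ c hc n).m x ≤ V * c.err n ∧ c.err n ≤ V * (level hρ c hc n).m x := by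
  obtain ⟨V, hV, h⟩ := exists_m_comparable hρ c hc hα
  refine ⟨V, hV, fun n => ⟨?_, h n⟩⟩
  have h1 : (level hρ c hc n).M ≤ V * c.err n := ciSup_le fun x => (h n x).1
  have he := c.err_pos n
  calc (level hρ c hc n).r ≤ √(V ^ 2 * c.err n) := by
        refine Real.sqrt_le_sqrt (h1.trans ?_)
        gcongr
        exact le_self_pow₀ hV (by norm_num)
    _ = _ := by rw [Real.sqrt_mul (by positivity), Real.sqrt_sq (by linarith)]

lemma exists_iteratedDeriv_phi_q_le (hρ : IsRotNumber f.toFun α) (c : Convergents α)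
    (hc : c.q 0 = 1) (hα : IsDiophantine α) (k : ℕ) : ∃ C : ℝ, 1 ≤ C ∧
      ∀ n a, a ≤ k → ∀ x,
        |iteratedDeriv a (phi f (c.q (n + 1))) x| ≤ C * ((√(c.err n))⁻¹) ^ a := by
  obtain ⟨V, hV, h⟩ := exists_r_le hρ c hc hα
  obtain ⟨C₀, hC₀, h₀⟩ := exists_abs_phi_le hρ c hc hα
  obtain ⟨C, hC, h₁⟩ := Level.exists_iteratedDeriv_phi_le f (denjoyBound f) k
  have hVV : 1 ≤ V * V := one_le_mul_of_one_le_of_one_le hV hV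
  refine ⟨C₀ + C * (V * V) ^ k, ?_, fun n a ha x => ?_⟩
  · have : 0 ≤ C * (V * V) ^ k := by positivity
    linarith
  have he := c.err_pos n
  have hs : 0 < √(c.err n) := Real.sqrt_pos.2 he
  have hss : √(c.err n) * √(c.err n) = c.err n := Real.mul_self_sqrt he.le
  rcases Nat.eq_zero_or_pos a with rfl | ha0
  · rw [pow_zero, mul_one, iteratedDeriv_zero]
    have : 0 ≤ C * (V * V) ^ k := by positivity
    linarith [h₀ (c.q (n + 1)) x]
  · have h2 := h₁ (level hρ c hc n) (c.q (n + 1))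
      (by change _ ≤ 2 * c.q (n + 1); omega) x a ha0 ha
    obtain ⟨hr, hm⟩ := h n
    have hm0 := (level hρ c hc n).m_pos x
    have h3 : (level hρ c hc n).r / (level hρ c hc n).m x ≤ V * V * (√(c.err n))⁻¹ := by
      rw [div_le_iff₀ hm0]
      refine hr.trans ?_
      calc V * √(c.err n) = V * (√(c.err n))⁻¹ * c.err n := by
            nth_rewrite 3 [← hss]; field_simp
        _ ≤ V * (√(c.err n))⁻¹ * (V * (level hρ c hc n).m x) := by
            have := (hm x).2
            gcongr
        _ = _ := by ring
    have hr0 := (level hρ c hc n).r_pos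
    calc _ ≤ C * ((level hρ c hc n).r / (level hρ c hc n).m x) ^ a := h2
      _ ≤ C * (V * V * (√(c.err n))⁻¹) ^ a := by gcongr
      _ = C * (V * V) ^ a * ((√(c.err n))⁻¹) ^ a := by rw [mul_pow]; ring
      _ ≤ (C₀ + C * (V * V) ^ k) * ((√(c.err n))⁻¹) ^ a := by
          gcongr
          have : C * (V * V) ^ a ≤ C * (V * V) ^ k := by gcongr
          linarith

lemma exists_abs_phi_q_le (hρ : IsRotNumber f.toFun α) (c : Convergents α)
    (hc : c.q 0 = 1) (hα : IsDiophantine α) : ∃ C : ℝ, 1 ≤ C ∧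
      ∀ n x, |phi f (c.q (n + 1)) x| ≤ C * (c.err (n + 1) / √(c.err n)) := by
  obtain ⟨V, hV, h⟩ := exists_r_le hρ c hc hα
  obtain ⟨γ, hγ, hγ1, τ, hτ, hdio⟩ := exists_pow_err_le c hα
  obtain ⟨C, hC, h₁⟩ := Level.exists_phi_next_le f (denjoyBound f) (2 * τ) (by omega)
  have hV0 : 0 < V := by linarith
  refine ⟨C * V ^ 3 + C * V ^ (2 * τ) / γ + 1, ?_, fun n x => ?_⟩
  · have : 0 ≤ C * V ^ 3 := by positivity
    have : 0 ≤ C * V ^ (2 * τ) / γ := by positivity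
    linarith
  have he := c.err_pos n
  have he' := c.err_pos (n + 1)
  have hs : 0 < √(c.err n) := Real.sqrt_pos.2 he
  have hs1 : √(c.err n) ≤ 1 := Real.sqrt_le_one.2 (err_lt_one c n).le
  have hss : √(c.err n) * √(c.err n) = c.err n := Real.mul_self_sqrt he.le
  have h2 := h₁ _ _ (level_next hρ c hc n) x x Set.left_mem_uIcc
  obtain ⟨hr, hm⟩ := h n
  have hr0 := (level hρ c hc n).r_pos
  have hm0 := (level hρ c hc n).m_pos x
  have hm0' := (level hρ c hc (n + 1)).m_pos x
  have k1 : (level hρ c hc (n + 1)).m x / (level hρ c hc n).m x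
      ≤ V ^ 2 * (c.err (n + 1) / c.err n) := by
    rw [div_le_iff₀ hm0]
    calc _ ≤ V * c.err (n + 1) := ((h (n + 1)).2 x).1
      _ = V * (c.err (n + 1) / c.err n) * c.err n := by field_simp
      _ ≤ V * (c.err (n + 1) / c.err n) * (V * (level hρ c hc n).m x) := by
          have := (hm x).2
          gcongr
      _ = _ := by ring
  have k2 : (level hρ c hc n).r * ((level hρ c hc (n + 1)).m x / (level hρ c hc n).m x)
      ≤ V ^ 3 * (c.err (n + 1) / √(c.err n)) := by
    calc _ ≤ V * √(c.err n) * (V ^ 2 * (c.err (n + 1) / c.err n)) := by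
          have : 0 < (level hρ c hc (n + 1)).m x / (level hρ c hc n).m x := by positivity
          gcongr
      _ = _ := by nth_rewrite 2 [← hss]; field_simp
  have k3 : (level hρ c hc n).r ^ (2 * τ) ≤ V ^ (2 * τ) / γ * (c.err (n + 1) / √(c.err n)) := by
    calc _ ≤ (V * √(c.err n)) ^ (2 * τ) := by gcongr
      _ = V ^ (2 * τ) / γ * (γ * c.err n ^ τ) := by
          rw [mul_pow, pow_mul √(c.err n), Real.sq_sqrt he.le]; field_simp
      _ ≤ V ^ (2 * τ) / γ * (c.err (n + 1) / √(c.err n)) := by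
          gcongr
          refine (hdio n).trans ?_
          rw [le_div_iff₀ hs]
          exact mul_le_of_le_one_right he'.le hs1
  calc _ ≤ C * (V ^ 3 * (c.err (n + 1) / √(c.err n))
        + V ^ (2 * τ) / γ * (c.err (n + 1) / √(c.err n))) := by
        refine h2.trans ?_
        gcongr
    _ = (C * V ^ 3 + C * V ^ (2 * τ) / γ) * (c.err (n + 1) / √(c.err n)) := by ring
    _ ≤ _ := mul_le_mul_of_nonneg_right (by linarith) (by positivity)

/-- Derivatives of the Birkhoff sums up to order `g` grow slower than every power. -/
def SubpolyBound (f : SmoothCircleDiffeoLift) (g : ℕ) : Prop :=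
  ∀ ε : ℝ, 0 < ε → ∃ C : ℝ, 1 ≤ C ∧ ∀ N j, j ≤ g → ∀ x,
    |iteratedDeriv j (phi f N) x| ≤ C * ((N : ℝ) + 1) ^ ε

lemma exists_iteratedDeriv_ret_sub_le (C₀ S : ℝ) (j : ℕ) : ∃ C : ℝ, 1 ≤ C ∧
    ∀ (f : SmoothCircleDiffeoLift) (q : ℕ) (p : ℤ) (s x : ℝ), s ≤ S →
      |phi f q x| ≤ C₀ → (∀ i ≤ j, |iteratedDeriv i (phi f q) x| ≤ s) →
      ∀ i ≤ j, |iteratedDeriv (i + 1) (fun y => ret f q p y - y) x| ≤ C * s := by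
  obtain ⟨C, hC, h⟩ := exists_bound_of_deriv_eq_mul j S
  set E := Real.exp C₀ with hE
  have hE0 : 0 < E := Real.exp_pos _
  refine ⟨1 + E + 2 ^ j * (C * E), ?_, fun f q p s x hs h0 hi i hij => ?_⟩
  · have : 0 ≤ 2 ^ j * (C * E) := by positivity
    linarith
  have hs0 : 0 ≤ s := (abs_nonneg _).trans (hi 0 (Nat.zero_le _))
  have hexp : |Real.exp (phi f q x)| ≤ E := by
    rw [abs_of_pos (Real.exp_pos _)]
    exact Real.exp_le_exp.2 ((le_abs_self _).trans h0)
  have e1 : deriv (fun y => ret f q p y - y) = fun y => Real.exp (phi f q y) - 1 :=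
    funext fun y => ((hasDerivAt_ret f q p y).sub (hasDerivAt_id y)).deriv
  rw [iteratedDeriv_succ', e1]
  rcases i with _ | i
  · rw [iteratedDeriv_zero]
    have h1 := abs_exp_sub_one_le_mul (phi f q x)
    have h2 : |phi f q x| ≤ s := hi 0 (Nat.zero_le _)
    calc _ ≤ s * E := by
          refine h1.trans ?_
          gcongr
          exact Real.exp_le_exp.2 h0
      _ = E * s := mul_comm _ _
      _ ≤ _ := by
          refine mul_le_mul_of_nonneg_right ?_ hs0
          have : 0 ≤ 2 ^ j * (C * E) := by positivity
          linarith
  · have e2 : deriv (fun y => Real.exp (phi f q y) - 1)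
        = fun y => deriv (phi f q) y * Real.exp (phi f q y) := funext fun y => by
      rw [deriv_sub_const, deriv_exp_phi]
    rw [iteratedDeriv_succ', e2]
    have h3 := abs_iteratedDeriv_mul_le (contDiff_deriv (smooth_phi f q)) (smooth_exp_phi f q)
      (x := x) (A := s) (B := C * E) (lam := 1) hs0 zero_le_one i
      (fun l hl => by
        rw [← iteratedDeriv_succ', one_pow, mul_one]
        exact hi _ (by omega))
      (fun l hl => by
        refine (h (phi f q) _ (smooth_phi f q) (smooth_exp_phi f q) (deriv_exp_phi f q) x 1
          zero_le_one (fun a _ ha => ?_) l (by omega)).trans ?_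
        · rw [one_pow, mul_one]
          exact (hi a ha).trans hs
        · gcongr)
    calc _ ≤ _ := h3
      _ = 2 ^ i * (C * E) * s := by rw [one_pow]; ring
      _ ≤ 2 ^ j * (C * E) * s := by
          gcongr
          · norm_num
          · omega
      _ ≤ _ := by
          refine mul_le_mul_of_nonneg_right ?_ hs0
          linarith

end derivatives

section derivatives

variable {f : SmoothCircleDiffeoLift} {α : ℝ}

lemma phi_eq_cohomologous (f : SmoothCircleDiffeoLift) (q : ℕ) (p : ℤ) {K : ℕ} (hK : 0 < K)
    (y : ℝ) : phi f q y =
      -((K : ℝ)⁻¹ * ∑ N ∈ Finset.range K, phi f N (ret f q p y)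
        - (K : ℝ)⁻¹ * ∑ N ∈ Finset.range K, phi f N y)
      + ((K : ℝ)⁻¹ * ∑ N ∈ Finset.range q, phi f (K + N) y
        - (K : ℝ)⁻¹ * ∑ N ∈ Finset.range q, phi f N y) := by
  have hK' : (K : ℝ) ≠ 0 := by positivity
  have h1 : ∀ N, phi f N (ret f q p y) = phi f (q + N) y - phi f q y := fun N => by
    rw [phi_ret, add_comm, phi_add]; ring
  have h2 : ∑ N ∈ Finset.range (q + K), phi f N y = ∑ N ∈ Finset.range (K + q), phi f N y := by
    rw [add_comm]
  rw [Finset.sum_range_add, Finset.sum_range_add] at h2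
  simp only [h1]
  rw [Finset.sum_sub_distrib, Finset.sum_const, Finset.card_range, nsmul_eq_mul]
  field_simp
  linarith

lemma smooth_sum_phi (f : SmoothCircleDiffeoLift) (a : ℝ) (n s : ℕ) :
    ContDiff ℝ ∞ fun y => a * ∑ N ∈ Finset.range n, phi f (s + N) y :=
  contDiff_const.mul (ContDiff.sum fun i _ => smooth_phi f (s + i))

lemma abs_iteratedDeriv_const_mul_sum_le {w : ℕ → ℝ → ℝ} (hw : ∀ N, ContDiff ℝ ∞ (w N))
    {a A : ℝ} (ha : 0 ≤ a) (n j : ℕ) (x : ℝ) (h : ∀ N < n, |iteratedDeriv j (w N) x| ≤ A) :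
    |iteratedDeriv j (fun y => a * ∑ N ∈ Finset.range n, w N y) x| ≤ a * n * A := by
  rw [iteratedDeriv_const_mul_field, abs_mul, abs_of_nonneg ha,
    iteratedDeriv_fun_sum (f := fun i y => w i y)
      (fun i _ => contDiffAt_nat (hw i) _ _), mul_assoc]
  refine mul_le_mul_of_nonneg_left ?_ ha
  refine (Finset.abs_sum_le_sum_abs _ _).trans ?_
  refine (Finset.sum_le_sum fun i hi => h i (Finset.mem_range.1 hi)).trans (le_of_eq ?_)
  rw [Finset.sum_const, Finset.card_range, nsmul_eq_mul]

lemma abs_iteratedDeriv_sum_phi_le (f : SmoothCircleDiffeoLift) {a A : ℝ} (ha : 0 ≤ a)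
    (n s j : ℕ) (x : ℝ) (h : ∀ N < n, |iteratedDeriv j (phi f (s + N)) x| ≤ A) :
    |iteratedDeriv j (fun y => a * ∑ N ∈ Finset.range n, phi f (s + N) y) x| ≤ a * n * A :=
  abs_iteratedDeriv_const_mul_sum_le (fun N => smooth_phi f (s + N)) ha n j x h

lemma rpow_err_le (c : Convergents α) (n : ℕ) {a b : ℝ} (h : a ≤ b) :
    c.err n ^ b ≤ c.err n ^ a :=
  Real.rpow_le_rpow_of_exponent_ge (c.err_pos n) (err_lt_one c n).le h

lemma exists_phi_q_rpow_le_of_ret_sub (c : Convergents α) {g : ℕ} (hg : SubpolyBound f g)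
    {j : ℕ} (hj : j + 1 ≤ g) {δ C₁ : ℝ} (hδ : 0 < δ) (hδ1 : δ ≤ 1) (hC₁ : 1 ≤ C₁)
    (h₁ : ∀ n i, i ≤ j → ∀ x,
      |iteratedDeriv i (fun y => ret f (c.q n) (c.p n) y - y) x| ≤ C₁ * c.err n ^ (1 - δ)) :
    ∃ C : ℝ, 1 ≤ C ∧ ∀ n i, i ≤ j → ∀ x,
      |iteratedDeriv i (phi f (c.q n)) x| ≤ C * c.err n ^ (1 - 3 * δ) := by
  obtain ⟨C, hC, h⟩ := hg δ hδ
  obtain ⟨C₂, hC₂, h₂⟩ := exists_bound_comp_sub j (E := C₁) (by linarith)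
  refine ⟨C * (3 : ℝ) ^ δ * (C₂ * C₁ + 2), ?_, fun n i hi x => ?_⟩
  · have k1 : (1 : ℝ) ≤ 3 ^ δ := Real.one_le_rpow (by norm_num) hδ.le
    have k2 : 1 ≤ C₂ * C₁ + 2 := by
      have : 0 ≤ C₂ * C₁ := by positivity
      linarith
    exact one_le_mul_of_one_le_of_one_le (one_le_mul_of_one_le_of_one_le hC k1) k2
  set e := c.err n with he
  have he0 : 0 < e := c.err_pos n
  have he1 : e < 1 := err_lt_one c n
  set q := c.q n with hq
  set p := c.p n with hp
  set K := ⌈(e ^ 2)⁻¹⌉₊ with hK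
  have hinv : 1 ≤ (e ^ 2)⁻¹ := (one_le_inv₀ (by positivity)).2 (pow_le_one₀ he0.le he1.le)
  have hK1 : (e ^ 2)⁻¹ ≤ K := Nat.le_ceil _
  have hK2 : (K : ℝ) ≤ (e ^ 2)⁻¹ + 1 := (Nat.ceil_lt_add_one (by positivity)).le
  have hK0 : 0 < K := Nat.ceil_pos.2 (by positivity)
  have hKr : (0 : ℝ) < K := by exact_mod_cast hK0
  have hqe : (q : ℝ) * e ≤ 1 := by
    refine le_trans ?_ (c.q_mul_err_le n)
    have : (q : ℝ) ≤ c.q (n + 1) := by exact_mod_cast (c.q_lt n).le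
    gcongr
  have hqe' : (q : ℝ) ≤ (e ^ 2)⁻¹ := by
    rw [le_inv_comm₀ (by have := c.q_pos n; positivity) (by positivity)]
    rw [le_inv_comm₀ (by positivity) (by have := c.q_pos n; positivity)]
    rw [← one_div, le_div_iff₀ (by positivity)]
    calc (q : ℝ) * e ^ 2 = q * e * e := by ring
      _ ≤ 1 * 1 := by gcongr
      _ = 1 := one_mul _
  set A := C * (3 * (e ^ 2)⁻¹) ^ δ with hA
  have hA0 : 0 ≤ A := by positivity
  have hbound : ∀ N < K + q, ∀ i ≤ g, ∀ y, |iteratedDeriv i (phi f N) y| ≤ A := by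
    intro N hN i hi y
    refine (h N i hi y).trans ?_
    rw [hA]
    have : (N : ℝ) + 1 ≤ K + q := by exact_mod_cast hN
    gcongr
    linarith
  set l : ℝ → ℝ := fun y => (K : ℝ)⁻¹ * ∑ N ∈ Finset.range K, phi f N y with hl
  have hls : ContDiff ℝ ∞ l := by
    have := smooth_sum_phi f (K : ℝ)⁻¹ K 0
    simpa only [zero_add] using this
  have hlb : ∀ i ≤ j + 1, ∀ y, |iteratedDeriv i l y| ≤ A := by
    intro i hi y
    have := abs_iteratedDeriv_sum_phi_le f (a := (K : ℝ)⁻¹) (A := A) (by positivity) K 0 i y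
      (fun N hN => hbound _ (by omega) i (by omega) y)
    simp only [zero_add] at this
    rwa [inv_mul_cancel₀ hKr.ne', one_mul] at this
  have hKq : (K : ℝ)⁻¹ * q ≤ e := by
    rw [inv_mul_le_iff₀ hKr]
    calc (q : ℝ) = q * e * e * (e ^ 2)⁻¹ := by field_simp
      _ ≤ 1 * e * K := by gcongr
      _ = _ := by ring
  have hfun : phi f q = fun y => -(l (ret f q p y) - l y)
      + ((K : ℝ)⁻¹ * ∑ N ∈ Finset.range q, phi f (K + N) y
        - (K : ℝ)⁻¹ * ∑ N ∈ Finset.range q, phi f (0 + N) y) := funext fun y => by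
    simp only [zero_add]
    exact phi_eq_cohomologous f q p hK0 y
  have s1 : ContDiff ℝ ∞ fun y => l (ret f q p y) - l y :=
    (hls.comp (smooth_ret f q p)).sub hls
  have s2 := smooth_sum_phi f (K : ℝ)⁻¹ q K
  have s3 := smooth_sum_phi f (K : ℝ)⁻¹ q 0
  have b1 : |iteratedDeriv i (fun y => l (ret f q p y) - l y) x|
      ≤ C₂ * A * (C₁ * e ^ (1 - δ)) := by
    refine h₂ l (ret f q p) hls (smooth_ret f q p) x A _ ?_ hlb (fun i hi => h₁ n i hi x) i hi
    refine mul_le_of_le_one_right (by linarith) ?_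
    exact Real.rpow_le_one he0.le he1.le (by linarith)
  have b2 : |iteratedDeriv i (fun y => (K : ℝ)⁻¹ * ∑ N ∈ Finset.range q, phi f (K + N) y) x|
      ≤ e * A := by
    refine (abs_iteratedDeriv_sum_phi_le f (A := A) (by positivity) q K i x
      (fun N hN => hbound _ (by omega) i (by omega) x)).trans ?_
    gcongr
  have b3 : |iteratedDeriv i (fun y => (K : ℝ)⁻¹ * ∑ N ∈ Finset.range q, phi f (0 + N) y) x|
      ≤ e * A := by
    refine (abs_iteratedDeriv_sum_phi_le f (A := A) (by positivity) q 0 i x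
      (fun N hN => hbound _ (by omega) i (by omega) x)).trans ?_
    gcongr
  have hAe : A = C * 3 ^ δ * e ^ (-2 * δ) := by
    rw [hA, Real.mul_rpow (by norm_num) (by positivity), Real.inv_rpow (by positivity),
      ← Real.rpow_natCast, ← Real.rpow_mul he0.le, ← Real.rpow_neg he0.le]
    push_cast
    ring_nf
  have p1 : e ^ (-2 * δ) * e ^ (1 - δ) = e ^ (1 - 3 * δ) := by
    rw [← Real.rpow_add he0]; ring_nf
  have p2 : e * e ^ (-2 * δ) ≤ e ^ (1 - 3 * δ) := by
    calc e * e ^ (-2 * δ) = e ^ (1 - 2 * δ) := by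
          nth_rewrite 1 [← Real.rpow_one e]
          rw [← Real.rpow_add he0]; ring_nf
      _ ≤ _ := rpow_err_le c n (by linarith)
  rw [hfun, iteratedDeriv_fun_add (contDiffAt_nat s1.neg _ _) (contDiffAt_nat (s2.sub s3) _ _),
    iteratedDeriv_fun_neg, iteratedDeriv_fun_sub (contDiffAt_nat s2 _ _) (contDiffAt_nat s3 _ _)]
  refine (abs_add_le _ _).trans ?_
  rw [abs_neg]
  refine (add_le_add b1 ((abs_sub _ _).trans (add_le_add b2 b3))).trans ?_
  rw [hAe]
  calc _ = C * 3 ^ δ * (C₂ * C₁ * (e ^ (-2 * δ) * e ^ (1 - δ)) + 2 * (e * e ^ (-2 * δ))) := by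
        ring
    _ ≤ C * 3 ^ δ * (C₂ * C₁ * e ^ (1 - 3 * δ) + 2 * e ^ (1 - 3 * δ)) := by
        rw [p1]
        gcongr
    _ = _ := by ring

lemma exists_phi_q_rpow_le (hρ : IsRotNumber f.toFun α) (c : Convergents α) (hc : c.q 0 = 1)
    (hα : IsDiophantine α) {g : ℕ} (hg : SubpolyBound f g) (j : ℕ) (hj : j + 1 ≤ g) :
    ∀ ε : ℝ, 0 < ε → ∃ C : ℝ, 1 ≤ C ∧ ∀ n i, i ≤ j → ∀ x,
      |iteratedDeriv i (phi f (c.q n)) x| ≤ C * c.err n ^ (1 - ε) := by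
  obtain ⟨V, hV, hVm⟩ := exists_m_comparable hρ c hc hα
  obtain ⟨C₀, hC₀, h₀⟩ := exists_abs_phi_le hρ c hc hα
  have hdispl : ∀ δ : ℝ, 0 < δ → ∀ n x,
      |ret f (c.q n) (c.p n) x - x| ≤ V * c.err n ^ (1 - δ) := by
    intro δ hδ n x
    refine (hVm n x).1.trans ?_
    have := rpow_err_le c n (a := 1 - δ) (b := 1) (by linarith)
    rw [Real.rpow_one] at this
    gcongr
  have red : ∀ j, j + 1 ≤ g → (∀ δ : ℝ, 0 < δ → δ ≤ 1 → ∃ C : ℝ, 1 ≤ C ∧ ∀ n i, i ≤ j → ∀ x,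
      |iteratedDeriv i (fun y => ret f (c.q n) (c.p n) y - y) x| ≤ C * c.err n ^ (1 - δ)) →
      ∀ ε : ℝ, 0 < ε → ∃ C : ℝ, 1 ≤ C ∧ ∀ n i, i ≤ j → ∀ x,
      |iteratedDeriv i (phi f (c.q n)) x| ≤ C * c.err n ^ (1 - ε) := by
    intro j hj H ε hε
    have hδ : 0 < min (ε / 3) 1 := lt_min (by linarith) one_pos
    obtain ⟨C₁, hC₁, h₁⟩ := H _ hδ (min_le_right _ _)
    obtain ⟨C, hC, h⟩ := exists_phi_q_rpow_le_of_ret_sub c hg hj hδ (min_le_right _ _) hC₁ h₁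
    refine ⟨C, hC, fun n i hi x => (h n i hi x).trans ?_⟩
    have := rpow_err_le c n (a := 1 - ε) (b := 1 - 3 * min (ε / 3) 1)
      (by linarith [min_le_left (ε / 3) 1])
    gcongr
  induction j with
  | zero =>
    refine red _ hj fun δ hδ hδ1 => ⟨V, hV, fun n i hi x => ?_⟩
    obtain rfl : i = 0 := by omega
    rw [iteratedDeriv_zero]
    exact hdispl δ hδ n x
  | succ j ih =>
    refine red _ hj fun δ hδ hδ1 => ?_
    obtain ⟨C₁, hC₁, h₁⟩ := ih (by omega) δ hδ
    obtain ⟨C₂, hC₂, h₂⟩ := exists_iteratedDeriv_ret_sub_le C₀ C₁ j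
    refine ⟨max V (C₂ * C₁), hV.trans (le_max_left _ _), fun n i hi x => ?_⟩
    have he := c.err_pos n
    rcases i with _ | i
    · rw [iteratedDeriv_zero]
      refine (hdispl δ hδ n x).trans ?_
      gcongr
      exact le_max_left _ _
    · have hs : C₁ * c.err n ^ (1 - δ) ≤ C₁ :=
        mul_le_of_le_one_right (by linarith)
          (Real.rpow_le_one he.le (err_lt_one c n).le (by linarith))
      refine (h₂ f (c.q n) (c.p n) _ x hs (h₀ _ x) (fun i hi => h₁ n i hi x) i
        (by omega)).trans ?_
      rw [← mul_assoc]
      gcongr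
      exact le_max_right _ _

end derivatives

section derivatives

variable {f : SmoothCircleDiffeoLift} {α : ℝ}

lemma exists_iteratedDeriv_phi_q_le_of_base (hρ : IsRotNumber f.toFun α) (c : Convergents α)
    (hc : c.q 0 = 1) (hα : IsDiophantine α) (m r : ℕ) {δ C : ℝ} (hδ : 0 < δ)
    (hC : 1 ≤ C)
    (h : ∀ n x, |iteratedDeriv m (phi f (c.q (n + 1))) x|
      ≤ C * c.err (n + 1) ^ (1 - δ) * √(c.err n) ^ r / c.err n) :
    ∃ C' : ℝ, 1 ≤ C' ∧ ∀ n i, i ≤ r → ∀ x, |iteratedDeriv (i + m) (phi f (c.q (n + 1))) x|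
      ≤ C' * c.err (n + 1) ^ (1 - (r + 1) * δ) / c.err n := by
  obtain ⟨L, hL⟩ := exists_nat_ge ((1 + m + r) / δ)
  rw [div_le_iff₀ hδ] at hL
  obtain ⟨C₁, hC₁, h₁⟩ := exists_iteratedDeriv_phi_q_le hρ c hc hα (L + r + m)
  obtain ⟨C₂, hC₂, h₂⟩ := exists_landau_bound (L + r)
  refine ⟨C₂ * (C + C₁), by nlinarith, fun n i hi x => ?_⟩
  have hE := c.err_pos n
  have he := c.err_pos (n + 1)
  have he1 := (err_lt_one c (n + 1)).le
  have hE1 := (err_lt_one c n).le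
  have heE : c.err (n + 1) ≤ c.err n := (c.err_succ_lt n).le
  set E := c.err n
  set e := c.err (n + 1)
  have hs : 0 < √E := Real.sqrt_pos.2 hE
  have hs1 : √E ≤ 1 := Real.sqrt_le_one.2 hE1
  have hEs : E ≤ √E := by
    nlinarith [Real.mul_self_sqrt hE.le]
  set s := √E
  have ht : 0 < e ^ δ := Real.rpow_pos_of_pos he _
  have ht1 : e ^ δ ≤ 1 := Real.rpow_le_one he.le he1 hδ.le
  have hd : 0 < s * e ^ δ := by positivity
  have hd1 : s * e ^ δ ≤ 1 := mul_le_one₀ hs1 ht.le ht1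
  have key := h₂ (iteratedDeriv m (phi f (c.q (n + 1))))
    (contDiff_iteratedDeriv (smooth_phi f _) m) _ (C₁ * (s⁻¹) ^ (L + r + m)) (s * e ^ δ) hd (h n)
    (fun y => by
      rw [iteratedDeriv_eq_iterate, iteratedDeriv_eq_iterate, ← Function.iterate_add_apply,
        ← iteratedDeriv_eq_iterate]
      exact h₁ n _ le_rfl y) i (by omega) x
  rw [iteratedDeriv_eq_iterate, iteratedDeriv_eq_iterate, ← Function.iterate_add_apply,
        ← iteratedDeriv_eq_iterate] at key
  refine key.trans ?_
  have e1 : e ^ (1 - δ) * (e ^ δ)⁻¹ ^ r = e ^ (1 - (r + 1) * δ) := by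
    rw [← Real.rpow_neg he.le, ← Real.rpow_natCast, ← Real.rpow_mul he.le, ← Real.rpow_add he]
    ring_nf
  have t1 : C * e ^ (1 - δ) * s ^ r / E * ((s * e ^ δ) ^ i)⁻¹
      ≤ C * (e ^ (1 - (r + 1) * δ) / E) := by
    calc C * e ^ (1 - δ) * s ^ r / E * ((s * e ^ δ) ^ i)⁻¹
        ≤ C * e ^ (1 - δ) * s ^ r / E * ((s * e ^ δ) ^ r)⁻¹ := by
          refine mul_le_mul_of_nonneg_left ?_ (by positivity)
          exact inv_anti₀ (by positivity) (pow_le_pow_of_le_one hd.le hd1 hi)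
      _ = C * ((e ^ (1 - δ) * (e ^ δ)⁻¹ ^ r) / E) := by
          rw [mul_pow, inv_pow]; field_simp
      _ = _ := by rw [e1]
  have t2 : C₁ * (s⁻¹) ^ (L + r + m) * (s * e ^ δ) ^ (L + r - i)
      ≤ C₁ * (e ^ (1 - (r + 1) * δ) / E) := by
    calc C₁ * (s⁻¹) ^ (L + r + m) * (s * e ^ δ) ^ (L + r - i)
        ≤ C₁ * (s⁻¹) ^ (L + r + m) * (s * e ^ δ) ^ L := by
          refine mul_le_mul_of_nonneg_left ?_ (by positivity)
          exact pow_le_pow_of_le_one hd.le hd1 (by omega)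
      _ = C₁ * ((s⁻¹) ^ (m + r) * (e ^ δ) ^ L) := by
          rw [mul_pow, show L + r + m = L + (m + r) by ring, pow_add, inv_pow]
          field_simp
      _ ≤ C₁ * ((e⁻¹) ^ (m + r) * (e ^ δ) ^ L) := by
          have : s⁻¹ ≤ e⁻¹ := inv_anti₀ he (heE.trans hEs)
          gcongr
      _ = C₁ * e ^ (L * δ - (m + r)) := by
          rw [← Real.rpow_neg_one e, ← Real.rpow_natCast, ← Real.rpow_mul he.le,
            ← Real.rpow_natCast, ← Real.rpow_mul he.le, ← Real.rpow_add he]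
          push_cast
          ring_nf
      _ ≤ C₁ * e ^ (1 - (r + 1) * δ) := by
          refine mul_le_mul_of_nonneg_left ?_ (by linarith)
          refine rpow_err_le c (n + 1) ?_
          have : 0 ≤ (r + 1) * δ := by positivity
          linarith
      _ ≤ _ := by
          refine mul_le_mul_of_nonneg_left ?_ (by linarith)
          rw [le_div_iff₀ hE]
          exact mul_le_of_le_one_right (by positivity) hE1
  calc _ ≤ C₂ * (C * (e ^ (1 - (r + 1) * δ) / E) + C₁ * (e ^ (1 - (r + 1) * δ) / E)) := by
        refine mul_le_mul_of_nonneg_left (add_le_add t1 t2) (by linarith)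
    _ = _ := by ring

lemma exists_phi_q_succ_le (hρ : IsRotNumber f.toFun α) (c : Convergents α)
    (hc : c.q 0 = 1) (hα : IsDiophantine α) {g : ℕ} (hg : SubpolyBound f g) {ε : ℝ}
    (hε : 0 < ε) :
    ∃ C : ℝ, 1 ≤ C ∧ ∀ n j, j ≤ g + 1 → ∀ x,
      |iteratedDeriv j (phi f (c.q (n + 1))) x| ≤ C * c.err (n + 1) ^ (1 - ε) / c.err n := by
  have hδ : 0 < min (ε / 3) 1 := lt_min (by linarith) one_pos
  have hδε := min_le_left (ε / 3) 1
  set δ := min (ε / 3) 1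
  rcases g with _ | g
  · obtain ⟨C, hC, h⟩ := exists_abs_phi_q_le hρ c hc hα
    obtain ⟨C', hC', h'⟩ := exists_iteratedDeriv_phi_q_le_of_base hρ c hc hα 0 1 hδ hC
      (fun n x => by
        rw [iteratedDeriv_zero]
        refine (h n x).trans ?_
        have hE := c.err_pos n
        have hs : 0 < √(c.err n) := Real.sqrt_pos.2 hE
        have := rpow_err_le c (n + 1) (a := 1 - δ) (b := 1) (by linarith)
        rw [Real.rpow_one] at this
        calc C * (c.err (n + 1) / √(c.err n)) ≤ C * (c.err (n + 1) ^ (1 - δ) / √(c.err n)) := by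
              gcongr
          _ = C * c.err (n + 1) ^ (1 - δ) * √(c.err n) ^ 1 / (√(c.err n) * √(c.err n)) := by
              field_simp
          _ = _ := by rw [Real.mul_self_sqrt hE.le])
    refine ⟨C', hC', fun n j hj x => (h' n j (by omega) x).trans ?_⟩
    have hE := c.err_pos n
    have := rpow_err_le c (n + 1) (a := 1 - ε) (b := 1 - ((1 : ℕ) + 1) * δ)
      (by push_cast; linarith)
    gcongr
  · obtain ⟨C, hC, h⟩ := exists_phi_q_rpow_le hρ c hc hα hg g le_rfl δ hδ
    obtain ⟨C', hC', h'⟩ := exists_iteratedDeriv_phi_q_le_of_base hρ c hc hα g 2 hδ hC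
      (fun n x => by
        refine (h (n + 1) g le_rfl x).trans ?_
        have hE := c.err_pos n
        rw [Real.sq_sqrt hE.le, mul_div_cancel_right₀ _ hE.ne'])
    refine ⟨max C C', hC.trans (le_max_left _ _), fun n j hj x => ?_⟩
    have hE := c.err_pos n
    have he := c.err_pos (n + 1)
    rcases le_or_gt g j with hgj | hgj
    · obtain ⟨i, rfl⟩ := Nat.exists_eq_add_of_le' hgj
      refine (h' n i (by omega) x).trans ?_
      have := rpow_err_le c (n + 1) (a := 1 - ε) (b := 1 - ((2 : ℕ) + 1) * δ)
        (by push_cast; linarith)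
      gcongr
      exact le_max_right _ _
    · refine (h (n + 1) j hgj.le x).trans ?_
      have := rpow_err_le c (n + 1) (a := 1 - ε) (b := 1 - δ) (by linarith)
      rw [le_div_iff₀ hE]
      refine (mul_le_of_le_one_right (by positivity) (err_lt_one c n).le).trans ?_
      gcongr
      exact le_max_left _ _

end derivatives

section derivatives

variable {f : SmoothCircleDiffeoLift} {α : ℝ}

lemma Convergents.exists_q_le_lt (c : Convergents α) {N : ℕ} (hN : c.q 1 ≤ N) :
    ∃ n, c.q (n + 1) ≤ N ∧ N < c.q (n + 2) := by
  have hmono : StrictMono fun n => c.q (n + 1) := fun a b h => c.q_strictMono (by omega)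
  obtain ⟨n, h₁, h₂⟩ := hmono.exists_between_of_tendsto_atTop hmono.tendsto_atTop
    (x := N + 1) (by simpa using Nat.lt_succ_of_le hN)
  exact ⟨n, by omega, by simpa using h₂⟩

lemma exists_bound_lt (f : SmoothCircleDiffeoLift) (Q k : ℕ) : ∃ C : ℝ, 1 ≤ C ∧ ∀ N < Q,
    ∀ j ≤ k, ∀ x, |iteratedDeriv j (phi f N) x| ≤ C := by
  choose B hB₀ hB using fun N =>
    exists_abs_iteratedDeriv_le_of_periodic (smooth_phi f N) (phi_periodic f N) k
  refine ⟨1 + ∑ N ∈ Finset.range Q, B N, ?_, fun N hN j hj x => ?_⟩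
  · linarith [Finset.sum_nonneg fun N (_ : N ∈ Finset.range Q) => hB₀ N]
  · have := Finset.single_le_sum (fun N _ => hB₀ N) (Finset.mem_range.2 hN)
    linarith [hB N j hj x]

/-- Euclidean division of a time `N` by a denominator `q (n + 1)`. -/
lemma exists_iteratedDeriv_phi_le_mod (c : Convergents α) {C₀ : ℝ}
    (h₀ : ∀ N x, |phi f N x| ≤ C₀) {g : ℕ} (hg : SubpolyBound f g) {δ : ℝ} (hδ : 0 < δ) :
    ∃ C : ℝ, 1 ≤ C ∧ ∀ n N A, (∀ j ≤ g + 1, ∀ x, |iteratedDeriv j (phi f (c.q (n + 1))) x| ≤ A) →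
      ∀ j ≤ g + 1, ∀ x, |iteratedDeriv j (phi f N) x|
        ≤ |iteratedDeriv j (phi f (N % c.q (n + 1))) x|
          + C * (((N : ℝ) + 1) ^ (1 + δ) * c.err n * A) := by
  obtain ⟨C₁, hC₁, h₁⟩ := hg (δ / (g + 1)) (by positivity)
  obtain ⟨C₂, hC₂, h₂⟩ := exists_iteratedDeriv_phi_mul_add_le f h₀ (g + 1) C₁
  refine ⟨2 * C₂, by linarith, fun n N A hA j hj x => ?_⟩
  have hA₀ : 0 ≤ A := (abs_nonneg _).trans (hA 0 (by omega) 0)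
  have hdiv : N / c.q (n + 1) * c.q (n + 1) + N % c.q (n + 1) = N := by
    rw [mul_comm]; exact Nat.div_add_mod _ _
  have hN1 : (1 : ℝ) ≤ (N : ℝ) + 1 := by linarith [(N.cast_nonneg : (0 : ℝ) ≤ N)]
  have hlam : 1 ≤ ((N : ℝ) + 1) ^ (δ / (g + 1)) := Real.one_le_rpow hN1 (by positivity)
  have key := h₂ (c.q (n + 1)) (N / c.q (n + 1)) (N % c.q (n + 1)) A _ hlam hA
    (fun l hl y a ha hag => by
      rw [hdiv] at hl
      refine (h₁ l a (by omega) y).trans (mul_le_mul_of_nonneg_left ?_ (by linarith))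
      refine le_trans ?_ (le_self_pow₀ hlam (by omega))
      gcongr) j hj x
  rw [hdiv] at key
  refine key.trans (add_le_add_right ?_ _)
  have hpow : (((N : ℝ) + 1) ^ (δ / (g + 1))) ^ (g + 1) = ((N : ℝ) + 1) ^ δ := by
    rw [← Real.rpow_natCast, ← Real.rpow_mul (by linarith)]
    push_cast
    congr 1
    field_simp
  have hq : (0 : ℝ) < c.q (n + 1) := by exact_mod_cast c.q_pos _
  have hE := c.err_pos n
  have hb : ((N / c.q (n + 1) : ℕ) : ℝ) ≤ 2 * ((N + 1) * c.err n) := by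
    refine Nat.cast_div_le.trans ?_
    rw [div_le_iff₀ hq]
    have := c.half_le_q_mul_err n
    calc (N : ℝ) ≤ 2 * (N + 1) * (1 / 2) := by linarith
      _ ≤ 2 * (N + 1) * (c.q (n + 1) * c.err n) := by gcongr
      _ = _ := by ring
  rw [hpow, Real.rpow_add (by linarith), Real.rpow_one]
  calc C₂ * ((N / c.q (n + 1) : ℕ) : ℝ) * A * ((N : ℝ) + 1) ^ δ
      ≤ C₂ * (2 * ((N + 1) * c.err n)) * A * ((N : ℝ) + 1) ^ δ := by gcongr
    _ = _ := by ring

lemma Convergents.two_mul_mod_lt (c : Convergents α) {n N : ℕ} (h : c.q (n + 1) ≤ N) :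
    2 * (N % c.q (n + 1)) < N := by
  have := Nat.mod_lt N (c.q_pos (n + 1))
  have h2 := Nat.div_add_mod N (c.q (n + 1))
  have : 1 ≤ N / c.q (n + 1) := Nat.div_pos h (c.q_pos _)
  nlinarith

lemma Convergents.err_succ_le_inv (c : Convergents α) {n N : ℕ} (h : N < c.q (n + 2)) :
    c.err (n + 1) ≤ ((N : ℝ) + 1)⁻¹ := by
  have h1 := c.q_mul_err_le (n + 1)
  have : (N : ℝ) + 1 ≤ c.q (n + 2) := by exact_mod_cast h
  rw [← one_div, le_div_iff₀ (by positivity), mul_comm]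
  exact (mul_le_mul_of_nonneg_right this (c.err_pos _).le).trans h1

lemma subpolyBound_succ (hρ : IsRotNumber f.toFun α) (c : Convergents α)
    (hc : c.q 0 = 1) (hα : IsDiophantine α) {g : ℕ} (hg : SubpolyBound f g) :
    SubpolyBound f (g + 1) := by
  obtain ⟨C₀, hC₀, h₀⟩ := exists_abs_phi_le hρ c hc hα
  intro ε hε
  have hδ : 0 < min (ε / 2) 1 := lt_min (by linarith) one_pos
  have hδ1 := min_le_right (ε / 2) 1
  have hδε := min_le_left (ε / 2) 1
  set δ := min (ε / 2) 1
  obtain ⟨C₁, hC₁, h₁⟩ := exists_phi_q_succ_le hρ c hc hα hg hδ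
  obtain ⟨C₂, hC₂, h₂⟩ := exists_iteratedDeriv_phi_le_mod c h₀ hg hδ
  obtain ⟨C₃, hC₃, h₃⟩ := exists_bound_lt f (c.q 1) (g + 1)
  obtain ⟨C, hC, h⟩ := exists_le_rpow_of_halving (max C₃ (C₂ * C₁)) hε
  refine ⟨C, hC, fun N j hj x => h (fun N => |iteratedDeriv j (phi f N) x|) (c.q 1)
    (fun N hN => (h₃ N hN j hj x).trans (le_max_left _ _)) (fun N hN => ?_) N⟩
  obtain ⟨n, hn₁, hn₂⟩ := c.exists_q_le_lt hN
  refine ⟨N % c.q (n + 1), c.two_mul_mod_lt hn₁,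
    (h₂ n N _ (fun j hj x => h₁ n j hj x) j hj x).trans (add_le_add_right ?_ _)⟩
  have hE := c.err_pos n
  have he := c.err_pos (n + 1)
  have hN0 : (0 : ℝ) < (N : ℝ) + 1 := by positivity
  have hp : c.err (n + 1) ^ (1 - δ) ≤ ((N : ℝ) + 1) ^ (-(1 - δ)) := by
    rw [Real.rpow_neg hN0.le, ← Real.inv_rpow hN0.le]
    exact Real.rpow_le_rpow he.le (c.err_succ_le_inv hn₂) (by linarith)
  calc C₂ * (((N : ℝ) + 1) ^ (1 + δ) * c.err n * (C₁ * c.err (n + 1) ^ (1 - δ) / c.err n))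
      = C₂ * C₁ * (((N : ℝ) + 1) ^ (1 + δ) * c.err (n + 1) ^ (1 - δ)) := by field_simp
    _ ≤ C₂ * C₁ * (((N : ℝ) + 1) ^ (1 + δ) * ((N : ℝ) + 1) ^ (-(1 - δ))) := by gcongr
    _ = C₂ * C₁ * ((N : ℝ) + 1) ^ (2 * δ) := by rw [← Real.rpow_add hN0]; ring_nf
    _ ≤ max C₃ (C₂ * C₁) * ((N : ℝ) + 1) ^ ε := by
      refine mul_le_mul (le_max_right _ _) ?_ (by positivity) (by positivity)
      exact Real.rpow_le_rpow_of_exponent_le (by linarith [(N.cast_nonneg : (0 : ℝ) ≤ N)])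
        (by linarith)

lemma subpolyBound (hρ : IsRotNumber f.toFun α) (c : Convergents α)
    (hc : c.q 0 = 1) (hα : IsDiophantine α) (g : ℕ) : SubpolyBound f g := by
  induction g with
  | zero =>
    obtain ⟨C₀, hC₀, h₀⟩ := exists_abs_phi_le hρ c hc hα
    refine fun ε hε => ⟨C₀, hC₀, fun N j hj x => ?_⟩
    obtain rfl : j = 0 := by omega
    rw [iteratedDeriv_zero]
    refine (h₀ N x).trans (le_mul_of_one_le_right (by linarith) ?_)
    exact Real.one_le_rpow (by linarith [(N.cast_nonneg : (0 : ℝ) ≤ N)]) hε.le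
  | succ g ih => exact subpolyBound_succ hρ c hc hα ih

/-- The family `log D(f^N)` is bounded in every `C^k` norm. -/
lemma exists_iteratedDeriv_phi_le (hρ : IsRotNumber f.toFun α) (c : Convergents α)
    (hc : c.q 0 = 1) (hα : IsDiophantine α) (k : ℕ) :
    ∃ C : ℝ, 1 ≤ C ∧ ∀ N j, j ≤ k → ∀ x, |iteratedDeriv j (phi f N) x| ≤ C := by
  obtain ⟨C₀, hC₀, h₀⟩ := exists_abs_phi_le hρ c hc hα
  obtain ⟨γ, hγ, hγ1, τ, hτ, hγτ⟩ := exists_pow_err_le c hα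
  have hτ0 : (0 : ℝ) < τ := by exact_mod_cast hτ
  have hτ1 : (1 : ℝ) ≤ τ := by exact_mod_cast hτ
  have hδ : 0 < 1 / (4 * τ : ℝ) := by positivity
  have hδ1 : 1 / (4 * τ : ℝ) ≤ 1 := by rw [div_le_one (by positivity)]; linarith
  set δ := 1 / (4 * τ : ℝ) with hδdef
  obtain ⟨C₁, hC₁, h₁⟩ := exists_phi_q_rpow_le hρ c hc hα (subpolyBound hρ c hc hα (k + 2))
    (k + 1) le_rfl δ hδ
  obtain ⟨C₂, hC₂, h₂⟩ := exists_iteratedDeriv_phi_le_mod c h₀ (subpolyBound hρ c hc hα k) hδ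
  obtain ⟨C₃, hC₃, h₃⟩ := exists_bound_lt f (c.q 1) (k + 1)
  have hγi : 0 < γ⁻¹ ^ (1 / (τ : ℝ)) := by positivity
  obtain ⟨C, hC, h⟩ := exists_le_of_halving (max C₃ (C₂ * C₁ * γ⁻¹ ^ (1 / (τ : ℝ))))
    (ε := 2 * δ) (by linarith)
  refine ⟨C, hC, fun N j hj x => h (fun N => |iteratedDeriv j (phi f N) x|) (c.q 1)
    (fun N hN => (h₃ N hN j (by omega) x).trans (le_max_left _ _)) (fun N hN => ?_) N⟩
  obtain ⟨n, hn₁, hn₂⟩ := c.exists_q_le_lt hN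
  refine ⟨N % c.q (n + 1), c.two_mul_mod_lt hn₁,
    (h₂ n N _ (fun j hj x => h₁ (n + 1) j hj x) j (by omega) x).trans (add_le_add_right ?_ _)⟩
  have hE := c.err_pos n
  have he := c.err_pos (n + 1)
  have hN0 : (0 : ℝ) < (N : ℝ) + 1 := by positivity
  have hinv := c.err_succ_le_inv hn₂
  have hp : c.err (n + 1) ^ (1 - δ) ≤ ((N : ℝ) + 1) ^ (-(1 - δ)) := by
    rw [Real.rpow_neg hN0.le, ← Real.inv_rpow hN0.le]
    exact Real.rpow_le_rpow he.le hinv (by linarith)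
  have hEp : c.err n ≤ γ⁻¹ ^ (1 / (τ : ℝ)) * ((N : ℝ) + 1) ^ (-(4 * δ)) := by
    have e1 : c.err n ^ τ ≤ γ⁻¹ * ((N : ℝ) + 1)⁻¹ := by
      rw [← div_eq_inv_mul, le_div_iff₀ hγ, mul_comm]
      exact (hγτ n).trans hinv
    calc c.err n = (c.err n ^ τ) ^ (1 / (τ : ℝ)) := by
          rw [one_div, Real.pow_rpow_inv_natCast hE.le (by omega)]
      _ ≤ (γ⁻¹ * ((N : ℝ) + 1)⁻¹) ^ (1 / (τ : ℝ)) := by gcongr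
      _ = _ := by
          rw [Real.mul_rpow (by positivity) (by positivity), Real.inv_rpow hN0.le (1 / (τ : ℝ)),
            ← Real.rpow_neg hN0.le]
          congr 2
          rw [hδdef]; field_simp
  calc C₂ * (((N : ℝ) + 1) ^ (1 + δ) * c.err n * (C₁ * c.err (n + 1) ^ (1 - δ)))
      = C₂ * C₁ * (c.err n * (((N : ℝ) + 1) ^ (1 + δ) * c.err (n + 1) ^ (1 - δ))) := by ring
    _ ≤ C₂ * C₁ * (γ⁻¹ ^ (1 / (τ : ℝ)) * ((N : ℝ) + 1) ^ (-(4 * δ)) *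
        (((N : ℝ) + 1) ^ (1 + δ) * ((N : ℝ) + 1) ^ (-(1 - δ)))) := by gcongr
    _ = C₂ * C₁ * γ⁻¹ ^ (1 / (τ : ℝ)) * (((N : ℝ) + 1) ^ (-(4 * δ)) *
        (((N : ℝ) + 1) ^ (1 + δ) * ((N : ℝ) + 1) ^ (-(1 - δ)))) := by ring
    _ = C₂ * C₁ * γ⁻¹ ^ (1 / (τ : ℝ)) * ((N : ℝ) + 1) ^ (-(2 * δ)) := by
      rw [← Real.rpow_add hN0, ← Real.rpow_add hN0]; ring_nf
    _ ≤ _ := by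
      refine mul_le_mul_of_nonneg_right (le_max_right _ _) (by positivity)

end derivatives

lemma exists_tendsto_of_bounded (U : Ultrafilter ℕ) {a : ℕ → ℝ} {C : ℝ} (h : ∀ N, |a N| ≤ C) :
    ∃ b, Tendsto a U (𝓝 b) := by
  obtain ⟨b, -, hb⟩ := (isCompact_Icc (a := -C) (b := C)).ultrafilter_le_nhds (U.map a)
    (by
      rw [le_principal_iff]
      exact Filter.univ_mem' (f := (U : Filter ℕ)) fun N => abs_le.1 (h N))
  exact ⟨b, hb⟩

lemma abs_sub_le_of_abs_deriv_le {g : ℝ → ℝ} (hg : Differentiable ℝ g) {x y C : ℝ}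
    (h : ∀ z ∈ Set.uIcc x y, |deriv g z| ≤ C) : |g y - g x| ≤ C * |y - x| :=
  (convex_uIcc x y).norm_image_sub_le_of_norm_deriv_le (fun z _ => hg z) h
    Set.left_mem_uIcc Set.right_mem_uIcc

lemma abs_taylor_le {g : ℝ → ℝ} (hg : ContDiff ℝ ∞ g) {C : ℝ}
    (h : ∀ z, |iteratedDeriv 2 g z| ≤ C) (x y : ℝ) :
    |g y - g x - deriv g x * (y - x)| ≤ C * (y - x) ^ 2 := by
  have hd := differentiable_of_smooth hg
  have hd' : Differentiable ℝ (deriv g) := differentiable_of_smooth (contDiff_deriv hg)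
  have hder : ∀ z, HasDerivAt (fun z => g z - deriv g x * z) (deriv g z - deriv g x) z := fun z =>
    ((hd z).hasDerivAt.sub ((hasDerivAt_id z).const_mul _)).congr_deriv (by simp)
  have key := abs_sub_le_of_abs_deriv_le (g := fun z => g z - deriv g x * z) (x := x) (y := y)
    (C := C * |y - x|) (fun z => (hder z).differentiableAt) (fun z hz => by
      rw [(hder z).deriv]
      refine (abs_sub_le_of_abs_deriv_le hd' (C := C) (fun w _ => ?_)).trans ?_
      · have := h w
        rwa [iteratedDeriv_succ, iteratedDeriv_one] at this
      · refine mul_le_mul_of_nonneg_left ?_ ((abs_nonneg _).trans (h x))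
        exact Set.abs_sub_left_of_mem_uIcc hz)
  rw [mul_assoc, abs_mul_abs_self] at key
  convert key using 2 <;> ring

/-- Ultrafilter limits of smooth functions with bounded derivatives are smooth. -/
lemma exists_smooth_limit (U : Ultrafilter ℕ) {u : ℕ → ℝ → ℝ} (hu : ∀ N, ContDiff ℝ ∞ (u N))
    (h₀ : ∀ x, ∃ C, ∀ N, |u N x| ≤ C)
    (h : ∀ k, ∃ C, ∀ N x, |iteratedDeriv (k + 1) (u N) x| ≤ C) :
    ∃ v : ℝ → ℝ, ContDiff ℝ ∞ v ∧ (∀ x, Tendsto (fun N => u N x) U (𝓝 (v x))) ∧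
      ∀ x, Tendsto (fun N => deriv (u N) x) U (𝓝 (deriv v x)) := by
  have hlim : ∀ k x, ∃ b, Tendsto (fun N => iteratedDeriv k (u N) x) U (𝓝 b) := by
    intro k x
    rcases k with _ | k
    · obtain ⟨C, hC⟩ := h₀ x
      exact exists_tendsto_of_bounded U (C := C) (by simpa using hC)
    · obtain ⟨C, hC⟩ := h k
      exact exists_tendsto_of_bounded U fun N => hC N x
  choose v hv using hlim
  have hder : ∀ k x, HasDerivAt (v k) (v (k + 1) x) x := by
    intro k x
    obtain ⟨C, hC⟩ := h (k + 1)
    have key : ∀ y, |v k y - v k x - v (k + 1) x * (y - x)| ≤ C * (y - x) ^ 2 := by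
      intro y
      refine le_of_tendsto (((hv k y).sub (hv k x)).sub
        ((hv (k + 1) x).mul_const (y - x))).abs (Eventually.of_forall fun N => ?_)
      rw [iteratedDeriv_succ]
      refine abs_taylor_le (contDiff_iteratedDeriv (hu N) k) (fun z => ?_) x y
      rw [iteratedDeriv_succ, iteratedDeriv_one, ← iteratedDeriv_succ, ← iteratedDeriv_succ]
      exact hC N z
    rw [hasDerivAt_iff_isLittleO]
    have hO : (fun y => v k y - v k x - (y - x) • v (k + 1) x) =O[𝓝 x] fun y => (y - x) ^ 2 :=
      Asymptotics.IsBigO.of_bound C (Eventually.of_forall fun y => by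
        rw [smul_eq_mul, mul_comm, Real.norm_eq_abs, Real.norm_eq_abs,
          abs_of_nonneg (sq_nonneg (y - x))]
        exact key y)
    refine hO.trans_isLittleO ?_
    have : (fun y : ℝ => (y - x) ^ 2) = fun y => (y - x) * (y - x) := funext fun y => sq _
    rw [this]
    have h1 : (fun y : ℝ => y - x) =o[𝓝 x] fun _ => (1 : ℝ) := by
      rw [Asymptotics.isLittleO_one_iff]
      have : Tendsto (fun y : ℝ => y - x) (𝓝 x) (𝓝 (x - x)) :=
        (continuous_id.sub continuous_const).tendsto x
      rwa [sub_self] at this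
    simpa using h1.mul_isBigO (Asymptotics.isBigO_refl (fun y : ℝ => y - x) (𝓝 x))
  have hderiv : ∀ k, deriv (v k) = v (k + 1) := fun k => funext fun x => (hder k x).deriv
  have hsmooth : ∀ n : ℕ, ∀ k, ContDiff ℝ n (v k) := by
    intro n
    induction n with
    | zero =>
      intro k
      exact contDiff_zero.2 (continuous_iff_continuousAt.2 fun x => (hder k x).continuousAt)
    | succ n ih =>
      intro k
      push_cast
      rw [contDiff_succ_iff_deriv]
      refine ⟨fun x => (hder k x).differentiableAt, by simp, ?_⟩
      rw [hderiv]
      exact ih _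
  refine ⟨v 0, contDiff_infty.2 fun n => hsmooth n 0, fun x => by simpa using hv 0 x, fun x => ?_⟩
  rw [hderiv]
  simpa using hv 1 x

section derivatives

variable {f : SmoothCircleDiffeoLift} {α : ℝ}

/-- The Birkhoff averages whose limit is the linearization. -/
noncomputable def average (f : SmoothCircleDiffeoLift) (α : ℝ) (N : ℕ) (x : ℝ) : ℝ :=
  (N : ℝ)⁻¹ * ∑ n ∈ Finset.range N, (f.toFun^[n] x - n * α)

lemma smooth_average (N : ℕ) : ContDiff ℝ ∞ (average f α N) :=
  contDiff_const.mul (ContDiff.sum fun n _ => (smooth_iterate f n).sub contDiff_const)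

lemma abs_average_le (hρ : IsRotNumber f.toFun α) (N : ℕ) (x : ℝ) :
    |average f α N x| ≤ |x| + 1 := by
  rcases N.eq_zero_or_pos with rfl | hN
  · simpa [average] using by positivity
  · have hN' : (0 : ℝ) < N := by exact_mod_cast hN
    rw [average, abs_mul, abs_of_pos (inv_pos.2 hN'), inv_mul_le_iff₀ hN']
    refine (Finset.abs_sum_le_sum_abs _ _).trans ?_
    have : ∀ n ∈ Finset.range N, |f.toFun^[n] x - n * α| ≤ |x| + 1 := fun n _ => by
      have := abs_add_le x (f.toFun^[n] x - x - n * α)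
      rw [show x + (f.toFun^[n] x - x - n * α) = f.toFun^[n] x - n * α by ring] at this
      linarith [abs_iterate_sub_le hρ n x]
    simpa [mul_add] using Finset.sum_le_sum this

lemma iteratedDeriv_average_le (h : ∀ k, ∃ C : ℝ, 1 ≤ C ∧ ∀ N j, j ≤ k → ∀ x,
    |iteratedDeriv j (phi f N) x| ≤ C) (k : ℕ) :
    ∃ C, ∀ N x, |iteratedDeriv (k + 1) (average f α N) x| ≤ C := by
  obtain ⟨C, hC, hb⟩ := h k
  obtain ⟨C', hC', hb'⟩ := exists_bound_of_deriv_eq_mul k C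
  have hit : ∀ n x, |iteratedDeriv (k + 1) (fun y => f.toFun^[n] y - n * α) x|
      ≤ C' * Real.exp C := by
    intro n x
    have hd : deriv (fun y => f.toFun^[n] y - n * α) = fun y => Real.exp (phi f n y) :=
      funext fun y => ((hasDerivAt_iterate f n y).sub_const _).deriv
    rw [iteratedDeriv_succ', hd]
    have := hb' (phi f n) _ (smooth_phi f n) (smooth_exp_phi f n) (deriv_exp_phi f n) x 1
      zero_le_one (fun a _ ha => by simpa using hb n a ha x) k le_rfl
    rw [one_pow, mul_one, abs_of_pos (Real.exp_pos _)] at this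
    refine this.trans ?_
    have h0 := hb n 0 (by omega) x
    rw [iteratedDeriv_zero] at h0
    gcongr
    exact (abs_le.1 h0).2
  refine ⟨C' * Real.exp C, fun N x => ?_⟩
  refine (abs_iteratedDeriv_const_mul_sum_le (w := fun n y => f.toFun^[n] y - n * α)
    (fun n => (smooth_iterate f n).sub contDiff_const) (inv_nonneg.2 N.cast_nonneg) N (k + 1) x
    (fun n _ => hit n x)).trans ?_
  refine mul_le_of_le_one_left (by positivity) ?_
  exact inv_mul_le_one

lemma le_deriv_average {C : ℝ} (h : ∀ N x, |phi f N x| ≤ C) {N : ℕ} (hN : 0 < N) (x : ℝ) :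
    Real.exp (-C) ≤ deriv (average f α N) x := by
  have hN' : (0 : ℝ) < N := by exact_mod_cast hN
  have hd : HasDerivAt (average f α N)
      ((N : ℝ)⁻¹ * ∑ n ∈ Finset.range N, Real.exp (phi f n x)) x :=
    (HasDerivAt.fun_sum fun n _ => (hasDerivAt_iterate f n x).sub_const _).const_mul _
  rw [hd.deriv, le_inv_mul_iff₀ hN']
  have : ∀ n ∈ Finset.range N, Real.exp (-C) ≤ Real.exp (phi f n x) := fun n _ =>
    Real.exp_le_exp.2 (abs_le.1 (h n x)).1
  simpa using Finset.sum_le_sum this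

lemma average_add_one {N : ℕ} (hN : 0 < N) (x : ℝ) :
    average f α N (x + 1) = average f α N x + 1 := by
  have hN' : (N : ℝ) ≠ 0 := by positivity
  have h : ∀ n : ℕ, f.toFun^[n] (x + 1) - n * α = f.toFun^[n] x - n * α + 1 := fun n => by
    rw [iterate_add_one]; ring
  simp only [average, h]
  rw [Finset.sum_add_distrib]
  rw [Finset.sum_const, Finset.card_range, nsmul_eq_mul, mul_one, mul_add, inv_mul_cancel₀ hN']

lemma average_map (N : ℕ) (x : ℝ) :
    average f α N (f.toFun x) = average f α N x + (f.toFun^[N] x - x) / N := by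
  have h := Finset.sum_range_sub (fun n => f.toFun^[n] x) N
  rw [average, average, div_eq_inv_mul, ← mul_add]
  congr 1
  rw [← sub_eq_iff_eq_add', ← Finset.sum_sub_distrib]
  simp only [← Function.iterate_succ_apply, sub_sub_sub_cancel_right]
  simpa only [Function.iterate_zero, id_eq] using h

lemma exists_linearization (hρ : IsRotNumber f.toFun α) (h : ∀ k, ∃ C : ℝ, 1 ≤ C ∧ ∀ N j, j ≤ k →
    ∀ x, |iteratedDeriv j (phi f N) x| ≤ C) :
    ∃ H : ℝ → ℝ, ContDiff ℝ ∞ H ∧ (∀ x, 0 < deriv H x) ∧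
      (∀ x, H (x + 1) = H x + 1) ∧ ∀ x, H (f.toFun x) = H x + α := by
  have hpos : ∀ᶠ N : ℕ in (hyperfilter ℕ : Filter ℕ), 0 < N :=
    Nat.hyperfilter_le_atTop (eventually_gt_atTop 0)
  obtain ⟨H, hs, hH, hH'⟩ := exists_smooth_limit (hyperfilter ℕ) (u := average f α) smooth_average
    (fun x => ⟨_, fun N => abs_average_le hρ N x⟩) (iteratedDeriv_average_le h)
  obtain ⟨C, -, hC⟩ := h 0
  refine ⟨H, hs, fun x => ?_, fun x => ?_, fun x => ?_⟩
  · refine (Real.exp_pos (-C)).trans_le (ge_of_tendsto (hH' x) ?_)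
    filter_upwards [hpos] with N hN
    exact le_deriv_average (fun N x => by simpa using hC N 0 le_rfl x) hN x
  · refine tendsto_nhds_unique_of_eventuallyEq (hH (x + 1)) ((hH x).add_const 1) ?_
    filter_upwards [hpos] with N hN
    exact average_add_one hN x
  · refine tendsto_nhds_unique (hH (f.toFun x)) ?_
    simp only [average_map]
    exact (hH x).add ((hρ x).mono_left Nat.hyperfilter_le_atTop)

end derivatives

end HermanYoccoz

/-- **Herman–Yoccoz global theorem.** Any orientation-preserving `C^∞` circle diffeomorphism
whose rotation number `α` is Diophantine is `C^∞`-linearizable: there is a lift `H` of a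
`C^∞` circle diffeomorphism with `H ∘ f = H + α`. -/
theorem herman_yoccoz (f : SmoothCircleDiffeoLift) (α : ℝ)
    (hρ : IsRotNumber f.toFun α) (hα : IsDiophantine α) :
    ∃ H : ℝ → ℝ, ContDiff ℝ (⊤ : ℕ∞) H ∧ (∀ x, 0 < deriv H x) ∧
      (∀ x, H (x + 1) = H x + 1) ∧ ∀ x, H (f.toFun x) = H x + α := by
  obtain ⟨γ, hγ, τ, -, h⟩ := HermanYoccoz.exists_pow_le_of_isDiophantine hα
  obtain ⟨c, hc⟩ := HermanYoccoz.exists_convergents fun q p hq => abs_pos.1 <|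
    (by positivity : 0 < γ / (q : ℝ) ^ τ).trans_le (h q p hq)
  exact HermanYoccoz.exists_linearization hρ
    (HermanYoccoz.exists_iteratedDeriv_phi_le hρ c hc hα)
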